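/- For every constant C ≥ 2 there exists a constant A > 0 such that for all K > 0 and δ ∈ (0,1) there exists n₀ with the following property: for all integers n ≥ n₀ and m, setting d = 2m/n and μ = d/(n−1), if (log n)^K / n < μ ≤ δ·(log n)^{−3/4}, then for every sequence d = (d_1,…,d_n) of nonnegative integers satisfying (i) Σ_i d_i = 2m, (ii) |d_i − d| ≤ C√(d log n) for all i ∈ [n], and (iii) σ²(d) := (1/n) Σ_i (d_i − d)² ≤ 2d, one has Pr_{D(G(n,m))}(d) = Pr_{B_m}(d) · exp( 1/4 − γ₂²/(4μ²(1−μ)²) ) · (1 + E) with |E| ≤ A·( 1/√d + d√(log n)/n + d²(log n)^{3/2}/n² ), where γ₂ = (n−1)^{−2} Σ_i (d_i − d)². -/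

import Mathlib

open Finset

noncomputable section

/-- Simple graphs on vertex set `[n]`, encoded as finsets of non-diagonal unordered pairs. -/
def Graphs (n : ℕ) : Finset (Finset (Sym2 (Fin n))) :=
  Finset.univ.filter (fun E => ∀ e ∈ E, ¬ e.IsDiag)

/-- Degree of vertex `i` in the graph `E`. -/
def deg {n : ℕ} (E : Finset (Sym2 (Fin n))) (i : Fin n) : ℕ :=
  (E.filter (fun e => i ∈ e)).card

/-- Number of simple graphs on `[n]` with degree sequence `D`. -/
def gcount (n : ℕ) (D : Fin n → ℕ) : ℕ :=
  ((Graphs n).filter (fun E => ∀ i, deg E i = D i)).card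

/-- `Pr_{D(G(n,m))}(D)`: probability that a uniformly random graph on `[n]` with exactly `m`
edges has degree sequence `D`. -/
def prG (n m : ℕ) (D : Fin n → ℕ) : ℝ :=
  (((Graphs n).filter (fun E => E.card = m ∧ ∀ i, deg E i = D i)).card : ℝ) /
    (((Graphs n).filter (fun E => E.card = m)).card : ℝ)

/-- `Pr_{B_m}(D)`: probability of `D` for `n` independent `Bin(n-1,p)` variables conditioned
on the sum being `2m` (independent of `p`). -/
def prB (n m : ℕ) (D : Fin n → ℕ) : ℝ :=
  if ∑ i, D i = 2 * m then
    (∏ i, ((n - 1).choose (D i) : ℝ)) / ((n * (n - 1)).choose (2 * m) : ℝ)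
  else 0

def ev {n : ℕ} (a : Fin n) : Fin n → ℤ := Pi.single a 1

def GS {n : ℕ} (z : Fin n → ℤ) : Finset (Finset (Sym2 (Fin n))) :=
  (Graphs n).filter (fun E => ∀ i, (deg E i : ℤ) = z i)

def NN {n : ℕ} (z : Fin n → ℤ) : ℝ := ((GS z).card : ℝ)

def EC {n : ℕ} (z : Fin n → ℤ) (a v : Fin n) : ℝ :=
  (((GS z).filter (fun E => s(a, v) ∈ E)).card : ℝ)

lemma ev_self {n : ℕ} (a : Fin n) : ev a a = 1 := by simp [ev]
lemma ev_ne {n : ℕ} {a i : Fin n} (h : i ≠ a) : ev a i = 0 := by simp [ev, h]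
lemma ev_apply {n : ℕ} (a i : Fin n) : ev a i = if i = a then 1 else 0 := by
  simp [ev, Pi.single_apply]
lemma sum_ev {n : ℕ} (a : Fin n) : ∑ i, ev a i = 1 := by simp [ev_apply]

lemma mem_Graphs {n : ℕ} {E : Finset (Sym2 (Fin n))} :
    E ∈ Graphs n ↔ ∀ a, s(a, a) ∉ E := by
  unfold Graphs
  simp only [mem_filter, mem_univ, true_and]
  constructor
  · intro h a ha; exact h _ ha (by simp)
  · intro h e he hd
    induction e with | _ x y =>
    simp at hd; subst hd; exact h _ he

lemma deg_insert {n : ℕ} {E : Finset (Sym2 (Fin n))} {a v : Fin n} (hav : a ≠ v)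
    (h : s(a, v) ∉ E) (i : Fin n) :
    (deg (insert s(a, v) E) i : ℤ) = deg E i + ev a i + ev v i := by
  unfold deg
  rw [filter_insert]
  simp only [ev_apply]
  by_cases h1 : i = a
  · subst h1
    have : s(i, v) ∉ filter (fun e => i ∈ e) E := fun h2 => h (mem_filter.1 h2).1
    simp [card_insert_of_notMem this, hav]
  · by_cases h2 : i = v
    · subst h2
      have : s(a, i) ∉ filter (fun e => i ∈ e) E := fun h2 => h (mem_filter.1 h2).1
      simp [card_insert_of_notMem this, h1]
    · simp [h1, h2]

lemma deg_erase {n : ℕ} {E : Finset (Sym2 (Fin n))} {a v : Fin n} (hav : a ≠ v)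
    (h : s(a, v) ∈ E) (i : Fin n) :
    (deg (E.erase s(a, v)) i : ℤ) = deg E i - ev a i - ev v i := by
  have := deg_insert hav (notMem_erase s(a, v) E) i
  rw [insert_erase h] at this
  linarith

lemma Graphs_insert {n : ℕ} {E : Finset (Sym2 (Fin n))} {a v : Fin n} (hav : a ≠ v)
    (h : E ∈ Graphs n) : insert s(a, v) E ∈ Graphs n := by
  rw [mem_Graphs] at *
  intro c hc
  rw [mem_insert] at hc
  rcases hc with hc | hc
  · simp at hc
    rcases hc with hc | hc
    · exact hav (hc.1.symm.trans hc.2)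
    · exact hav (hc.2.symm.trans hc.1)
  · exact h c hc

lemma Graphs_erase {n : ℕ} {E : Finset (Sym2 (Fin n))} {e}
    (h : E ∈ Graphs n) : E.erase e ∈ Graphs n := by
  rw [mem_Graphs] at *
  intro c hc
  exact h c (mem_of_mem_erase hc)

lemma mem_GS {n : ℕ} {z : Fin n → ℤ} {E : Finset (Sym2 (Fin n))} :
    E ∈ GS z ↔ E ∈ Graphs n ∧ ∀ i, (deg E i : ℤ) = z i := by
  unfold GS; simp

lemma NN_split {n : ℕ} (z : Fin n → ℤ) (a v : Fin n) :
    NN z - EC z a v = (((GS z).filter (fun E => s(a, v) ∉ E)).card : ℝ) := by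
  unfold NN EC
  rw [← card_filter_add_card_filter_not (s := GS z) (fun E => s(a, v) ∈ E)]
  push_cast; ring

lemma F1 {n : ℕ} (z : Fin n → ℤ) {a v : Fin n} (hav : a ≠ v) :
    EC z a v = NN (z - ev a - ev v) - EC (z - ev a - ev v) a v := by
  rw [NN_split]; unfold EC
  congr 1
  refine card_bij' (fun E _ => E.erase s(a, v)) (fun E _ => insert s(a, v) E) ?_ ?_ ?_ ?_
  · intro E hE
    simp only [mem_filter, mem_GS] at *
    refine ⟨⟨Graphs_erase hE.1.1, fun i => ?_⟩, notMem_erase _ _⟩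
    rw [deg_erase hav hE.2, hE.1.2]; simp
  · intro E hE
    simp only [mem_filter, mem_GS] at *
    refine ⟨⟨Graphs_insert hav hE.1.1, fun i => ?_⟩, mem_insert_self _ _⟩
    rw [deg_insert hav hE.2, hE.1.2]; simp only [Pi.sub_apply]; ring
  · intro E hE
    exact insert_erase (mem_filter.1 hE).2
  · intro E hE
    exact erase_insert (mem_filter.1 hE).2

def nb {n : ℕ} (E : Finset (Sym2 (Fin n))) (a : Fin n) : Finset (Fin n) :=
  univ.filter (fun v => s(a, v) ∈ E)

lemma mem_nb {n : ℕ} {E : Finset (Sym2 (Fin n))} {a v : Fin n} : v ∈ nb E a ↔ s(a, v) ∈ E := by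
  simp [nb]

lemma card_nb {n : ℕ} (E : Finset (Sym2 (Fin n))) (a : Fin n) : (nb E a).card = deg E a := by
  unfold deg
  apply card_bij (fun v _ => s(a, v))
  · intro v hv; rw [mem_nb] at hv; simp [hv]
  · intro v _ w _ h; exact Sym2.congr_right.1 h
  · intro e he
    rw [mem_filter] at he
    obtain ⟨w, rfl⟩ := he.2
    exact ⟨w, by rw [mem_nb]; exact he.1, rfl⟩

lemma F2 {n : ℕ} (z : Fin n → ℤ) (a : Fin n) :
    ∑ v ∈ univ.erase a, EC z a v = z a * NN z := by
  unfold EC NN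
  have h1 : ∑ v, (((GS z).filter (fun E => s(a, v) ∈ E)).card) = ∑ E ∈ GS z, (nb E a).card := by
    simp only [card_filter, nb]
    rw [sum_comm]
  have h2 : (((GS z).filter (fun E => s(a, a) ∈ E)).card) = 0 := by
    rw [card_eq_zero, filter_eq_empty_iff]
    intro E hE
    exact mem_Graphs.1 (mem_GS.1 hE).1 a
  rw [← Nat.cast_sum]
  rw [← add_sum_erase univ _ (mem_univ a), h2, zero_add] at h1
  rw [h1]
  push_cast
  rw [sum_congr rfl (fun E hE => ?_), sum_const, nsmul_eq_mul, mul_comm]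
  rw [card_nb]
  have := (mem_GS.1 hE).2 a
  exact_mod_cast this

lemma sum_deg {n : ℕ} {E : Finset (Sym2 (Fin n))} (hE : E ∈ Graphs n) :
    ∑ i, deg E i = 2 * E.card := by
  unfold deg
  simp only [card_filter]
  rw [sum_comm, mul_comm, ← smul_eq_mul, ← sum_const]
  apply sum_congr rfl
  intro e he
  induction e with | _ x y =>
  have hxy : x ≠ y := by rintro rfl; exact mem_Graphs.1 hE _ he
  rw [← card_filter]
  have : filter (fun i => i ∈ s(x, y)) univ = {x, y} := by ext i; simp
  rw [this, card_pair hxy]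

lemma EC_symm {n : ℕ} (z : Fin n → ℤ) (a v : Fin n) : EC z a v = EC z v a := by
  unfold EC; rw [Sym2.eq_swap]

lemma EC_nonneg {n : ℕ} (z : Fin n → ℤ) (a v : Fin n) : 0 ≤ EC z a v := by
  unfold EC; positivity
lemma NN_nonneg {n : ℕ} (z : Fin n → ℤ) : 0 ≤ NN z := by
  unfold NN; positivity
lemma EC_le {n : ℕ} (z : Fin n → ℤ) (a v : Fin n) : EC z a v ≤ NN z := by
  have := NN_split z a v
  have h : (0:ℝ) ≤ (((GS z).filter (fun E => s(a, v) ∉ E)).card : ℝ) := by positivity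
  linarith
lemma NN_neg {n : ℕ} {z : Fin n → ℤ} {a : Fin n} (h : z a < 0) : NN z = 0 := by
  unfold NN
  rw [Nat.cast_eq_zero, card_eq_zero, eq_empty_iff_forall_notMem]
  intro E hE
  have := (mem_GS.1 hE).2 a
  omega

/-- switching -/
def sw {n : ℕ} (E : Finset (Sym2 (Fin n))) (u v x y : Fin n) : Finset (Sym2 (Fin n)) :=
  insert s(u, x) (insert s(v, y) (E.erase s(x, y)))

def SK {n : ℕ} (E : Finset (Sym2 (Fin n))) (u v : Fin n) : Finset (Fin n × Fin n) :=
  univ.filter (fun p => s(p.1, p.2) ∈ E ∧ s(u, p.1) ∉ E ∧ p.1 ≠ u ∧ s(v, p.2) ∉ E ∧ p.2 ≠ v)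

lemma sw_spec {n : ℕ} {E : Finset (Sym2 (Fin n))} (hE : E ∈ Graphs n) {u v x y : Fin n}
    (hK : (x, y) ∈ SK E u v) :
    sw E u v x y ∈ Graphs n ∧ (∀ i, (deg (sw E u v x y) i : ℤ) = deg E i + ev u i + ev v i) ∧
    (sw E u v x y).card = E.card + 1 ∧ s(u, x) ∉ E.erase s(x, y) ∧ s(v, y) ∉ E.erase s(x, y) ∧
    s(u, x) ∉ insert s(v, y) (E.erase s(x, y)) := by
  simp only [SK, mem_filter, mem_univ, true_and] at hK
  obtain ⟨h1, h2, h3, h4, h5⟩ := hK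
  have hxy : x ≠ y := by rintro rfl; exact mem_Graphs.1 hE _ h1
  have hux : s(u, x) ≠ s(v, y) := by
    intro h
    simp at h
    rcases h with h | h
    · exact hxy h.2
    · obtain ⟨rfl, rfl⟩ := h
      rw [Sym2.eq_swap] at h1
      exact h2 h1
  have i1 : s(u, x) ∉ E.erase s(x, y) := fun h => h2 (mem_of_mem_erase h)
  have i2 : s(v, y) ∉ E.erase s(x, y) := fun h => h4 (mem_of_mem_erase h)
  have i3 : s(u, x) ∉ insert s(v, y) (E.erase s(x, y)) := by
    rw [mem_insert]; push Not; exact ⟨hux, i1⟩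
  refine ⟨Graphs_insert h3.symm (Graphs_insert h5.symm (Graphs_erase hE)), fun i => ?_, ?_, i1, i2, i3⟩
  · unfold sw
    rw [deg_insert h3.symm i3, deg_insert h5.symm i2, deg_erase hxy h1]
    ring
  · unfold sw
    rw [card_insert_of_notMem i3, card_insert_of_notMem i2, card_erase_of_mem h1]
    have := card_pos.2 ⟨_, h1⟩
    omega

lemma SK_card {n : ℕ} {E : Finset (Sym2 (Fin n))} (u v : Fin n) (Δ : ℕ)
    (hΔ : ∀ i, deg E i ≤ Δ) :
    ∑ i, deg E i ≤ (SK E u v).card + 2 * (Δ * (Δ + 1)) := by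
  have hs : ∀ w : Fin n, ∑ i ∈ insert w (nb E w), deg E i ≤ Δ * (Δ + 1) := by
    intro w
    calc _ ≤ ∑ i ∈ insert w (nb E w), Δ := sum_le_sum (fun i _ => hΔ i)
      _ = (insert w (nb E w)).card * Δ := by simp
      _ ≤ (Δ + 1) * Δ := by
        apply Nat.mul_le_mul_right
        have := card_insert_le w (nb E w)
        have := card_nb E w
        have := hΔ w
        omega
      _ = _ := by ring
  have h1 : ∑ i, deg E i = ((univ : Finset (Fin n)).sigma (fun i => nb E i)).card := by
    rw [card_sigma]; simp [card_nb]
  have hsub : ((univ : Finset (Fin n)).sigma (fun i => nb E i)) ⊆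
      (((SK E u v).image (fun p => (⟨p.1, p.2⟩ : (_ : Fin n) × Fin n))) ∪
        ((insert u (nb E u)).sigma (fun i => nb E i))) ∪
        (((insert v (nb E v)).sigma (fun i => nb E i)).image
          (fun p => (⟨p.2, p.1⟩ : (_ : Fin n) × Fin n))) := by
    rintro ⟨x, y⟩ h
    simp only [mem_sigma, mem_univ, true_and, mem_nb] at h
    simp only [mem_union, mem_image, mem_sigma, mem_insert, mem_nb, SK, mem_filter, mem_univ,
      true_and, Prod.exists, Sigma.exists]
    by_cases c1 : x = u ∨ s(u, x) ∈ E
    · left; right; exact ⟨c1, h⟩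
    · by_cases c2 : y = v ∨ s(v, y) ∈ E
      · right; exact ⟨y, x, ⟨c2, by rw [Sym2.eq_swap]; exact h⟩, rfl⟩
      · left; left
        push Not at c1 c2
        exact ⟨x, y, ⟨h, c1.2, c1.1, c2.2, c2.1⟩, rfl⟩
  rw [h1]
  refine (card_le_card hsub).trans ?_
  refine (card_union_le _ _).trans ?_
  have a1 := card_union_le ((SK E u v).image (fun p => (⟨p.1, p.2⟩ : (_ : Fin n) × Fin n)))
        ((insert u (nb E u)).sigma (fun i => nb E i))
  have a2 : ((SK E u v).image (fun p => (⟨p.1, p.2⟩ : (_ : Fin n) × Fin n))).card ≤ _ := card_image_le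
  have a3 : (((insert v (nb E v)).sigma (fun i => nb E i)).image
          (fun p => (⟨p.2, p.1⟩ : (_ : Fin n) × Fin n))).card ≤ _ := card_image_le
  have b : ∀ w, ((insert w (nb E w)).sigma (fun i => nb E i)).card ≤ Δ * (Δ + 1) := by
    intro w
    rw [card_sigma]
    simpa [card_nb] using hs w
  have := b u
  have := b v
  omega

lemma F4 {n : ℕ} (z : Fin n → ℤ) {a v : Fin n} (hav : a ≠ v) (Δ : ℕ) (hΔ : ∀ i, z i ≤ Δ) :
    EC z a v * (((∑ i, z i : ℤ) : ℝ) - 2 - 2 * (Δ * (Δ + 1))) ≤ (Δ : ℝ) ^ 2 * (NN z - EC z a v) := by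
  have hF := F1 z hav
  rw [NN_split] at hF
  rw [NN_split, hF]
  set z' := z - ev a - ev v with hz'
  set X := (GS z').filter (fun E => s(a, v) ∉ E)
  set Y := (GS z).filter (fun E => s(a, v) ∉ E)
  have hinj : (X.sigma (fun E => SK E a v)).card ≤ (Y.sigma (fun E => nb E a ×ˢ nb E v)).card := by
    apply card_le_card_of_injOn (fun p => ⟨sw p.1 a v p.2.1 p.2.2, p.2⟩)
    · rintro ⟨E, x, y⟩ h
      simp only [coe_sigma, Set.mem_sigma_iff, mem_coe, X, Y, mem_filter, mem_GS, mem_product, mem_nb] at h ⊢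
      obtain ⟨⟨⟨hE, hd⟩, hn⟩, hK⟩ := h
      obtain ⟨g1, g2, -, -, -, -⟩ := sw_spec hE hK
      refine ⟨⟨⟨g1, fun i => ?_⟩, ?_⟩, ?_, ?_⟩
      · rw [g2, hd]; simp only [hz', Pi.sub_apply]; ring
      · simp only [SK, mem_filter, mem_univ, true_and] at hK
        obtain ⟨h1, h2, h3, h4, h5⟩ := hK
        unfold sw
        simp only [mem_insert, mem_erase, not_or, not_and]
        refine ⟨?_, ?_, fun _ => hn⟩
        · intro h
          simp [hav] at h
          rcases h with h | h
          · subst h; exact h4 h1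
          · exact hav h.2.symm
        · intro h
          simp [hav] at h
          subst h; rw [Sym2.eq_swap] at h1; exact h2 h1
      · unfold sw; simp
      · unfold sw; simp
    · rintro ⟨E, x, y⟩ h ⟨E', x', y'⟩ h' heq
      simp only [coe_sigma, Set.mem_sigma_iff, mem_coe, X, mem_filter, mem_GS] at h h'
      obtain ⟨⟨⟨hE, hd⟩, hn⟩, hK⟩ := h
      obtain ⟨⟨⟨hE', hd'⟩, hn'⟩, hK'⟩ := h'
      simp only [Sigma.mk.injEq, heq_eq_eq, Prod.mk.injEq] at heq
      obtain ⟨h0, rfl, rfl⟩ := heq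
      obtain ⟨-, -, -, -, i2, i3⟩ := sw_spec hE hK
      obtain ⟨-, -, -, -, i2', i3'⟩ := sw_spec hE' hK'
      unfold sw at h0
      have := congrArg (fun S => S.erase s(a, x)) h0
      simp only [erase_insert i3, erase_insert i3'] at this
      have := congrArg (fun S => S.erase s(v, y)) this
      simp only [erase_insert i2, erase_insert i2'] at this
      have := congrArg (fun S => insert s(x, y) S) this
      simp only [SK, mem_filter, mem_univ, true_and] at hK hK'
      simp only [insert_erase hK.1, insert_erase hK'.1] at this
      rw [this]
  rw [card_sigma, card_sigma] at hinj
  have hl : (X.card : ℝ) * (((∑ i, z i : ℤ) : ℝ) - 2 - 2 * (Δ * (Δ + 1))) ≤ ((∑ E ∈ X, (SK E a v).card : ℕ) : ℝ) := by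
    rw [← nsmul_eq_mul]
    push_cast
    apply card_nsmul_le_sum
    intro E hE
    simp only [X, mem_filter, mem_GS] at hE
    have hev : ∀ c i : Fin n, 0 ≤ ev c i := by intro c i; rw [ev_apply]; split_ifs <;> norm_num
    have hd : ∀ i, deg E i ≤ Δ := by
      intro i
      have h1 := hE.1.2 i
      have := hΔ i
      have := hev a i
      have := hev v i
      simp only [hz', Pi.sub_apply] at h1
      omega
    have h2 := SK_card (E := E) a v Δ hd
    have h3 : ((∑ i, deg E i : ℕ) : ℤ) = ∑ i, z i - 2 := by
      push_cast
      rw [sum_congr rfl (fun i _ => hE.1.2 i)]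
      simp only [hz', Pi.sub_apply, sum_sub_distrib, sum_ev]; ring
    have h4 : ((∑ i, z i : ℤ) : ℝ) - 2 = ((∑ i, deg E i : ℕ) : ℝ) := by
      have := congrArg (Int.cast : ℤ → ℝ) h3
      push_cast at this ⊢
      linarith
    have : ((∑ i, deg E i : ℕ) : ℝ) ≤ (((SK E a v).card + 2 * (Δ * (Δ + 1)) : ℕ) : ℝ) := by
      exact_mod_cast h2
    push_cast at h4 this ⊢
    linarith
  have hr : ((∑ E ∈ Y, (nb E a ×ˢ nb E v).card : ℕ) : ℝ) ≤ (Δ : ℝ) ^ 2 * Y.card := by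
    rw [mul_comm, ← nsmul_eq_mul]
    push_cast
    apply sum_le_card_nsmul
    intro E hE
    simp only [Y, mem_filter, mem_GS] at hE
    rw [card_product, card_nb, card_nb, sq]
    have h1 := hE.1.2 a
    have h2 := hE.1.2 v
    have := hΔ a
    have := hΔ v
    have := Nat.mul_le_mul (show deg E a ≤ Δ by omega) (show deg E v ≤ Δ by omega)
    exact_mod_cast this
  have : ((∑ E ∈ X, (SK E a v).card : ℕ) : ℝ) ≤ ((∑ E ∈ Y, (nb E a ×ˢ nb E v).card : ℕ) : ℝ) := by
    exact_mod_cast hinj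
  linarith

lemma F3 {n : ℕ} (z : Fin n → ℤ) (Δ : ℕ) (hΔ : ∀ i, z i ≤ Δ) (h0 : ∀ i, 0 ≤ z i)
    (hpar : Even (∑ i, z i)) (hpos : 1 ≤ Δ) (hbig : 6 * ((Δ : ℤ) * (Δ + 1)) ≤ ∑ i, z i) : 0 < NN z := by
  set P := (Graphs n).filter (fun E => ∀ i, (deg E i : ℤ) ≤ z i) with hP
  have hne : P.Nonempty := ⟨∅, by
    rw [hP, mem_filter, mem_Graphs]
    refine ⟨by simp, fun i => ?_⟩
    simpa [deg] using h0 i⟩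
  obtain ⟨E, hE, hmax⟩ := exists_max_image P card hne
  rw [hP, mem_filter] at hE
  obtain ⟨hG, hle⟩ := hE
  unfold NN
  rw [Nat.cast_pos, card_pos]
  refine ⟨E, mem_GS.2 ⟨hG, ?_⟩⟩
  by_contra hcon
  push Not at hcon
  obtain ⟨u, hu⟩ := hcon
  have hu' : (deg E u : ℤ) < z u := lt_of_le_of_ne (hle u) hu
  have hd : ∀ i, deg E i ≤ Δ := fun i => by have := hle i; have := hΔ i; omega
  have hsd := sum_deg hG
  have hsd' : ∑ i, (deg E i : ℤ) = 2 * E.card := by exact_mod_cast hsd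
  by_cases hc : 2 * (Δ * (Δ + 1)) < ∑ i, deg E i
  · -- enough edges
    have : ∃ v, (deg E v : ℤ) + ev u v < z v := by
      by_contra hno
      push Not at hno
      have heq : ∀ i, z i = deg E i + ev u i := by
        intro i
        refine le_antisymm (hno i) ?_
        rw [ev_apply]
        split_ifs with h
        · subst h; omega
        · have := hle i; omega
      have : ∑ i, z i = 2 * E.card + 1 := by
        rw [sum_congr rfl (fun i _ => heq i), sum_add_distrib, sum_ev, hsd']
      rw [this] at hpar
      obtain ⟨k, hk⟩ := hpar
      omega
    obtain ⟨v, hv⟩ := this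
    have hK := SK_card (E := E) u v Δ hd
    have hKp : 0 < (SK E u v).card := by omega
    obtain ⟨⟨x, y⟩, hxy⟩ := card_pos.1 hKp
    obtain ⟨g1, g2, g3, -⟩ := sw_spec hG hxy
    have := hmax (sw E u v x y) (by
      rw [hP, mem_filter]
      refine ⟨g1, fun i => ?_⟩
      rw [g2]
      by_cases hiv : i = v
      · subst hiv; rw [ev_self i]; omega
      · rw [ev_ne hiv]
        by_cases hiu : i = u
        · subst hiu; rw [ev_self]; omega
        · rw [ev_ne hiu]; have := hle i; omega)
    omega
  · have : ∃ v, v ∉ insert u (nb E u) ∧ (deg E v : ℤ) < z v := by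
      by_contra hno
      push Not at hno
      have h1 : ∀ i, z i ≤ deg E i + if i ∈ insert u (nb E u) then (Δ : ℤ) else 0 := by
        intro i
        split_ifs with h
        · have := hΔ i; omega
        · have := hno i h; omega
      have h2 : ∑ i, z i ≤ ∑ i, (deg E i : ℤ) + (insert u (nb E u)).card * Δ := by
        refine (sum_le_sum (fun i _ => h1 i)).trans ?_
        rw [sum_add_distrib]
        rw [← sum_filter, filter_mem_eq_inter, univ_inter, sum_const, nsmul_eq_mul]
      have h3 : (insert u (nb E u)).card ≤ Δ + 1 := by
        have := card_insert_le u (nb E u)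
        have := card_nb E u
        have := hd u
        omega
      have h4 : ((insert u (nb E u)).card : ℤ) * Δ ≤ (Δ + 1) * Δ := by
        apply mul_le_mul_of_nonneg_right _ (by positivity)
        exact_mod_cast h3
      push Not at hc
      have h5 : (∑ i, (deg E i : ℤ)) ≤ 2 * (Δ * (Δ + 1)) := by exact_mod_cast hc
      have : (1:ℤ) ≤ Δ := by exact_mod_cast hpos
      nlinarith
    obtain ⟨v, hv1, hv2⟩ := this
    rw [mem_insert, mem_nb, not_or] at hv1
    have hvu : u ≠ v := fun h => hv1.1 h.symm
    have := hmax (insert s(u, v) E) (by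
      rw [hP, mem_filter]
      refine ⟨Graphs_insert hvu hG, fun i => ?_⟩
      rw [deg_insert hvu hv1.2]
      by_cases hiv : i = v
      · subst hiv; rw [ev_self i, ev_ne hvu.symm]; omega
      · rw [ev_ne hiv]
        by_cases hiu : i = u
        · subst hiu; rw [ev_self]; omega
        · rw [ev_ne hiu]; have := hle i; omega)
    rw [card_insert_of_notMem hv1.2] at this
    omega

/-- numeric parameters -/
structure PR (n : ℕ) (d e μ ν h lam : ℝ) : Prop where
  n2 : 2 ≤ n
  hμ0 : 0 < μ
  d1 : 1 ≤ d
  hd : h * d = 1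
  he : h ≤ e
  hν : ν = μ * h
  hnν : ((n : ℝ) - 1) * ν = 1
  hlam : lam * (1 - μ) = μ
  small : μ * (1 + e) ^ 4 ≤ 1 / 100000

namespace PR
variable {n : ℕ} {d e μ ν h lam : ℝ}

lemma h0 (p : PR n d e μ ν h lam) : 0 < h := by
  have := p.hd; have := p.d1
  by_contra hc; push Not at hc; nlinarith

lemma h1 (p : PR n d e μ ν h lam) : h ≤ 1 := by
  have := p.hd; have := p.d1; have := p.h0; nlinarith

lemma e0 (p : PR n d e μ ν h lam) : 0 < e := lt_of_lt_of_le p.h0 p.he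

lemma μk (p : PR n d e μ ν h lam) (k : ℕ) (hk : k ≤ 4) : μ * (1 + e) ^ k ≤ 1 / 100000 := by
  refine le_trans ?_ p.small
  have := p.e0
  have := p.hμ0
  gcongr
  linarith

lemma μe (p : PR n d e μ ν h lam) (k : ℕ) (hk : k ≤ 4) : μ * e ^ k ≤ 1 / 100000 := by
  refine le_trans ?_ (p.μk k hk)
  have := p.e0
  have := p.hμ0
  gcongr
  linarith

lemma μ1 (p : PR n d e μ ν h lam) : μ ≤ 1 / 100000 := by
  have := p.μe 0 (by norm_num); simpa using this

lemma ν0 (p : PR n d e μ ν h lam) : 0 < ν := by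
  rw [p.hν]; exact mul_pos p.hμ0 p.h0

lemma νμ (p : PR n d e μ ν h lam) : ν ≤ μ := by
  rw [p.hν]; have := p.h1; have := p.hμ0; nlinarith

lemma νμe (p : PR n d e μ ν h lam) : ν ≤ μ * e := by
  rw [p.hν]; exact mul_le_mul_of_nonneg_left p.he p.hμ0.le

lemma lam0 (p : PR n d e μ ν h lam) : 0 < lam := by
  have := p.hlam; have := p.hμ0; have := p.μ1
  by_contra hc; push Not at hc; nlinarith

lemma lam2 (p : PR n d e μ ν h lam) : lam ≤ 2 * μ := by
  have := p.hlam; have := p.hμ0; have := p.μ1; have := p.lam0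
  nlinarith

lemma np (p : PR n d e μ ν h lam) : (2 : ℝ) ≤ n := by exact_mod_cast p.n2

lemma nν1 (p : PR n d e μ ν h lam) : (1 : ℝ) ≤ n * ν := by
  have := p.hnν; have := p.ν0; linarith

lemma nν2 (p : PR n d e μ ν h lam) : n * ν ≤ (2 : ℝ) := by
  have := p.hnν; have := p.ν0; have := p.np; nlinarith

lemma inv_n (p : PR n d e μ ν h lam) : 1 / (n : ℝ) ≤ ν := by
  have := p.nν1; have := p.np
  rw [div_le_iff₀ (by linarith)]; linarith

/-- n*h ≥ 1 -/
lemma nh1 (p : PR n d e μ ν h lam) : (1 : ℝ) ≤ n * h := by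
  have h1 := p.nν1; have h2 := p.hν; have h3 := p.μ1; have h4 := p.h0; have := p.np
  have h5 : ν ≤ h := by rw [h2]; nlinarith
  nlinarith

end PR

/-- the edge probability approximant -/
def Pf (μ lam x y : ℝ) : ℝ := μ * (1 + x) * (1 + y) / (1 + lam * x * y)

section scalar
variable {n : ℕ} {d e μ ν h lam : ℝ}

lemma lam_xy (p : PR n d e μ ν h lam) {x y : ℝ} (hx : |x| ≤ e) (hy : |y| ≤ 2 * e) :
    |lam * x * y| ≤ 1 / 10000 := by
  have h1 := p.μe 2 (by norm_num)
  have h2 := p.lam2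
  have h3 := p.lam0
  have h4 := p.e0
  rw [mul_assoc, abs_mul, abs_mul, abs_of_pos h3]
  calc lam * (|x| * |y|) ≤ (2 * μ) * (e * (2 * e)) := by
        have := p.hμ0; gcongr
    _ ≤ _ := by nlinarith

lemma one_sub_Pf (p : PR n d e μ ν h lam) {x y : ℝ} (hx : |x| ≤ e) (hy : |y| ≤ 2 * e) :
    1 - Pf μ lam x y = (1 - μ) * (1 - lam * x) * (1 - lam * y) / (1 + lam * x * y) := by
  have h1 := (abs_le.1 (lam_xy p hx hy)).1
  have h2 : (1 + lam * x * y) ≠ 0 := by linarith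
  have h3 := p.hlam
  unfold Pf
  rw [eq_div_iff h2, sub_mul, div_mul_cancel₀ _ h2]
  have hl : lam = μ + lam * μ := by linarith
  linear_combination (x + y + x * y - lam * x * y) * h3

lemma abs_Pf_le (p : PR n d e μ ν h lam) {x y : ℝ} (hx : |x| ≤ e) (hy : |y| ≤ 2 * e)
    (hx1 : |1 + x| ≤ 1 + e) (hy1 : |1 + y| ≤ 1 + e) :
    |Pf μ lam x y| ≤ 2 * μ * (1 + e) ^ 2 := by
  have h1 := (abs_le.1 (lam_xy p hx hy)).1
  have h2 : 0 < (1 + lam * x * y) := by linarith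
  unfold Pf
  have := p.hμ0
  have := p.e0
  rw [abs_div, abs_of_pos h2, div_le_iff₀ h2, abs_mul, abs_mul, abs_of_pos p.hμ0]
  calc μ * |1 + x| * |1 + y| ≤ μ * (1 + e) * (1 + e) := by gcongr
    _ = μ * (1 + e) ^ 2 * 1 := by ring
    _ ≤ μ * (1 + e) ^ 2 * (2 * (1 + lam * x * y)) := by gcongr; linarith
    _ = _ := by ring

lemma Pf_sub_mu (p : PR n d e μ ν h lam) {x y : ℝ} (hx : |x| ≤ e) (hy : |y| ≤ e) :
    |Pf μ lam x y - μ| ≤ 6 * (1 + e) * μ * e := by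
  have h0 := p.e0
  have h1 := (abs_le.1 (lam_xy p hx (by linarith : |y| ≤ 2 * e))).1
  have h2 : 0 < (1 + lam * x * y) := by linarith
  have : Pf μ lam x y - μ = μ * (x + y + x * y - lam * x * y) / (1 + lam * x * y) := by
    unfold Pf; rw [eq_div_iff h2.ne', sub_mul, div_mul_cancel₀ _ h2.ne']; ring
  rw [this, abs_div, abs_of_pos h2, div_le_iff₀ h2, abs_mul, abs_of_pos p.hμ0]
  have h3 : |x + y + x * y - lam * x * y| ≤ e + e + e * e + e * e := by
    have a1 : |x * y| ≤ e * e := by rw [abs_mul]; gcongr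
    have a2 : |lam * x * y| ≤ e * e := by
      rw [mul_assoc, abs_mul, abs_of_pos p.lam0]
      have := p.lam2; have := p.μ1
      have : lam ≤ 1 := by linarith
      have := p.lam0
      nlinarith [abs_nonneg (x * y)]
    calc _ ≤ |x + y + x * y| + |lam * x * y| := abs_sub _ _
      _ ≤ |x| + |y| + |x * y| + |lam * x * y| := by
        gcongr; exact abs_add_three _ _ _
      _ ≤ _ := by gcongr
  have := p.hμ0
  calc μ * |x + y + x * y - lam * x * y| ≤ μ * (e + e + e * e + e * e) := by gcongr
    _ ≤ (6 * (1 + e) * μ * e) * (1 / 2) := by nlinarith [mul_pos this h0, mul_pos (mul_pos this h0) h0]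
    _ ≤ _ := by gcongr; linarith

lemma Pf_shift (p : PR n d e μ ν h lam) {x y : ℝ} (hx : |x| ≤ e) (hy : |y| ≤ e)
    (hx' : |x - h| ≤ e) (hy' : |y - h| ≤ e) :
    |(1 - Pf μ lam (x - h) (y - h)) - (1 + 2 * ν / (1 - μ)) * (1 - Pf μ lam x y)| ≤ 20 * e * ν := by
  have h0 := p.e0
  have l1 := (abs_le.1 (lam_xy p hx (by linarith : |y| ≤ 2 * e)))
  have l2 := (abs_le.1 (lam_xy p hx' (by linarith : |y - h| ≤ 2 * e)))
  have q1 : 0 < 1 + lam * x * y := by linarith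
  have q2 : 0 < 1 + lam * (x - h) * (y - h) := by linarith
  have m1 := p.μ1
  have m0 := p.hμ0
  have ν0 := p.ν0
  have hμ1 : 0 < 1 - μ := by linarith
  have key : Pf μ lam x y - Pf μ lam (x - h) (y - h) - 2 * ν =
      ν * ((x + y - h - 2 * (lam * x * y)) / (1 + lam * x * y)
        - lam * ((1 + (x - h)) * (1 + (y - h))) * (x + y - h) / ((1 + lam * x * y) * (1 + lam * (x - h) * (y - h)))) := by
    unfold Pf; rw [p.hν]
    obtain ⟨Q1, hQ1⟩ : ∃ Q, Q = 1 + lam * x * y := ⟨_, rfl⟩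
    obtain ⟨Q2, hQ2⟩ : ∃ Q, Q = 1 + lam * (x - h) * (y - h) := ⟨_, rfl⟩
    rw [← hQ1] at q1 ⊢
    rw [← hQ2] at q2 ⊢
    have := q1.ne'
    have := q2.ne'
    field_simp
    rw [hQ1, hQ2]; ring
  have s1 : |x + y - h| ≤ 2 * e := by
    have : x + y - h = x + (y - h) := by ring
    rw [this]; exact (abs_add_le _ _).trans (by linarith)
  have lamxy : |lam * x * y| ≤ e := by
    rw [mul_assoc, abs_mul, abs_mul, abs_of_pos p.lam0]
    have a1 := p.μe 1 (by norm_num); have := p.lam2; have := p.lam0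
    calc lam * (|x| * |y|) ≤ (2 * μ) * (e * e) := by gcongr
      _ ≤ e := by nlinarith
  have b1 : |(x + y - h - 2 * (lam * x * y)) / (1 + lam * x * y)| ≤ 5 * e := by
    rw [abs_div, abs_of_pos q1, div_le_iff₀ q1]
    have : |x + y - h - 2 * (lam * x * y)| ≤ 2 * e + 2 * e := by
      refine (abs_sub _ _).trans ?_
      rw [abs_mul 2, abs_two]; linarith
    nlinarith
  have b2 : |lam * ((1 + (x - h)) * (1 + (y - h))) * (x + y - h) / ((1 + lam * x * y) * (1 + lam * (x - h) * (y - h)))| ≤ e := by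
    have qq : (1:ℝ)/2 ≤ (1 + lam * x * y) * (1 + lam * (x - h) * (y - h)) := by nlinarith
    rw [abs_div, abs_of_pos (by linarith : 0 < (1 + lam * x * y) * (1 + lam * (x - h) * (y - h))), div_le_iff₀ (by linarith)]
    rw [abs_mul, abs_mul, abs_mul, abs_of_pos p.lam0]
    have c1 : |1 + (x - h)| ≤ 1 + e := (abs_add_le _ _).trans (by rw [abs_one]; linarith)
    have c2 : |1 + (y - h)| ≤ 1 + e := (abs_add_le _ _).trans (by rw [abs_one]; linarith)
    have a2 := p.μk 2 (by norm_num)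
    calc lam * (|1 + (x - h)| * |1 + (y - h)|) * |x + y - h| ≤ (2 * μ) * ((1 + e) * (1 + e)) * (2 * e) := by
          have := p.lam2; have := p.lam0
          gcongr
      _ = 4 * (μ * (1 + e) ^ 2) * e := by ring
      _ ≤ 4 * (1 / 100000) * e := by gcongr
      _ ≤ e * (1 / 2) := by nlinarith
      _ ≤ _ := by gcongr
  have b3 := Pf_sub_mu p hx hy
  have id : (1 - Pf μ lam (x - h) (y - h)) - (1 + 2 * ν / (1 - μ)) * (1 - Pf μ lam x y)
      = (Pf μ lam x y - Pf μ lam (x - h) (y - h) - 2 * ν) + 2 * ν / (1 - μ) * (Pf μ lam x y - μ) := by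
    field_simp; ring
  rw [id]
  refine (abs_add_le _ _).trans ?_
  have e1 : |Pf μ lam x y - Pf μ lam (x - h) (y - h) - 2 * ν| ≤ ν * (5 * e + e) := by
    rw [key, abs_mul, abs_of_pos ν0]
    gcongr
    exact (abs_sub _ _).trans (add_le_add b1 b2)
  have e2 : |2 * ν / (1 - μ) * (Pf μ lam x y - μ)| ≤ 4 * ν * e := by
    rw [abs_mul, abs_of_pos (by positivity)]
    have : 2 * ν / (1 - μ) ≤ 4 * ν := by rw [div_le_iff₀ hμ1]; nlinarith
    calc 2 * ν / (1 - μ) * |Pf μ lam x y - μ| ≤ 4 * ν * (6 * (1 + e) * μ * e) := by gcongr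
      _ = 4 * ν * e * (6 * (μ * (1 + e) ^ 1)) := by ring
      _ ≤ 4 * ν * e * (6 * (1 / 100000)) := by
        have := p.μk 1 (by norm_num)
        gcongr
      _ ≤ _ := by nlinarith [mul_pos ν0 h0]
  nlinarith [mul_pos ν0 h0]

end scalar

/-- admissible relative deviations -/
structure AD (n : ℕ) (e h : ℝ) (ε : Fin n → ℝ) : Prop where
  lo : ∀ i, -1 ≤ ε i
  hi : ∀ i, |ε i| ≤ e
  s1 : |∑ i, ε i| ≤ e
  s2 : ∑ i, ε i ^ 2 ≤ 5 * n * h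

def hht (σ x : ℝ) : ℝ := (1 + x) / (1 - σ * x)

lemma sum_approx {n : ℕ} (f g : Fin n → ℝ) (ε : Fin n → ℝ) (c q : ℝ)
    (H : ∀ i, |f i - g i| ≤ c + q * ε i ^ 2) :
    |∑ i, f i - ∑ i, g i| ≤ n * c + q * ∑ i, ε i ^ 2 := by
  rw [← sum_sub_distrib]
  refine (abs_sum_le_sum_abs _ _).trans ((sum_le_sum (fun i _ => H i)).trans ?_)
  rw [sum_add_distrib, ← mul_sum]; simp

section
variable {n : ℕ} {d e μ ν h lam σ : ℝ}

lemma sx (p : PR n d e μ ν h lam) (s0 : 0 ≤ σ) (s7 : σ ≤ 7 * μ) {x : ℝ} (hx : |x| ≤ e) :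
    |σ * x| ≤ 1 / 10000 := by
  have := p.μe 1 (by norm_num)
  rw [abs_mul, abs_of_nonneg s0]
  have := p.hμ0
  calc σ * |x| ≤ 7 * μ * e := by gcongr
    _ ≤ _ := by linarith

lemma hh1 (p : PR n d e μ ν h lam) (s0 : 0 ≤ σ) (s7 : σ ≤ 7 * μ) {x : ℝ} (hx : |x| ≤ e) :
    |hht σ x - (1 + (1 + σ) * x)| ≤ 2 * σ * x ^ 2 := by
  have h1 := abs_le.1 (sx p s0 s7 hx)
  have h2 : 0 < 1 - σ * x := by linarith
  have h3 := p.μ1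
  have : hht σ x - (1 + (1 + σ) * x) = σ * (1 + σ) * x ^ 2 / (1 - σ * x) := by
    unfold hht; rw [eq_div_iff h2.ne', sub_mul, div_mul_cancel₀ _ h2.ne']; ring
  rw [this, abs_of_nonneg (by positivity), div_le_iff₀ h2]
  have : 0 ≤ σ * x ^ 2 := by positivity
  nlinarith

lemma hh_nonneg (p : PR n d e μ ν h lam) (s0 : 0 ≤ σ) (s7 : σ ≤ 7 * μ) {x : ℝ} (hx : |x| ≤ e) (hl : -1 ≤ x) :
    0 ≤ hht σ x := by
  have h1 := abs_le.1 (sx p s0 s7 hx)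
  exact div_nonneg (by linarith) (by linarith)

lemma hh2 (p : PR n d e μ ν h lam) (s0 : 0 ≤ σ) (s7 : σ ≤ 7 * μ) {x : ℝ} (hx : |x| ≤ e) :
    |hht σ x - (1 + x)| ≤ 3 * σ * (1 + e) * |x| := by
  have h1 := hh1 p s0 s7 hx
  have h0 := p.e0
  have : hht σ x - (1 + x) = (hht σ x - (1 + (1 + σ) * x)) + σ * x := by ring
  rw [this]
  refine (abs_add_le _ _).trans ?_
  rw [abs_mul, abs_of_nonneg s0]
  have h2 : x ^ 2 ≤ e * |x| := by
    rw [← sq_abs, sq]; gcongr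
  have : 2 * σ * x ^ 2 ≤ 2 * σ * (e * |x|) := by gcongr
  have : 0 ≤ σ * |x| := by positivity
  have : 0 ≤ σ * (e * |x|) := by positivity
  nlinarith

lemma hh3 (p : PR n d e μ ν h lam) (s0 : 0 ≤ σ) (s7 : σ ≤ 7 * μ) {x : ℝ} (hx : |x| ≤ e) :
    |hht σ x - 1| ≤ 2 * |x| := by
  have h1 := hh2 p s0 s7 hx
  have h0 := p.e0
  have : hht σ x - 1 = (hht σ x - (1 + x)) + x := by ring
  rw [this]
  refine (abs_add_le _ _).trans ?_
  have h2 : σ * (1 + e) ≤ 7 / 100000 := by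
    have := p.μk 1 (by norm_num)
    nlinarith
  have : 0 ≤ |x| := abs_nonneg x
  nlinarith

lemma sA (p : PR n d e μ ν h lam) (s7 : σ ≤ 7 * μ) {ε : Fin n → ℝ} (a : AD n e h ε) :
    σ * ∑ i, ε i ^ 2 ≤ 70 := by
  have h0 : 0 ≤ ∑ i, ε i ^ 2 := sum_nonneg (fun i _ => sq_nonneg _)
  have := p.nν2; have h1 := p.hν; have := a.s2
  calc σ * ∑ i, ε i ^ 2 ≤ 7 * μ * (5 * n * h) := by
        have := p.hμ0; gcongr
    _ = 35 * (n * ν) := by rw [h1]; ring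
    _ ≤ 70 := by linarith

lemma H1 (p : PR n d e μ ν h lam) (s0 : 0 ≤ σ) (s7 : σ ≤ 7 * μ) {ε : Fin n → ℝ} (a : AD n e h ε) :
    |∑ i, hht σ (ε i) - n| ≤ 140 * (1 + e) := by
  have h0 := sum_approx (fun i => hht σ (ε i)) (fun i => 1 + (1 + σ) * ε i) ε 0 (2 * σ)
    (fun i => by have := hh1 p s0 s7 (a.hi i); linarith)
  rw [sum_add_distrib, ← mul_sum] at h0
  simp only [sum_const, card_univ, Fintype.card_fin, nsmul_eq_mul, mul_one, mul_zero, zero_add] at h0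
  have h1 := sA p s7 a
  have h2 := abs_le.1 a.s1
  have h3 := abs_le.1 h0
  have h4 := p.μ1
  have h5 := p.e0
  have hs : σ ≤ 1 / 10000 := by linarith
  rw [abs_le]; constructor <;> nlinarith

lemma W_n (p : PR n d e μ ν h lam) : (1 + e) ≤ n / 100000 := by
  have h1 := p.inv_n; have h2 := p.νμ; have h3 := p.μk 1 (by norm_num); have h4 := p.np; have := p.e0
  have : 1 / (n:ℝ) * (1 + e) ≤ 1 / 100000 := by
    refine le_trans ?_ h3
    rw [pow_one]; gcongr; linarith
  rw [div_mul_eq_mul_div, div_le_iff₀ (by linarith)] at this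
  linarith

lemma H_half (p : PR n d e μ ν h lam) (s0 : 0 ≤ σ) (s7 : σ ≤ 7 * μ) {ε : Fin n → ℝ} (a : AD n e h ε) :
    (n : ℝ) / 2 ≤ ∑ i, hht σ (ε i) := by
  have h1 := abs_le.1 (H1 p s0 s7 a)
  have h2 := W_n p
  have := p.np
  linarith

lemma H2 (p : PR n d e μ ν h lam) (s0 : 0 ≤ σ) (s7 : σ ≤ 7 * μ) {ε : Fin n → ℝ} (a : AD n e h ε) :
    |∑ i, hht σ (ε i) * ε i - ∑ i, ε i ^ 2| ≤ 211 * (1 + e) := by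
  have h5 := p.e0
  have h0 := sum_approx (fun i => hht σ (ε i) * ε i) (fun i => ε i + ε i ^ 2) ε 0 (3 * σ * (1 + e))
    (fun i => by
      have := hh2 p s0 s7 (a.hi i)
      have e1 : hht σ (ε i) * ε i - (ε i + ε i ^ 2) = (hht σ (ε i) - (1 + ε i)) * ε i := by ring
      rw [e1, abs_mul, zero_add, ← sq_abs (ε i), sq]
      calc _ ≤ 3 * σ * (1 + e) * |ε i| * |ε i| := by gcongr
        _ = _ := by ring)
  rw [sum_add_distrib] at h0
  have h1 := sA p s7 a
  have h2 := abs_le.1 a.s1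
  have h3 := abs_le.1 h0
  have : 3 * σ * (1 + e) * ∑ i, ε i ^ 2 ≤ 3 * (1 + e) * 70 := by
    have : 3 * (1 + e) * (σ * ∑ i, ε i ^ 2) ≤ 3 * (1 + e) * 70 := by gcongr
    linarith
  rw [abs_le]; constructor <;> linarith

/-- G1 -/
lemma G1_bound (p : PR n d e μ ν h lam) (s0 : 0 ≤ σ) (s7 : σ ≤ 7 * μ) {ε : Fin n → ℝ} (a : AD n e h ε) :
    |(∑ i, hht σ (ε i) * ε i) / (∑ i, hht σ (ε i)) - (∑ i, ε i ^ 2) / n| ≤ 2000 * (1 + e) * ν := by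
  have a1 := H1 p s0 s7 a
  have a2 := H2 p s0 s7 a
  have a3 := H_half p s0 s7 a
  have a4 := a.s2
  have a5 : 0 ≤ ∑ i, ε i ^ 2 := sum_nonneg (fun i _ => sq_nonneg _)
  have a6 := p.np
  have a7 := p.inv_n
  have a8 := p.h1
  have a9 := p.e0
  have a10 := p.h0
  generalize (∑ i, hht σ (ε i) * ε i) = X at *
  generalize (∑ i, hht σ (ε i)) = H at *
  generalize (∑ i, ε i ^ 2) = Q at *
  have hn : (0:ℝ) < n := by linarith
  have hH : 0 < H := by linarith
  have : X / H - Q / n = ((X - Q) * n + Q * (n - H)) / (H * n) := by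
    field_simp; ring
  rw [this, abs_div, abs_of_pos (mul_pos hH hn), div_le_iff₀ (mul_pos hH hn)]
  have b1 : |(X - Q) * n + Q * (n - H)| ≤ 211 * (1 + e) * n + 5 * n * h * (140 * (1 + e)) := by
    refine (abs_add_le _ _).trans ?_
    rw [abs_mul, abs_mul, abs_of_pos hn, abs_of_nonneg a5, abs_sub_comm (n : ℝ)]
    gcongr
  refine b1.trans ?_
  have b2 : 5 * n * h * (140 * (1 + e)) ≤ 700 * (1 + e) * n := by
    have : (n * (1 + e)) * h ≤ (n * (1 + e)) * 1 := by gcongr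
    linarith
  have b3 := p.nν1
  have b4 : (1 + e) * n * (1 / 2) ≤ (1 + e) * ν * (H * n) := by
    have : (1 + e) * n * (1 / 2) ≤ (1 + e) * H * (n * ν) := by
      calc (1 + e) * n * (1 / 2) ≤ (1 + e) * H * 1 := by nlinarith
        _ ≤ _ := by gcongr
    linarith
  have b5 : 0 ≤ (1 + e) * n := by positivity
  linarith

lemma q_bound (p : PR n d e μ ν h lam) (s0 : 0 ≤ σ) (s7 : σ ≤ 7 * μ) {ε : Fin n → ℝ} (a : AD n e h ε) (i : Fin n) :
    |hht σ (ε i) / (∑ i, hht σ (ε i)) - (1 + ε i) / n| ≤ 322 * (1 + e) ^ 2 * μ * e * ν := by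
  have a1 := H1 p s0 s7 a
  have a3 := H_half p s0 s7 a
  have a2 := hh2 p s0 s7 (a.hi i)
  have a6 := p.np
  have a7 := p.inv_n
  have a8 := p.h1
  have a9 := p.e0
  have hm := p.hμ0
  have a10 := a.hi i
  have a12 := a.lo i
  have a11 : |1 + ε i| ≤ 1 + e := (abs_add_le _ _).trans (by rw [abs_one]; linarith)
  generalize (∑ i, hht σ (ε i)) = H at *
  generalize (ε i) = x at *
  generalize hht σ x = t at *
  have hn : (0:ℝ) < n := by linarith
  have hH : 0 < H := by linarith
  have : t / H - (1 + x) / n = ((t - (1 + x)) * n + (1 + x) * (n - H)) / (H * n) := by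
    field_simp; ring
  rw [this, abs_div, abs_of_pos (mul_pos hH hn), div_le_iff₀ (mul_pos hH hn)]
  have b1 : |(t - (1 + x)) * n + (1 + x) * (n - H)| ≤ 21 * μ * (1 + e) * e * n + (1 + e) * (140 * (1 + e)) := by
    refine (abs_add_le _ _).trans ?_
    rw [abs_mul, abs_mul, abs_of_pos hn, abs_sub_comm (n : ℝ)]
    gcongr
    refine a2.trans ?_
    calc 3 * σ * (1 + e) * |x| ≤ 3 * (7 * μ) * (1 + e) * e := by gcongr
      _ = _ := by ring
  refine b1.trans ?_
  have b3 := p.nν1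
  have b4 := p.νμe
  have ν0 := p.ν0
  have c1 : (n : ℝ) / 2 ≤ ν * (H * n) := by
    calc (n : ℝ) / 2 ≤ H * 1 := by linarith
      _ ≤ H * (n * ν) := by gcongr
      _ = _ := by ring
  have c2 : 1 / 2 ≤ μ * e * ν * (H * n) := by
    have : (1:ℝ) / 2 ≤ ν * (n / 2) := by linarith
    calc (1:ℝ) / 2 ≤ ν * (n / 2) := this
      _ ≤ (μ * e) * (ν * (H * n)) := by gcongr
      _ = _ := by ring
  have c3 : 21 * μ * (1 + e) * e * n ≤ 42 * (1 + e) ^ 2 * (μ * e * ν * (H * n)) := by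
    calc 21 * μ * (1 + e) * e * n = 42 * (1 + e) * (μ * e) * (n / 2) := by ring
      _ ≤ 42 * (1 + e) ^ 2 * (μ * e) * (ν * (H * n)) := by gcongr; nlinarith
      _ = _ := by ring
  have c4 : (1 + e) * (140 * (1 + e)) ≤ 280 * (1 + e) ^ 2 * (μ * e * ν * (H * n)) := by
    calc (1 + e) * (140 * (1 + e)) = 280 * (1 + e) ^ 2 * (1 / 2) := by ring
      _ ≤ _ := by gcongr
  linarith

end

def gg (lam x y : ℝ) : ℝ := y * (1 + y) / (1 + lam * x * y)

section
variable {n : ℕ} {d e μ ν h lam σ : ℝ}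

lemma y_bounds (p : PR n d e μ ν h lam) {x : ℝ} (hx : |x| ≤ e) (hl : -1 ≤ x) :
    |x - h| ≤ 2 * e ∧ |1 + (x - h)| ≤ 1 + e ∧ |x - h| ≤ |x| + h := by
  have h1 := abs_le.1 hx; have h2 := p.h0; have h3 := p.he; have h4 := p.e0
  have : |x - h| ≤ |x| + h := (abs_sub _ _).trans (by rw [abs_of_pos h2])
  refine ⟨by linarith, ?_, this⟩
  rw [abs_le]; constructor <;> linarith

lemma Pf_gg (p : PR n d e μ ν h lam) {x y : ℝ} (hx : |x| ≤ e) (hy : |y| ≤ 2 * e) :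
    Pf μ lam x y = μ * (1 + x) * ((1 + y) - lam * x * gg lam x y) := by
  have h1 := abs_le.1 (lam_xy p hx hy)
  have h2 : (1 + lam * x * y) ≠ 0 := by linarith
  unfold Pf gg
  rw [div_eq_iff h2]
  have h3 := div_mul_cancel₀ (y * (1 + y)) h2
  linear_combination (μ * (1 + x) * lam * x) * h3

lemma gg_abs (p : PR n d e μ ν h lam) {x y : ℝ} (hx : |x| ≤ e) (hy : |y| ≤ 2 * e) (hy1 : |1 + y| ≤ 1 + e) :
    |gg lam x y| ≤ 4 * e * (1 + e) := by
  have h1 := abs_le.1 (lam_xy p hx hy)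
  have h2 : 0 < (1 + lam * x * y) := by linarith
  have h0 := p.e0
  unfold gg
  rw [abs_div, abs_of_pos h2, div_le_iff₀ h2, abs_mul]
  calc |y| * |1 + y| ≤ 2 * e * (1 + e) := by gcongr
    _ = 4 * e * (1 + e) * (1 / 2) := by ring
    _ ≤ _ := by gcongr; linarith

lemma gg_approx (p : PR n d e μ ν h lam) {x y : ℝ} (hx : |x| ≤ e) (hy : |y| ≤ 2 * e) :
    |gg lam x y - y| ≤ 2 * y ^ 2 := by
  have h1 := abs_le.1 (lam_xy p hx hy)
  have h2 : 0 < (1 + lam * x * y) := by linarith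
  have h0 := p.e0
  have : gg lam x y - y = y ^ 2 * (1 - lam * x) / (1 + lam * x * y) := by
    unfold gg; rw [eq_div_iff h2.ne', sub_mul, div_mul_cancel₀ _ h2.ne']; ring
  have h3 : |lam * x| ≤ 1 / 1000 := by
    have := p.lam2; have := p.lam0; have := p.μe 1 (by norm_num); have := p.hμ0
    rw [abs_mul, abs_of_pos p.lam0]
    calc lam * |x| ≤ 2 * μ * e := by gcongr
      _ ≤ _ := by linarith
  have h4 := abs_le.1 h3
  rw [this, abs_of_nonneg (div_nonneg (mul_nonneg (sq_nonneg _) (by linarith)) h2.le), div_le_iff₀ h2]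
  nlinarith [sq_nonneg y]

lemma G2_bound (p : PR n d e μ ν h lam) (s0 : 0 ≤ σ) (s7 : σ ≤ 7 * μ) {ε : Fin n → ℝ} (a : AD n e h ε) {x : ℝ} (hx : |x| ≤ e) :
    |(∑ i, hht σ (ε i) * gg lam x (ε i - h)) / (∑ i, hht σ (ε i))| ≤ 400 * (1 + e) * h := by
  have e0 := p.e0
  have hh0 := p.h0
  have hh1 := p.h1
  have h0 := sum_approx (fun i => hht σ (ε i) * gg lam x (ε i - h)) ε ε (20 * (1 + e) * h) (20 * (1 + e))
    (fun i => by
      obtain ⟨b1, b2, b3⟩ := y_bounds p (a.hi i) (a.lo i)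
      have c1 := gg_approx p hx b1
      have c2 := hh3 p s0 s7 (a.hi i)
      have c0 := a.hi i
      have c3 : |hht σ (ε i)| ≤ 2 * (1 + e) := by
        have : hht σ (ε i) = (hht σ (ε i) - 1) + 1 := by ring
        rw [this]; refine (abs_add_le _ _).trans ?_
        rw [abs_one]; linarith
      have c4 : (ε i - h) ^ 2 ≤ 2 * (ε i) ^ 2 + 2 * h := by nlinarith [sq_nonneg (ε i + h)]
      have c5 : |gg lam x (ε i - h) - ε i| ≤ 4 * ε i ^ 2 + 5 * h := by
        have : gg lam x (ε i - h) - ε i = (gg lam x (ε i - h) - (ε i - h)) + (-h) := by ring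
        rw [this]; refine (abs_add_le _ _).trans ?_
        rw [abs_neg, abs_of_pos hh0]; linarith
      have : hht σ (ε i) * gg lam x (ε i - h) - ε i = hht σ (ε i) * (gg lam x (ε i - h) - ε i) + (hht σ (ε i) - 1) * ε i := by ring
      rw [this]
      refine (abs_add_le _ _).trans ?_
      rw [abs_mul, abs_mul]
      have c6 : |hht σ (ε i) - 1| * |ε i| ≤ 2 * |ε i| * |ε i| := by gcongr
      have c7 : |ε i| * |ε i| = ε i ^ 2 := by rw [← sq, sq_abs]
      have c8 : |hht σ (ε i)| * |gg lam x (ε i - h) - ε i| ≤ 2 * (1 + e) * (4 * ε i ^ 2 + 5 * h) := by gcongr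
      have c9 : 0 ≤ e * ε i ^ 2 := by positivity
      have c10 : 0 ≤ ε i ^ 2 := by positivity
      have c11 : 0 ≤ e * h := by positivity
      nlinarith)
  have a3 := H_half p s0 s7 a
  have a2 := a.s2
  have a1 := a.s1
  have n1 := p.nh1
  have n2 := p.np
  have hH : 0 < ∑ i, hht σ (ε i) := by linarith
  rw [abs_div, abs_of_pos hH, div_le_iff₀ hH]
  have b1 : |∑ i, hht σ (ε i) * gg lam x (ε i - h)| ≤ e + 120 * (1 + e) * (n * h) := by
    have : 20 * (1 + e) * ∑ i, ε i ^ 2 ≤ 20 * (1 + e) * (5 * n * h) := by gcongr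
    have := abs_le.1 h0
    have := abs_le.1 a1
    rw [abs_le]; constructor <;> linarith
  have b2 : e ≤ (1 + e) * (n * h) := by nlinarith
  calc _ ≤ _ := b1
    _ ≤ 121 * (1 + e) * (n * h) := by linarith
    _ ≤ 400 * (1 + e) * h * (n / 2) := by nlinarith [mul_pos (mul_pos (show (0:ℝ) < n by linarith) (show 0 < 1 + e by linarith)) hh0]
    _ ≤ _ := by gcongr

lemma aux_r2 {e : ℝ} (h : 0 ≤ e) : (1 + e) * (1 + e) * (3 * e) + e * (1 + (1 + e)) ≤ 5 * (1 + e) ^ 2 * e := by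
  nlinarith [mul_nonneg h h, mul_nonneg (mul_nonneg h h) h]

lemma aux_r3 {e : ℝ} (h : 0 ≤ e) : (1 + e) * (1 + 3 * e) ≤ 4 * (1 + e) ^ 2 := by
  nlinarith

set_option maxHeartbeats 2000000 in
/-- the ER lemma -/
lemma ER (p : PR n d e μ ν h lam) {S : ℝ} {ε : Fin n → ℝ} (a : AD n e h ε) (hS : S = μ * (∑ i, ε i ^ 2) / n)
    (hσ : σ = lam + S) (s0 : 0 ≤ σ) (s7 : σ ≤ 7 * μ) :
    ∃ κ : ℝ, 1 / 2 ≤ κ ∧ κ ≤ 2 ∧ ∀ i, |(1 - hht σ (ε i) / (∑ j, hht σ (ε j))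
      - ∑ v ∈ univ.erase i, hht σ (ε v) / (∑ j, hht σ (ε j)) * Pf μ lam (ε i) (ε v - h)) - κ * (1 - σ * ε i)|
      ≤ 6000 * (1 + e) ^ 2 * μ * e * ν := by
  have e0 := p.e0
  have hh0 := p.h0
  have hh1 := p.h1
  have ν0 := p.ν0
  have μ0 := p.hμ0
  have μ1 := p.μ1
  have np := p.np
  have a3 := H_half p s0 s7 a
  set H := ∑ j, hht σ (ε j) with hH
  have hHp : 0 < H := by linarith
  have g1 := G1_bound p s0 s7 a
  rw [← hH] at g1
  set X1 := (∑ i, hht σ (ε i) * ε i) / H with hX1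
  have hS' : (∑ i, ε i ^ 2) / n = S / μ := by rw [hS]; field_simp
  have S0 : 0 ≤ S := by rw [hS]; positivity
  have S5 : S ≤ 5 * ν := by
    rw [hS, div_le_iff₀ (by linarith), p.hν]
    have := a.s2
    calc μ * ∑ i, ε i ^ 2 ≤ μ * (5 * n * h) := by gcongr
      _ = _ := by ring
  set θ1 := X1 - S / μ with hθ1
  rw [hS'] at g1
  set G1 := 1 + X1 - h with hG1
  have hμG1 : μ * G1 = μ + S - ν + μ * θ1 := by
    rw [hG1, hθ1, p.hν]; field_simp; ring
  have θ1b : |μ * θ1| ≤ ν / 10 := by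
    rw [abs_mul, abs_of_pos μ0]
    have := p.μk 1 (by norm_num)
    calc μ * |θ1| ≤ μ * (2000 * (1 + e) * ν) := by gcongr
      _ = 2000 * (μ * (1 + e) ^ 1) * ν := by ring
      _ ≤ 2000 * (1 / 100000) * ν := by gcongr
      _ ≤ _ := by linarith
  have hn0 : (0:ℝ) < n := by linarith
  have in1 := p.inv_n
  have in0 : 0 < 1 / (n:ℝ) := by positivity
  have hνn : ν - 1 / n = ν * (1 / n) := by
    have := p.hnν; field_simp; linarith
  set c0 := 1 - 1 / (n:ℝ) - μ * G1 + μ * (1 / n) with hc0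
  -- κ' = c0 - (1-μ)
  have κb : |c0 - (1 - μ)| ≤ 9 * ν := by
    have := abs_le.1 θ1b
    have : μ * (1 / n) ≤ 1 / n := mul_le_of_le_one_left in0.le (by linarith)
    have : 0 < μ * (1 / n) := by positivity
    rw [hc0, hμG1, abs_le]; constructor <;> linarith
  have νμ := p.νμ
  refine ⟨c0, ?_, ?_, ?_⟩
  · have := abs_le.1 κb; linarith
  · have := abs_le.1 κb; linarith
  intro i
  set x := ε i with hx
  have hxe : |x| ≤ e := a.hi i
  have hxl : -1 ≤ x := a.lo i
  have x1 : |1 + x| ≤ 1 + e := (abs_add_le _ _).trans (by rw [abs_one]; linarith)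
  obtain ⟨y1, y2, y3⟩ := y_bounds p hxe hxl
  have g2 := G2_bound p s0 s7 a hxe
  rw [← hH] at g2
  set G2 := (∑ v, hht σ (ε v) * gg lam x (ε v - h)) / H with hG2
  have q1 := q_bound p s0 s7 a i
  rw [← hH, ← hx] at q1
  set q := hht σ x / H with hq
  set r := (1 + (x - h)) - lam * x * gg lam x (x - h) with hr
  have hsum : ∑ v ∈ univ.erase i, hht σ (ε v) / H * Pf μ lam x (ε v - h)
      = μ * (1 + x) * (G1 - lam * x * G2) - q * (μ * (1 + x) * r) := by
    rw [← sub_eq_iff_eq_add'.2 (add_sum_erase univ (fun v => hht σ (ε v) / H * Pf μ lam x (ε v - h)) (mem_univ i)).symm]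
    congr 1
    · have : ∀ v, hht σ (ε v) / H * Pf μ lam x (ε v - h) = μ * (1 + x) *
        (hht σ (ε v) / H * (1 - h) + hht σ (ε v) * ε v / H - lam * x * (hht σ (ε v) * gg lam x (ε v - h) / H)) := by
        intro v
        rw [Pf_gg p hxe (y_bounds p (a.hi v) (a.lo v)).1]; ring
      rw [sum_congr rfl (fun v _ => this v), ← mul_sum, sum_sub_distrib, sum_add_distrib, ← mul_sum, ← sum_mul,
        ← sum_div, ← sum_div, ← sum_div, ← hH, ← hX1, ← hG2, div_self hHp.ne', hG1]
      ring
    · rw [← hx, ← hq, Pf_gg p hxe y1]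
  rw [hsum]
  have r1 : |r - 1| ≤ 3 * e := by
    have b := gg_abs p hxe y1 y2
    have : r - 1 = (x - h) + (-(lam * x * gg lam x (x - h))) := by rw [hr]; ring
    rw [this]
    refine (abs_add_le _ _).trans ?_
    rw [abs_neg, abs_mul, abs_mul, abs_of_pos p.lam0]
    have l2 := p.lam2
    have l0 := p.lam0
    have m2 := p.μk 2 (by norm_num)
    have : lam * |x| * |gg lam x (x - h)| ≤ e := by
      calc lam * |x| * |gg lam x (x - h)| ≤ 2 * μ * (1 + e) * (4 * e * (1 + e)) := by gcongr; linarith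
        _ = 8 * (μ * (1 + e) ^ 2) * e := by ring
        _ ≤ 8 * (1 / 100000) * e := by gcongr
        _ ≤ e := by linarith
    linarith
  have r2 : |(1 + x) ^ 2 * r - 1| ≤ 5 * (1 + e) ^ 2 * e := by
    have : (1 + x) ^ 2 * r - 1 = (1 + x) * (1 + x) * (r - 1) + x * (1 + (1 + x)) := by ring
    rw [this]
    refine (abs_add_le _ _).trans ?_
    rw [abs_mul, abs_mul, abs_mul]
    have : |1 + (1 + x)| ≤ 1 + (1 + e) := (abs_add_le _ _).trans (by rw [abs_one]; linarith)
    calc _ ≤ (1 + e) * (1 + e) * (3 * e) + e * (1 + (1 + e)) := by gcongr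
      _ ≤ _ := aux_r2 e0.le
  have r3 : |(1 + x) * r| ≤ 4 * (1 + e) ^ 2 := by
    have : |r| ≤ 1 + 3 * e := by
      have : r = 1 + (r - 1) := by ring
      rw [this]; exact (abs_add_le _ _).trans (by rw [abs_one]; linarith)
    rw [abs_mul]
    calc _ ≤ (1 + e) * (1 + 3 * e) := by gcongr
      _ ≤ _ := aux_r3 e0.le
  rw [← hθ1] at g1
  clear_value q r G2 x c0 G1 θ1 X1 H
  have id : (1 - q - (μ * (1 + x) * (G1 - lam * x * G2) - q * (μ * (1 + x) * r))) - c0 * (1 - σ * x)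
     = -(q - (1 + x) / n) + x * (ν * (1 / n)) + (-(x * (μ * θ1))) + lam * μ * (1 + x) * x * G2
       + μ * (1 / n) * ((1 + x) ^ 2 * r - 1) + μ * ((q - (1 + x) / n) * ((1 + x) * r))
       + (c0 - (1 - μ)) * (lam + S) * x + (- (μ * S * x)) := by
    rw [hσ]
    have h1 := p.hlam
    rw [← hνn]
    have : c0 - (1 - 1 / (n:ℝ) - μ * G1 + μ * (1 / n)) = 0 := by rw [hc0]; ring
    linear_combination x * h1 - x * hμG1 - this
  rw [id]
  set B := μ * e * ν with hB
  have B0 : 0 < B := by positivity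
  have W1 : 1 ≤ (1 + e) := by linarith
  have W2 : (1 + e) ≤ (1 + e) ^ 2 := le_self_pow₀ W1 (by norm_num)
  have t1 : |-(q - (1 + x) / n)| ≤ 322 * (1 + e) ^ 2 * B := by rw [abs_neg]; linarith
  have t2 : |x * (ν * (1 / n))| ≤ B := by
    rw [abs_mul, abs_of_pos (by positivity : 0 < ν * (1 / (n:ℝ)))]
    calc |x| * (ν * (1 / n)) ≤ e * (ν * μ) := by gcongr; linarith
      _ = B := by rw [hB]; ring
  have t3 : |-(x * (μ * θ1))| ≤ 2000 * (1 + e) ^ 2 * B := by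
    rw [abs_neg, abs_mul, abs_mul, abs_of_pos μ0]
    calc |x| * (μ * |θ1|) ≤ e * (μ * (2000 * (1 + e) ^ 2 * ν)) := by
          gcongr; refine g1.trans ?_; gcongr
      _ = _ := by rw [hB]; ring
  have t4 : |lam * μ * (1 + x) * x * G2| ≤ 800 * (1 + e) ^ 2 * B := by
    rw [abs_mul, abs_mul, abs_mul, abs_mul, abs_of_pos p.lam0, abs_of_pos μ0]
    have l2 := p.lam2; have l0 := p.lam0
    calc lam * μ * |1 + x| * |x| * |G2| ≤ (2 * μ) * μ * (1 + e) * e * (400 * (1 + e) * h) := by gcongr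
      _ = _ := by rw [hB, p.hν]; ring
  have t5 : |μ * (1 / n) * ((1 + x) ^ 2 * r - 1)| ≤ 5 * (1 + e) ^ 2 * B := by
    rw [abs_mul, abs_of_pos (by positivity : 0 < μ * (1 / (n:ℝ)))]
    calc μ * (1 / n) * |(1 + x) ^ 2 * r - 1| ≤ μ * ν * (5 * (1 + e) ^ 2 * e) := by gcongr
      _ = _ := by rw [hB]; ring
  have t6 : |μ * ((q - (1 + x) / n) * ((1 + x) * r))| ≤ (1 + e) ^ 2 * B := by
    rw [abs_mul, abs_mul, abs_of_pos μ0]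
    have m2 := p.μk 2 (by norm_num)
    calc μ * (|q - (1 + x) / n| * |(1 + x) * r|) ≤ μ * ((322 * (1 + e) ^ 2 * μ * e * ν) * (4 * (1 + e) ^ 2)) := by gcongr
      _ = 1288 * (μ * (1 + e) ^ 2) * ((1 + e) ^ 2 * B) := by rw [hB]; ring
      _ ≤ 1288 * (1 / 100000) * ((1 + e) ^ 2 * B) := by gcongr
      _ ≤ _ := by
        have : 0 ≤ (1 + e) ^ 2 * B := by positivity
        linarith
  have t7 : |(c0 - (1 - μ)) * (lam + S) * x| ≤ 63 * B := by
    rw [← hσ, abs_mul, abs_mul, abs_of_nonneg s0]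
    calc |c0 - (1 - μ)| * σ * |x| ≤ 9 * ν * (7 * μ) * e := by gcongr
      _ = _ := by rw [hB]; ring
  have t8 : |-(μ * S * x)| ≤ 5 * B := by
    rw [abs_neg, abs_mul, abs_mul, abs_of_pos μ0, abs_of_nonneg S0]
    calc μ * S * |x| ≤ μ * (5 * ν) * e := by gcongr
      _ = _ := by rw [hB]; ring
  have WB : B ≤ (1 + e) ^ 2 * B := le_mul_of_one_le_left B0.le (one_le_pow₀ W1)
  have fin : 6000 * (1 + e) ^ 2 * μ * e * ν = 6000 * ((1 + e) ^ 2 * B) := by rw [hB]; ring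
  rw [fin]
  refine (abs_add_le _ _).trans ?_
  refine (add_le_add_left (abs_add_le _ _) _).trans ?_
  refine (add_le_add_left (add_le_add_left (abs_add_le _ _) _) _).trans ?_
  refine (add_le_add_left (add_le_add_left (add_le_add_left (abs_add_le _ _) _) _) _).trans ?_
  refine (add_le_add_left (add_le_add_left (add_le_add_left (add_le_add_left (abs_add_le _ _) _) _) _) _).trans ?_
  refine (add_le_add_left (add_le_add_left (add_le_add_left (add_le_add_left (add_le_add_left (abs_add_le _ _) _) _) _) _) _).trans ?_
  refine (add_le_add_left (add_le_add_left (add_le_add_left (add_le_add_left (add_le_add_left (add_le_add_left (abs_add_le _ _) _) _) _) _) _) _).trans ?_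
  linarith

end

structure CX (n : ℕ) (d e μ ν h lam L : ℝ) (J : ℕ) : Prop extends PR n d e μ ν h lam where
  hL : e * d = 2 * L
  hJ : (J : ℝ) + 1 ≤ L
  hq : 5 * L * J ≤ n * d

structure Good (n : ℕ) (d L : ℝ) (t : ℕ) (z : Fin n → ℤ) : Prop where
  nn : ∀ i, 0 ≤ z i
  dev : ∀ i, |(z i : ℝ) - d| ≤ L + t
  sm : |∑ i, (z i : ℝ) - n * d| ≤ 1 + t
  qq : ∑ i, ((z i : ℝ) - d) ^ 2 ≤ 4 * n * d + 5 * L * t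

def ep {n : ℕ} (d : ℝ) (z : Fin n → ℤ) (i : Fin n) : ℝ := ((z i : ℝ) - d) / d
def SS {n : ℕ} (d μ : ℝ) (z : Fin n → ℤ) : ℝ := μ * (∑ i, ep d z i ^ 2) / n
def sg {n : ℕ} (d μ lam : ℝ) (z : Fin n → ℤ) : ℝ := lam + SS d μ z
def hz {n : ℕ} (d μ lam : ℝ) (z : Fin n → ℤ) (i : Fin n) : ℝ := hht (sg d μ lam z) (ep d z i)

section
variable {n : ℕ} {d e μ ν h lam L : ℝ} {J : ℕ}

lemma CX.d0 (c : CX n d e μ ν h lam L J) : 0 < d := by have := c.d1; linarith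

lemma Good.mono {s t : ℕ} {z : Fin n → ℤ} (L0 : 0 ≤ L) (st : s ≤ t) (g : Good n d L s z) : Good n d L t z := by
  have h1 : (s : ℝ) ≤ t := by exact_mod_cast st
  refine ⟨g.nn, fun i => (g.dev i).trans (by linarith), g.sm.trans (by linarith), g.qq.trans ?_⟩
  gcongr

lemma CX.L0 (c : CX n d e μ ν h lam L J) : 1 ≤ L := by
  have := c.hJ; have : (0:ℝ) ≤ J := by positivity
  linarith

lemma Good.down (c : CX n d e μ ν h lam L J) {t : ℕ} {z : Fin n → ℤ} (g : Good n d L t z) (tJ : t ≤ J)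
    {a : Fin n} (ha : 1 ≤ z a) : Good n d L (t + 1) (z - ev a) := by
  have h1 : (t : ℝ) ≤ J := by exact_mod_cast tJ
  have h2 := c.hJ
  have h0 := c.L0
  have key : ∀ i, (((z - ev a) i : ℤ) : ℝ) = (z i : ℝ) - if i = a then 1 else 0 := by
    intro i
    rw [Pi.sub_apply, ev_apply]; push_cast
    split_ifs <;> simp
  refine ⟨fun i => ?_, fun i => ?_, ?_, ?_⟩
  · rw [Pi.sub_apply, ev_apply]
    have := g.nn i
    split_ifs with h
    · subst h; omega
    · omega
  · rw [key]
    have := abs_le.1 (g.dev i)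
    push_cast
    rw [abs_le]
    split_ifs <;> constructor <;> linarith
  · simp only [key, sum_sub_distrib]
    have := abs_le.1 g.sm
    simp only [sum_ite_eq', mem_univ, if_true]
    push_cast
    rw [abs_le]; constructor <;> linarith
  · have : ∀ i, (((z - ev a) i : ℤ) - d : ℝ) ^ 2 = ((z i : ℝ) - d) ^ 2 + if i = a then (-2 * ((z a : ℝ) - d) + 1) else 0 := by
      intro i
      rw [key]
      split_ifs with h
      · rw [h]; ring
      · ring
    rw [sum_congr rfl (fun i _ => this i), sum_add_distrib]
    simp only [sum_ite_eq', mem_univ, if_true]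
    have := abs_le.1 (g.dev a)
    have := g.qq
    push_cast
    linarith

lemma d_ep (c : CX n d e μ ν h lam L J) (z : Fin n → ℤ) (i : Fin n) : d * (1 + ep d z i) = z i := by
  have := c.d0; unfold ep; field_simp; ring

lemma Good.ad (c : CX n d e μ ν h lam L J) {t : ℕ} {z : Fin n → ℤ} (g : Good n d L t z) (tJ : t ≤ J) :
    AD n e h (ep d z) := by
  have h1 : (t : ℝ) ≤ J := by exact_mod_cast tJ
  have h2 := c.hJ
  have h0 := c.L0
  have d0 := c.d0
  have hL := c.hL
  have hd := c.hd
  refine ⟨fun i => ?_, fun i => ?_, ?_, ?_⟩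
  · have h3 := d_ep c z i
    have : (0:ℝ) ≤ z i := by exact_mod_cast g.nn i
    rw [← h3] at this
    have := nonneg_of_mul_nonneg_right this d0
    linarith
  · unfold ep
    rw [abs_div, abs_of_pos d0, div_le_iff₀ d0, hL]
    have := g.dev i; linarith
  · have : ∑ i, ep d z i = (∑ i, (z i : ℝ) - n * d) / d := by
      unfold ep; rw [← sum_div, sum_sub_distrib]; simp
    rw [this, abs_div, abs_of_pos d0, div_le_iff₀ d0, hL]
    have := g.sm; linarith
  · have : ∑ i, ep d z i ^ 2 = (∑ i, ((z i : ℝ) - d) ^ 2) / d ^ 2 := by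
      unfold ep; rw [sum_div]; simp only [div_pow]
    rw [this, div_le_iff₀ (by positivity)]
    have h3 := g.qq
    have h4 : 5 * L * t ≤ 5 * L * J := by gcongr
    have h5 := c.hq
    have h6 : 5 * n * h * d ^ 2 = 5 * (n * d) := by
      have : 5 * n * h * d ^ 2 = 5 * (n * d) * (h * d) := by ring
      rw [this, hd, mul_one]
    linarith

lemma SS_bound (c : CX n d e μ ν h lam L J) {z : Fin n → ℤ} (a : AD n e h (ep d z)) :
    0 ≤ SS d μ z ∧ SS d μ z ≤ 5 * ν := by
  have := c.hμ0
  have np := c.toPR.np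
  unfold SS
  refine ⟨by positivity, ?_⟩
  rw [div_le_iff₀ (by linarith), c.hν]
  have := a.s2
  calc μ * ∑ i, ep d z i ^ 2 ≤ μ * (5 * n * h) := by gcongr
      _ = _ := by ring

lemma sg_bound (c : CX n d e μ ν h lam L J) {z : Fin n → ℤ} (a : AD n e h (ep d z)) :
    0 ≤ sg d μ lam z ∧ sg d μ lam z ≤ 7 * μ := by
  have h1 := SS_bound c a
  have := c.toPR.lam0; have := c.toPR.lam2; have := c.toPR.νμ
  unfold sg
  constructor <;> linarith

lemma hz_nonneg (c : CX n d e μ ν h lam L J) {z : Fin n → ℤ} (a : AD n e h (ep d z)) (i : Fin n) :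
    0 ≤ hz d μ lam z i :=
  hh_nonneg c.toPR (sg_bound c a).1 (sg_bound c a).2 (a.hi i) (a.lo i)

lemma ep_zero (c : CX n d e μ ν h lam L J) {z : Fin n → ℤ} {i : Fin n} (hi : z i = 0) : ep d z i = -1 := by
  have := c.d0; unfold ep; rw [hi]; field_simp; simp

lemma hz_zero (c : CX n d e μ ν h lam L J) {z : Fin n → ℤ} {i : Fin n} (hi : z i = 0) : hz d μ lam z i = 0 := by
  unfold hz hht; rw [ep_zero c hi]; simp

lemma ep_sub (c : CX n d e μ ν h lam L J) (z : Fin n → ℤ) (a i : Fin n) :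
    ep d (z - ev a) i = ep d z i - if i = a then h else 0 := by
  have := c.d0
  have hd := c.hd
  have : h = 1 / d := by field_simp; linarith
  unfold ep
  rw [Pi.sub_apply, ev_apply, this]
  split_ifs <;> push_cast <;> field_simp <;> ring

lemma NN_sub_zero {z : Fin n → ℤ} {i : Fin n} (hi : z i = 0) : NN (z - ev i) = 0 := by
  apply NN_neg (a := i)
  rw [Pi.sub_apply, ev_self, hi]; norm_num

/-- upper bound and positivity -/
lemma basic (c : CX n d e μ ν h lam L J) {t : ℕ} {z : Fin n → ℤ} (g : Good n d L t z) (tJ : t ≤ J)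
    (hev : Even (∑ i, z i)) : 0 < NN z ∧ ∀ a v, a ≠ v → EC z a v ≤ 2 * μ * (1 + e) ^ 2 * NN z := by
  have ad := g.ad c tJ
  have d0 := c.d0
  have e0 := c.toPR.e0
  have h1 : (t : ℝ) ≤ J := by exact_mod_cast tJ
  have h2 := c.hJ
  have hL := c.hL
  set Δ : ℕ := ⌊d * (1 + e)⌋₊ with hΔ
  have Δ1 : (Δ : ℝ) ≤ d * (1 + e) := Nat.floor_le (by positivity)
  have zΔ : ∀ i, z i ≤ Δ := by
    intro i
    have h3 := d_ep c z i
    have h4 := abs_le.1 (ad.hi i)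
    have h5 := g.nn i
    obtain ⟨k, hk⟩ := Int.eq_ofNat_of_zero_le h5
    rw [hk] at h3 ⊢
    have : k ≤ Δ := by
      apply Nat.le_floor
      push_cast at h3
      rw [← h3]; gcongr; linarith
    exact_mod_cast this
  have Δp : 1 ≤ Δ := by
    apply Nat.le_floor
    have := c.d1; push_cast; nlinarith
  have wn := W_n c.toPR
  have np := c.toPR.np
  have hnν := c.hnν
  have ν0 := c.toPR.ν0
  have hμ := c.hμ0
  have hdn : d * ν = μ := by rw [c.hν]; have := c.hd; linear_combination μ * this
  have dn : d = μ * (n - 1) := by rw [← hdn]; linear_combination (-d) * hnν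
  have m2 := c.toPR.μk 2 (by norm_num)
  have dW : d * (1 + e) ^ 2 ≤ n / 100000 := by
    calc d * (1 + e) ^ 2 = (μ * (1 + e) ^ 2) * ((n:ℝ) - 1) := by rw [dn]; ring
      _ ≤ 1 / 100000 * ((n:ℝ) - 1) := by gcongr; linarith
      _ ≤ _ := by linarith
  have ΔΔ : (Δ : ℝ) * (Δ + 1) ≤ 2 * d * (d * (1 + e) ^ 2) := by
    have : (1:ℝ) ≤ Δ := by exact_mod_cast Δp
    calc (Δ : ℝ) * (Δ + 1) ≤ Δ * (2 * Δ) := by gcongr; linarith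
      _ ≤ (d * (1 + e)) * (2 * (d * (1 + e))) := by gcongr
      _ = _ := by ring
  have ΔΔ2 : (Δ : ℝ) * (Δ + 1) ≤ n * d / 50000 := by
    calc _ ≤ _ := ΔΔ
      _ ≤ 2 * d * (n / 100000) := by gcongr
      _ = _ := by ring
  have sumlo : n * d * (9 / 10) ≤ ∑ i, (z i : ℝ) := by
    have s := abs_le.1 g.sm
    have : e * d ≤ n / 100000 * d := by gcongr; linarith
    have : 0 < n * d := by positivity
    linarith
  have sumcast : ((∑ i, z i : ℤ) : ℝ) = ∑ i, (z i : ℝ) := by push_cast; rfl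
  constructor
  · apply F3 z Δ zΔ g.nn hev Δp
    have : (6 * ((Δ:ℝ) * (Δ + 1))) ≤ ((∑ i, z i : ℤ) : ℝ) := by
      rw [sumcast]
      have : 0 < n * d := by positivity
      linarith
    exact_mod_cast this
  · intro a v hav
    have f := F4 z hav Δ zΔ
    rw [sumcast] at f
    have n0 := NN_nonneg z
    have e1 := EC_nonneg z a v
    have nd1 : (100000:ℝ) ≤ n * d := by
      have := c.d1; nlinarith
    have f1 : EC z a v * (n * d / 2) ≤ Δ ^ 2 * NN z := by
      calc EC z a v * (n * d / 2) ≤ EC z a v * (∑ i, (z i : ℝ) - 2 - 2 * (Δ * (Δ + 1))) := by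
            gcongr; linarith
        _ ≤ _ := f
        _ ≤ _ := by gcongr; linarith
    have f2 : (Δ:ℝ) ^ 2 * NN z ≤ (d * (1 + e)) ^ 2 * NN z := by gcongr
    have f3 : EC z a v * (n * d / 2) ≤ (2 * μ * (1 + e) ^ 2 * NN z) * (n * d / 2) := by
      calc _ ≤ _ := f1
        _ ≤ _ := f2
        _ = (1 + e) ^ 2 * NN z * d * d := by ring
        _ ≤ (1 + e) ^ 2 * NN z * d * (μ * n) := by
          gcongr; rw [dn]; gcongr; linarith
        _ = _ := by ring
    exact le_of_mul_le_mul_right f3 (by positivity)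

end

lemma finish_aux {F W κ ρ η : ℝ} (hW : 0 ≤ W) (hρ : |ρ - 1| ≤ 1 / 1000) (hη : 0 ≤ η)
    (hF : |F - W * κ * ρ| ≤ W * η) : |F / ρ - W * κ| ≤ 101 / 100 * (W * η) := by
  have h := abs_le.1 hρ
  have ρ0 : 0 < ρ := by linarith
  have : F / ρ - W * κ = (F - W * κ * ρ) / ρ := by field_simp
  rw [this, abs_div, abs_of_pos ρ0, div_le_iff₀ ρ0]
  have h0 : 0 ≤ W * η := by positivity
  calc _ ≤ W * η := hF
    _ = (W * η) * 1 := by ring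
    _ ≤ (W * η) * (101 / 100 * ρ) := by gcongr; linarith
    _ = _ := by ring

lemma finish {Fa Fb W κ ρa ρb η : ℝ} (hW : 0 ≤ W) (hκ : 1 / 2 ≤ κ) (ha : |ρa - 1| ≤ 1 / 1000)
    (hb : |ρb - 1| ≤ 1 / 1000) (hη : 0 ≤ η) (hη2 : η ≤ 1 / 20)
    (hFa : |Fa - W * κ * ρa| ≤ W * η) (hFb : |Fb - W * κ * ρb| ≤ W * η) :
    |Fb / ρb - Fa / ρa| ≤ 10 * η * (Fa / ρa) := by
  have h1 := abs_le.1 (finish_aux hW ha hη hFa)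
  have h2 := abs_le.1 (finish_aux hW hb hη hFb)
  have h3 : W * η ≤ W * (1 / 20) := by gcongr
  have h4 : W * (1 / 2) ≤ W * κ := by gcongr
  have h5 : W * (2 / 5) ≤ Fa / ρa := by linarith
  have h6 : W * η * 4 ≤ 10 * η * (Fa / ρa) := by
    calc W * η * 4 = 10 * η * (W * (2 / 5)) := by ring
      _ ≤ _ := by gcongr
  have h7 : 0 ≤ W * η := by positivity
  rw [abs_le]; constructor <;> linarith

def MC (n : ℕ) (d μ lam L : ℝ) (T : ℕ) (M : ℝ) : Prop :=
  ∀ x : Fin n → ℤ, Good n d L T x → Odd (∑ i, x i) → ∀ a b, a ≠ b →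
    |NN (x - ev a) * hz d μ lam x b - NN (x - ev b) * hz d μ lam x a| ≤ M * (NN (x - ev b) * hz d μ lam x a)

def BC (n : ℕ) (d μ lam L : ℝ) (T : ℕ) (β : ℝ) : Prop :=
  ∀ z : Fin n → ℤ, Good n d L T z → Even (∑ i, z i) → ∀ a v, a ≠ v →
    |EC z a v - Pf μ lam (ep d z a) (ep d z v) * NN z| ≤ β * NN z

lemma odd_sub {n : ℕ} {z : Fin n → ℤ} (a : Fin n) (h : Odd (∑ i, z i)) : Even (∑ i, (z - ev a) i) := by
  simp only [Pi.sub_apply, sum_sub_distrib, sum_ev]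
  exact h.sub_odd odd_one

lemma even_sub {n : ℕ} {z : Fin n → ℤ} (a : Fin n) (h : Even (∑ i, z i)) : Odd (∑ i, (z - ev a) i) := by
  simp only [Pi.sub_apply, sum_sub_distrib, sum_ev]
  exact h.sub_odd odd_one

section
variable {n : ℕ} {d e μ ν h lam L : ℝ} {J : ℕ}

lemma MC_sum {T : ℕ} {M : ℝ} (M0 : 0 ≤ M) (mc : MC n d μ lam L T M) (c : CX n d e μ ν h lam L J) (TJ : T ≤ J) {z : Fin n → ℤ} (g : Good n d L T z)
    (ho : Odd (∑ i, z i)) (s : Finset (Fin n)) (v : Fin n) :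
    |NN (z - ev v) * (∑ u ∈ s, hz d μ lam z u) - (∑ u ∈ s, NN (z - ev u)) * hz d μ lam z v|
      ≤ M * ((∑ u ∈ s, NN (z - ev u)) * hz d μ lam z v) := by
  rw [mul_sum, sum_mul, ← sum_sub_distrib, mul_sum]
  refine (abs_sum_le_sum_abs _ _).trans (sum_le_sum fun u _ => ?_)
  by_cases huv : v = u
  · subst huv
    rw [sub_self, abs_zero]
    have := NN_nonneg (z - ev v)
    have := hz_nonneg c (g.ad c TJ) v
    positivity
  · exact mc z g ho v u huv

lemma one_le_of {z : ℤ} (h0 : 0 ≤ z) (h : z ≠ 0) : 1 ≤ z := by omega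

/-- Main identity for step R -/
lemma FaEq {x : Fin n → ℤ} {a b : Fin n} (hab : a ≠ b) :
    ∑ v ∈ univ.erase a, (NN (x - ev a - ev b - ev v) - EC (x - ev a - ev b - ev v) a v) = x a * NN (x - ev b) := by
  have := F2 (x - ev b) a
  rw [Pi.sub_apply, ev_ne hab, sub_zero] at this
  rw [← this]
  refine sum_congr rfl fun v hv => ?_
  rw [F1 (x - ev b) (ne_of_mem_erase hv).symm, sub_right_comm x (ev b) (ev a)]

lemma hz_q (c : CX n d e μ ν h lam L J) {z : Fin n → ℤ} (ad : AD n e h (ep d z)) (a : Fin n) :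
    hz d μ lam z a / (∑ j, hz d μ lam z j) ≤ 4 * μ * (1 + e) ^ 2 := by
  have sb := sg_bound c ad
  have hH := H_half c.toPR sb.1 sb.2 ad
  have h3 := abs_le.1 (hh3 c.toPR sb.1 sb.2 (ad.hi a))
  have np := c.toPR.np
  have e0 := c.toPR.e0
  have ν0 := c.toPR.ν0
  have hi := ad.hi a
  have inv := c.toPR.inv_n
  change hht _ _ / (∑ j, hht _ _) ≤ _
  have hn : hht (sg d μ lam z) (ep d z a) ≤ 2 * (1 + e) := by linarith
  have h1 : (n : ℝ) ≠ 0 := by linarith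
  calc _ ≤ 2 * (1 + e) / (n / 2) := by gcongr
    _ = 4 * (1 + e) * (1 / n) := by field_simp; norm_num
    _ ≤ 4 * (1 + e) * ν := by gcongr
    _ ≤ 4 * (1 + e) * (μ * (1 + e)) := by
      have := c.toPR.νμ; have := c.hμ0
      gcongr; nlinarith
    _ = _ := by ring

lemma Fa_bound (c : CX n d e μ ν h lam L J) {t : ℕ} (tJ : t + 1 ≤ J) {z : Fin n → ℤ} (g : Good n d L t z)
    (ho : Odd (∑ i, z i)) {M β : ℝ} (M0 : 0 ≤ M) (β0 : 0 ≤ β) (mc : MC n d μ lam L t M) (bc : BC n d μ lam L (t + 1) β) :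
    ∃ κ : ℝ, 1 / 2 ≤ κ ∧ κ ≤ 2 ∧ ∀ a, |∑ v ∈ univ.erase a, (NN (z - ev v) - EC (z - ev v) a v)
      - (∑ v, NN (z - ev v)) * κ * (1 - sg d μ lam z * ep d z a)| ≤
      (∑ v, NN (z - ev v)) * (6 * μ * (1 + e) ^ 2 * M + β + 6000 * (1 + e) ^ 2 * μ * e * ν) := by
  have ad := g.ad c (by omega : t ≤ J)
  have sb := sg_bound c ad
  obtain ⟨κ, k1, k2, hκ⟩ := ER c.toPR ad rfl rfl sb.1 sb.2
  refine ⟨κ, k1, k2, fun a => ?_⟩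
  have hκ := hκ a
  have e0 := c.toPR.e0
  have μ0 := c.hμ0
  have np := c.toPR.np
  change |(1 - hz d μ lam z a / (∑ j, hz d μ lam z j) - ∑ v ∈ univ.erase a, hz d μ lam z v / (∑ j, hz d μ lam z j) * Pf μ lam (ep d z a) (ep d z v - h)) - _| ≤ _ at hκ
  have hH : (n : ℝ) / 2 ≤ ∑ j, hz d μ lam z j := H_half c.toPR sb.1 sb.2 ad
  have qa := hz_q c ad a
  have ms := MC_sum M0 mc c (by omega) g ho univ
  have hn := hz_nonneg c ad
  have Pb : ∀ v, |Pf μ lam (ep d z a) (ep d z v - h)| ≤ 2 * μ * (1 + e) ^ 2 := by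
    intro v
    have y := y_bounds c.toPR (ad.hi v) (ad.lo v)
    refine abs_Pf_le c.toPR (ad.hi a) y.1 ?_ y.2.1
    have := ad.lo a; have := abs_le.1 (ad.hi a)
    rw [abs_le]; constructor <;> linarith
  have ecb : ∀ v, a ≠ v → |EC (z - ev v) a v - Pf μ lam (ep d z a) (ep d z v - h) * NN (z - ev v)| ≤ β * NN (z - ev v) := by
    intro v hv
    by_cases h0 : z v = 0
    · have h1 := NN_sub_zero h0
      have h2 := EC_le (z - ev v) a v
      have h3 := EC_nonneg (z - ev v) a v
      rw [h1] at h2 ⊢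
      rw [le_antisymm h2 h3]; simp
    · have g' := g.down c (by omega) (one_le_of (g.nn v) h0)
      have := bc _ g' (odd_sub v ho) a v hv
      rw [ep_sub c, ep_sub c, if_neg hv, if_pos rfl, sub_zero] at this
      exact this
  set H := ∑ j, hz d μ lam z j with hHd
  set Wt := ∑ v, NN (z - ev v) with hWt
  have H0 : 0 < H := by linarith
  have W0 : 0 ≤ Wt := sum_nonneg fun v _ => NN_nonneg _
  set q : Fin n → ℝ := fun v => hz d μ lam z v / H with hq
  have q0 : ∀ v, 0 ≤ q v := fun v => div_nonneg (hn v) H0.le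
  have qs : ∑ v, q v = 1 := by rw [hq, ← sum_div, ← hHd]; exact div_self H0.ne'
  have wq : ∀ v, |NN (z - ev v) - Wt * q v| ≤ M * Wt * q v := by
    intro v
    have h1 : NN (z - ev v) - Wt * q v = (NN (z - ev v) * H - Wt * hz d μ lam z v) / H := by
      rw [hq]; field_simp
    rw [h1, abs_div, abs_of_pos H0, div_le_iff₀ H0]
    refine (ms v).trans (le_of_eq ?_)
    rw [hq]; field_simp
  set w : Fin n → ℝ := fun v => NN (z - ev v) with hw
  set P : Fin n → ℝ := fun v => Pf μ lam (ep d z a) (ep d z v - h) with hP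
  have w0 : ∀ v, 0 ≤ w v := fun v => NN_nonneg _
  have s1 : |∑ v ∈ univ.erase a, (w v - EC (z - ev v) a v) - ∑ v ∈ univ.erase a, (w v - P v * w v)| ≤ β * Wt := by
    rw [← sum_sub_distrib]
    refine (abs_sum_le_sum_abs _ _).trans ?_
    calc _ ≤ ∑ v ∈ univ.erase a, β * w v := by
          refine sum_le_sum fun v hv => ?_
          rw [show w v - EC (z - ev v) a v - (w v - P v * w v) = -(EC (z - ev v) a v - P v * w v) by ring, abs_neg]
          exact ecb v (ne_of_mem_erase hv).symm
      _ ≤ ∑ v, β * w v := sum_le_sum_of_subset_of_nonneg (erase_subset _ _) fun v _ _ => mul_nonneg β0 (w0 v)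
      _ = _ := by rw [← mul_sum]
  have s2 : ∑ v ∈ univ.erase a, (w v - P v * w v) = Wt - w a - ∑ v ∈ univ.erase a, P v * w v := by
    rw [sum_sub_distrib, sum_erase_eq_sub (mem_univ a)]
  have s3 : |∑ v ∈ univ.erase a, P v * w v - Wt * ∑ v ∈ univ.erase a, q v * P v| ≤ 2 * μ * (1 + e) ^ 2 * (M * Wt) := by
    rw [mul_sum, ← sum_sub_distrib]
    refine (abs_sum_le_sum_abs _ _).trans ?_
    calc _ ≤ ∑ v ∈ univ.erase a, 2 * μ * (1 + e) ^ 2 * (M * Wt) * q v := by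
          refine sum_le_sum fun v hv => ?_
          rw [show P v * w v - Wt * (q v * P v) = P v * (w v - Wt * q v) by ring, abs_mul]
          calc _ ≤ (2 * μ * (1 + e) ^ 2) * (M * Wt * q v) := by
                apply mul_le_mul (Pb v) (wq v) (abs_nonneg _) (by positivity)
            _ = _ := by ring
      _ ≤ ∑ v, 2 * μ * (1 + e) ^ 2 * (M * Wt) * q v := sum_le_sum_of_subset_of_nonneg (erase_subset _ _) fun v _ _ => by
            have := q0 v; positivity
      _ = _ := by rw [← mul_sum, qs, mul_one]
  have s4 : |w a - Wt * q a| ≤ M * Wt * (4 * μ * (1 + e) ^ 2) := (wq a).trans (by gcongr)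
  have s5 : |Wt * ((1 - q a - ∑ v ∈ univ.erase a, q v * P v) - κ * (1 - sg d μ lam z * ep d z a))| ≤ Wt * (6000 * (1 + e) ^ 2 * μ * e * ν) := by
    rw [abs_mul, abs_of_nonneg W0]; gcongr; exact hκ
  rw [s2] at s1
  have t1 := abs_le.1 s1; have t3 := abs_le.1 s3; have t4 := abs_le.1 s4; have t5 := abs_le.1 s5
  generalize ∑ v ∈ univ.erase a, P v * w v = X1 at *
  generalize ∑ v ∈ univ.erase a, q v * P v = X2 at *
  generalize ∑ v ∈ univ.erase a, (w v - EC (z - ev v) a v) = X3 at *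
  clear_value w q Wt
  rw [abs_le]; constructor <;> linarith

end

section
variable {n : ℕ} {d e μ ν h lam L : ℝ} {J : ℕ}

lemma sumsq_sub (c : CX n d e μ ν h lam L J) (z : Fin n → ℤ) (a : Fin n) :
    ∑ i, ep d (z - ev a) i ^ 2 = ∑ i, ep d z i ^ 2 - 2 * h * ep d z a + h ^ 2 := by
  have : ∀ i, ep d (z - ev a) i ^ 2 = ep d z i ^ 2 + if i = a then (-2 * h * ep d z a + h ^ 2) else 0 := by
    intro i
    rw [ep_sub c]
    split_ifs with hi
    · rw [hi]; ring
    · ring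
  rw [sum_congr rfl fun i _ => this i, sum_add_distrib]
  simp only [sum_ite_eq', mem_univ, if_true]
  ring

/-- change of `sg` under one subtraction -/
lemma sg_sub (c : CX n d e μ ν h lam L J) (z : Fin n → ℤ) (a : Fin n) (ha : |ep d z a| ≤ e) :
    |sg d μ lam (z - ev a) - sg d μ lam z| ≤ 3 * ν ^ 2 * e := by
  have p := c.toPR
  have := p.e0; have := p.h0; have := p.he; have := p.np; have := c.hμ0; have := p.inv_n; have := p.ν0
  have h1 : sg d μ lam (z - ev a) - sg d μ lam z = μ * h * (1 / n) * (-2 * ep d z a + h) := by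
    unfold sg SS; rw [sumsq_sub c]; ring
  have h2 : |-2 * ep d z a + h| ≤ 3 * e := by
    have := abs_le.1 ha
    rw [abs_le]; constructor <;> linarith
  rw [h1, ← c.hν, abs_mul, abs_of_nonneg (by positivity)]
  calc _ ≤ ν * ν * (3 * e) := by gcongr
    _ = _ := by ring

lemma rho_alg {e μ ν h σ σ' ε : ℝ} (e0 : 0 ≤ e) (μ0 : 0 ≤ μ) (ν0 : 0 ≤ ν) (h0 : 0 ≤ h) (he : h ≤ e) (νμ : ν ≤ μ) (hν : ν = μ * h)
    (s0 : 0 ≤ σ) (s7 : σ ≤ 7 * μ) (hσ : |σ' - σ| ≤ 6 * ν ^ 2 * e) (hε : |ε| ≤ e) (_μ1 : μ ≤ 1) :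
    |1 - σ' * (ε - h) - (1 + σ * h) * (1 - σ * ε)| ≤ 61 * (1 + e) * μ * e * ν := by
  have h1 : 1 - σ' * (ε - h) - (1 + σ * h) * (1 - σ * ε) = -((σ' - σ) * (ε - h)) + σ * σ * h * ε := by ring
  have h2 : |ε - h| ≤ 2 * e := by
    have := abs_le.1 hε; rw [abs_le]; constructor <;> linarith
  rw [h1]
  refine (abs_add_le _ _).trans ?_
  rw [abs_neg, abs_mul, abs_mul, abs_of_nonneg (by positivity : 0 ≤ σ * σ * h)]
  calc _ ≤ 6 * ν ^ 2 * e * (2 * e) + (7 * μ) * (7 * μ) * h * e := by gcongr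
    _ = 12 * e * (e * ν * ν) + 49 * μ * e * ν := by rw [hν]; ring
    _ ≤ 12 * e * (e * μ * ν) + 49 * (1 + e) * μ * e * ν := by
      gcongr
      nlinarith
    _ ≤ 12 * (1 + e) * (e * μ * ν) + 49 * (1 + e) * μ * e * ν := by gcongr; linarith
    _ = _ := by ring

lemma hz_eq (c : CX n d e μ ν h lam L J) {x : Fin n → ℤ} (b : Fin n) :
    hz d μ lam x b = x b / d / (1 - sg d μ lam x * ep d x b) := by
  have := c.d0
  unfold hz hht; congr 1
  rw [← d_ep c x b]; field_simp

/-- convert a statement on `F/ρ` into the ratio statement -/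
lemma conv_MC (c : CX n d e μ ν h lam L J) {x : Fin n → ℤ} {a b : Fin n} {Fa Fb M : ℝ}
    (hFa : Fa = x a * NN (x - ev b)) (hFb : Fb = x b * NN (x - ev a))
    (H : |Fb / (1 - sg d μ lam x * ep d x b) - Fa / (1 - sg d μ lam x * ep d x a)| ≤ M * (Fa / (1 - sg d μ lam x * ep d x a))) :
    |NN (x - ev a) * hz d μ lam x b - NN (x - ev b) * hz d μ lam x a| ≤ M * (NN (x - ev b) * hz d μ lam x a) := by
  have d0 := c.d0
  rw [hz_eq c, hz_eq c]
  have h1 : NN (x - ev a) * (x b / d / (1 - sg d μ lam x * ep d x b)) = Fb / (1 - sg d μ lam x * ep d x b) / d := by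
    rw [hFb]; ring
  have h2 : NN (x - ev b) * (x a / d / (1 - sg d μ lam x * ep d x a)) = Fa / (1 - sg d μ lam x * ep d x a) / d := by
    rw [hFa]; ring
  rw [h1, h2, ← sub_div, abs_div, abs_of_pos d0, ← mul_div_assoc]
  gcongr

lemma triv_MC (c : CX n d e μ ν h lam L J) {x : Fin n → ℤ} {a b : Fin n} (M : ℝ) (hx : x a = 0 ∨ x b = 0) :
    |NN (x - ev a) * hz d μ lam x b - NN (x - ev b) * hz d μ lam x a| ≤ M * (NN (x - ev b) * hz d μ lam x a) := by
  rcases hx with h0 | h0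
  · rw [NN_sub_zero h0, hz_zero c h0]; simp
  · rw [NN_sub_zero h0, hz_zero c h0]; simp

lemma rho_near (c : CX n d e μ ν h lam L J) {x : Fin n → ℤ} (ad : AD n e h (ep d x)) (a : Fin n) :
    |1 - sg d μ lam x * ep d x a - 1| ≤ 1 / 1000 := by
  have sb := sg_bound c ad
  have := sx c.toPR sb.1 sb.2 (ad.hi a)
  rw [show 1 - sg d μ lam x * ep d x a - 1 = -(sg d μ lam x * ep d x a) by ring, abs_neg]
  linarith

lemma stepR (c : CX n d e μ ν h lam L J) {T : ℕ} (TJ : T + 3 ≤ J) {M β : ℝ} (M0 : 0 ≤ M) (β0 : 0 ≤ β)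
    (mc : MC n d μ lam L (T + 2) M) (bc : BC n d μ lam L (T + 3) β)
    (hη : 6 * μ * (1 + e) ^ 2 * M + β + 6200 * (1 + e) ^ 2 * μ * e * ν ≤ 1 / 20) :
    MC n d μ lam L T (10 * (6 * μ * (1 + e) ^ 2 * M + β + 6200 * (1 + e) ^ 2 * μ * e * ν)) := by
  intro x g ho a b hab
  by_cases h0 : x a = 0 ∨ x b = 0
  · exact triv_MC c _ h0
  rw [not_or] at h0
  have xa := one_le_of (g.nn a) h0.1
  have xb := one_le_of (g.nn b) h0.2
  have g1 := g.down c (by omega) xa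
  have g2 : Good n d L (T + 2) (x - ev a - ev b) := g1.down c (by omega) (by rw [Pi.sub_apply, ev_ne hab.symm]; omega)
  have ho2 : Odd (∑ i, (x - ev a - ev b) i) := even_sub b (odd_sub a ho)
  obtain ⟨κ, k1, k2, hκ⟩ := Fa_bound c (by omega) g2 ho2 M0 β0 mc bc
  have p := c.toPR
  have ad := g.ad c (by omega : T ≤ J)
  have ad1 := g1.ad c (by omega : T + 1 ≤ J)
  have sb := sg_bound c ad
  have e0 := p.e0; have μ0 := c.hμ0; have ν0 := p.ν0; have h0' := p.h0
  have hs : |sg d μ lam (x - ev a - ev b) - sg d μ lam x| ≤ 6 * ν ^ 2 * e := by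
    have s1 := sg_sub c x a (ad.hi a)
    have s2 := sg_sub c (x - ev a) b (ad1.hi b)
    have := abs_le.1 s1; have := abs_le.1 s2
    rw [abs_le]; constructor <;> linarith
  set W := ∑ v, NN (x - ev a - ev b - ev v) with hW
  have W0 : 0 ≤ W := sum_nonneg fun v _ => NN_nonneg _
  have main : ∀ i, (i = a ∨ i = b) → |∑ v ∈ univ.erase i, (NN (x - ev a - ev b - ev v) - EC (x - ev a - ev b - ev v) i v)
      - W * (κ * (1 + sg d μ lam x * h)) * (1 - sg d μ lam x * ep d x i)| ≤ W * (6 * μ * (1 + e) ^ 2 * M + β + 6200 * (1 + e) ^ 2 * μ * e * ν) := by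
    intro i hi
    have epi : ep d (x - ev a - ev b) i = ep d x i - h := by
      rw [ep_sub c, ep_sub c]
      rcases hi with rfl | rfl
      · rw [if_pos rfl, if_neg hab]; ring
      · rw [if_pos rfl, if_neg hab.symm]; ring
    have hk := hκ i
    rw [epi] at hk
    have hr := rho_alg e0.le μ0.le ν0.le h0'.le c.he p.νμ c.hν sb.1 sb.2 hs (ad.hi i) (by have := p.μ1; linarith)
    have hr2 : |W * κ * (1 - sg d μ lam (x - ev a - ev b) * (ep d x i - h) - (1 + sg d μ lam x * h) * (1 - sg d μ lam x * ep d x i))|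
        ≤ W * (200 * (1 + e) ^ 2 * μ * e * ν) := by
      rw [abs_mul, abs_of_nonneg (by positivity)]
      calc _ ≤ W * 2 * (61 * (1 + e) * μ * e * ν) := by gcongr
        _ = W * (122 * (1 + e) * μ * e * ν) := by ring
        _ ≤ _ := by
          gcongr
          · norm_num
          · nlinarith
    have t1 := abs_le.1 hk; have t2 := abs_le.1 hr2
    generalize ∑ v ∈ univ.erase i, (NN (x - ev a - ev b - ev v) - EC (x - ev a - ev b - ev v) i v) = X at *
    generalize sg d μ lam (x - ev a - ev b) = s' at *
    generalize sg d μ lam x = s at *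
    clear_value W
    rw [abs_le]; constructor <;> linarith
  refine conv_MC c (FaEq hab) ?_ ?_ (Fb := ∑ v ∈ univ.erase b, (NN (x - ev a - ev b - ev v) - EC (x - ev a - ev b - ev v) b v))
  · rw [← FaEq hab.symm, sub_right_comm x (ev a) (ev b)]
  · refine finish W0 ?_ (rho_near c ad a) (rho_near c ad b) (by positivity) hη (main a (Or.inl rfl)) (main b (Or.inr rfl))
    have : 0 ≤ sg d μ lam x * h := mul_nonneg sb.1 h0'.le
    nlinarith

/-- initial bounds -/
lemma initB (c : CX n d e μ ν h lam L J) {T : ℕ} (TJ : T ≤ J) : BC n d μ lam L T (4 * μ * (1 + e) ^ 2) := by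
  intro z g ev a v hav
  have b := basic c g TJ ev
  have h1 := b.2 a v hav
  have h2 := EC_nonneg z a v
  have ad := g.ad c TJ
  have e0 := c.toPR.e0
  have h3 := abs_Pf_le c.toPR (ad.hi a) (y := ep d z v) (by have := ad.hi v; linarith)
    (by have := ad.lo a; have := abs_le.1 (ad.hi a); rw [abs_le]; constructor <;> linarith)
    (by have := ad.lo v; have := abs_le.1 (ad.hi v); rw [abs_le]; constructor <;> linarith)
  have h4 : |Pf μ lam (ep d z a) (ep d z v) * NN z| ≤ 2 * μ * (1 + e) ^ 2 * NN z := by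
    rw [abs_mul, abs_of_pos b.1]; have := b.1; gcongr
  have := abs_le.1 h4
  rw [abs_le]; constructor <;> linarith

lemma initM (c : CX n d e μ ν h lam L J) {T : ℕ} (TJ : T + 3 ≤ J) : MC n d μ lam L T (140 * μ * (1 + e) ^ 2) := by
  intro x g ho a b hab
  by_cases h0 : x a = 0 ∨ x b = 0
  · exact triv_MC c _ h0
  rw [not_or] at h0
  have xa := one_le_of (g.nn a) h0.1
  have xb := one_le_of (g.nn b) h0.2
  have ga := g.down c (by omega) xa
  have gb := g.down c (by omega) xb
  have g2 : Good n d L (T + 2) (x - ev a - ev b) := ga.down c (by omega) (by rw [Pi.sub_apply, ev_ne hab.symm]; omega)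
  have ho2 : Odd (∑ i, (x - ev a - ev b) i) := even_sub b (odd_sub a ho)
  have p := c.toPR
  have ad := g.ad c (by omega : T ≤ J)
  have sb := sg_bound c ad
  have e0 := p.e0; have μ0 := c.hμ0
  have m2 := p.μk 2 (by norm_num)
  obtain ⟨ph, hph⟩ : ∃ ph, ph = 2 * μ * (1 + e) ^ 2 := ⟨_, rfl⟩
  have ph0 : 0 ≤ ph := by rw [hph]; positivity
  have ph1 : ph ≤ 1 / 50000 := by rw [hph]; linarith
  set W := ∑ v, NN (x - ev a - ev b - ev v) with hW
  have W0 : 0 ≤ W := sum_nonneg fun v _ => NN_nonneg _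
  have wW : ∀ v, NN (x - ev a - ev b - ev v) ≤ W := fun v => single_le_sum (f := fun v => NN (x - ev a - ev b - ev v)) (fun v _ => NN_nonneg _) (mem_univ v)
  have wP : ∀ i v, i ≠ v → EC (x - ev a - ev b - ev v) i v ≤ ph * NN (x - ev a - ev b - ev v) := by
    intro i v hv
    by_cases h0 : (x - ev a - ev b) v = 0
    · have h1 := NN_sub_zero h0
      have h2 := EC_le (x - ev a - ev b - ev v) i v
      rw [h1] at h2 ⊢; linarith
    · have g3 := g2.down c (by omega) (one_le_of (g2.nn v) h0)
      rw [hph]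
      exact (basic c g3 (by omega) (odd_sub v ho2)).2 i v hv
  -- lower/upper bounds on F
  have Fle : ∀ i, ∑ v ∈ univ.erase i, (NN (x - ev a - ev b - ev v) - EC (x - ev a - ev b - ev v) i v) ≤ W := by
    intro i
    calc _ ≤ ∑ v ∈ univ.erase i, NN (x - ev a - ev b - ev v) := sum_le_sum fun v _ => by
            have := EC_nonneg (x - ev a - ev b - ev v) i v; linarith
      _ ≤ _ := sum_le_sum_of_subset_of_nonneg (erase_subset _ _) fun v _ _ => NN_nonneg _
  -- w_v small
  have NaW : NN (x - ev b) ≤ W := by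
    have h1 := Fle a
    rw [FaEq hab] at h1
    have : (1:ℝ) ≤ x a := by exact_mod_cast xa
    have := NN_nonneg (x - ev b)
    nlinarith
  have NbW : NN (x - ev a) ≤ W := by
    have h1 := Fle b
    rw [sub_right_comm x (ev a) (ev b), FaEq hab.symm] at h1
    have : (1:ℝ) ≤ x b := by exact_mod_cast xb
    have := NN_nonneg (x - ev a)
    nlinarith
  have ws : ∀ v, NN (x - ev a - ev b - ev v) ≤ 2 * ph * W := by
    have fin : ∀ w N, 0 ≤ w → w - ph * w ≤ ph * N → N ≤ W → w ≤ 2 * ph * W := by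
      intro w N hw h1 h2
      have : ph * N ≤ ph * W := by gcongr
      nlinarith
    intro v
    by_cases hv : v = a
    · have hvb : b ≠ v := by rw [hv]; exact hab.symm
      have f1 := F1 (x - ev a) hvb
      have f2 := wP b v hvb
      have f3 := (basic c ga (by omega) (odd_sub a ho)).2 b v hvb
      rw [← hph] at f3
      exact fin _ (NN (x - ev a)) (NN_nonneg _) (by linarith) NbW
    · have hva : a ≠ v := fun h => hv h.symm
      have f1 := F1 (x - ev b) hva
      rw [sub_right_comm x (ev b) (ev a)] at f1
      have f2 := wP a v hva
      have f3 := (basic c gb (by omega) (odd_sub b ho)).2 a v hva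
      rw [← hph] at f3
      exact fin _ (NN (x - ev b)) (NN_nonneg _) (by linarith) NaW
  have main : ∀ i, |∑ v ∈ univ.erase i, (NN (x - ev a - ev b - ev v) - EC (x - ev a - ev b - ev v) i v)
      - W * 1 * (1 - sg d μ lam x * ep d x i)| ≤ W * (7 * ph) := by
    intro i
    have h1 := Fle i
    have h2 : W * (1 - 3 * ph) ≤ ∑ v ∈ univ.erase i, (NN (x - ev a - ev b - ev v) - EC (x - ev a - ev b - ev v) i v) := by
      calc W * (1 - 3 * ph) ≤ (1 - ph) * (W - NN (x - ev a - ev b - ev i)) := by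
            have := ws i; have := NN_nonneg (x - ev a - ev b - ev i); nlinarith
        _ = ∑ v ∈ univ.erase i, (1 - ph) * NN (x - ev a - ev b - ev v) := by
            rw [← mul_sum, sum_erase_eq_sub (mem_univ i)]
        _ ≤ _ := sum_le_sum fun v hv => by
            have := wP i v (ne_of_mem_erase hv).symm; linarith
    have h3 : |sg d μ lam x * ep d x i| ≤ 4 * ph := by
      rw [abs_mul, abs_of_nonneg sb.1, hph]
      calc _ ≤ 7 * μ * e := by gcongr; exact sb.2; exact ad.hi i
        _ ≤ 4 * (2 * μ * (1 + e) ^ 2) := by nlinarith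
    have h4 : |W * (sg d μ lam x * ep d x i)| ≤ W * (4 * ph) := by
      rw [abs_mul, abs_of_nonneg W0]; gcongr
    have h5 := abs_le.1 h4
    have h6 : 0 ≤ W * ph := by positivity
    generalize ∑ v ∈ univ.erase i, (NN (x - ev a - ev b - ev v) - EC (x - ev a - ev b - ev v) i v) = X at *
    clear_value W
    rw [abs_le]; constructor <;> linarith
  have e140 : 140 * μ * (1 + e) ^ 2 = 10 * (7 * ph) := by rw [hph]; ring
  rw [e140]
  refine conv_MC c (FaEq hab) ?_ ?_ (Fb := ∑ v ∈ univ.erase b, (NN (x - ev a - ev b - ev v) - EC (x - ev a - ev b - ev v) b v))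
  · rw [← FaEq hab.symm, sub_right_comm x (ev a) (ev b)]
  · exact finish W0 (by norm_num) (rho_near c ad a) (rho_near c ad b) (by positivity) (by linarith) (main a) (main b)

end

section
variable {n : ℕ} {d e μ ν h lam L : ℝ} {J : ℕ}

lemma Pf_symm (x y : ℝ) : Pf μ lam x y = Pf μ lam y x := by
  unfold Pf; rw [mul_right_comm μ, mul_right_comm lam]

lemma Pf_nonneg (p : PR n d e μ ν h lam) {x y : ℝ} (hx : |x| ≤ e) (hy : |y| ≤ e) (lx : -1 ≤ x) (ly : -1 ≤ y) :
    0 ≤ Pf μ lam x y := by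
  have := p.e0
  have h1 := abs_le.1 (lam_xy p hx (by linarith : |y| ≤ 2 * e))
  have := p.hμ0
  unfold Pf
  apply div_nonneg
  · apply mul_nonneg (mul_nonneg _ _) <;> linarith
  · linarith

lemma Pi_scal {e n Se Sg μ ν lam ε P h : ℝ} (hε : |ε| ≤ e) (hSe : |Se| ≤ e) (e0 : 0 ≤ e) (l0 : 0 ≤ lam) (l2 : lam ≤ 2 * μ)
    (μe : μ * e ≤ 1 / 100000) (_nh0 : 0 ≤ n * h)
    (hSg : |Sg - Se| ≤ 10 * (n * h)) (hμ : 0 ≤ μ) (hnν : n * ν ≤ 2) (hν : ν = μ * h) (hP : P * (1 + lam * ε * ε) = 1 + ε) :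
    |1 + Se - lam * ε * Sg - P| ≤ 44 * e := by
  have l1 : |lam * ε| ≤ 2 * μ * e := by
    rw [abs_mul, abs_of_nonneg l0]; gcongr
  have l3 : |lam * ε * Sg| ≤ 41 * e := by
    rw [abs_mul]
    have : |Sg| ≤ e + 10 * (n * h) := by
      have := abs_le.1 hSg; have := abs_le.1 hSe; rw [abs_le]; constructor <;> linarith
    calc _ ≤ 2 * μ * e * (e + 10 * (n * h)) := by gcongr
      _ = 2 * e * (μ * e) + 20 * e * (n * ν) := by rw [hν]; ring
      _ ≤ 2 * e * (1 / 100000) + 20 * e * 2 := by gcongr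
      _ ≤ _ := by linarith
  have l4 : |lam * ε * ε| ≤ e / 50000 := by
    rw [abs_mul]
    calc _ ≤ 2 * μ * e * e := by gcongr
      _ = 2 * (μ * e) * e := by ring
      _ ≤ 2 * (1 / 100000) * e := by gcongr
      _ = _ := by ring
  have l5 : 0 ≤ lam * ε * ε := by rw [mul_assoc]; exact mul_nonneg l0 (mul_self_nonneg _)
  have l6 : |1 - P| ≤ 3 / 2 * e := by
    have h1 : (1 - P) * (1 + lam * ε * ε) = lam * ε * ε - ε := by linear_combination -hP
    have h2 : |1 - P| * (1 + lam * ε * ε) ≤ 3 / 2 * e := by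
      rw [← abs_of_nonneg (by linarith : 0 ≤ 1 + lam * ε * ε), ← abs_mul, h1]
      have := abs_le.1 l4; have := abs_le.1 hε
      rw [abs_le]; constructor <;> linarith
    have := abs_nonneg (1 - P)
    nlinarith
  have := abs_le.1 l3; have := abs_le.1 l6; have := abs_le.1 hSe
  rw [abs_le]; constructor <;> linarith

lemma Pi_bound (c : CX n d e μ ν h lam L J) {z : Fin n → ℤ} (ad : AD n e h (ep d z)) (v : Fin n) :
    |∑ b ∈ univ.erase v, Pf μ lam (ep d z b) (ep d z v) - z v| ≤ 44 * e * ν * z v := by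
  have p := c.toPR
  have e0 := p.e0; have h0 := p.h0; have np := p.np; have μ0 := p.hμ0; have ν0 := p.ν0
  set ε := ep d z with hε
  have h2e : ∀ b, |ε b| ≤ 2 * e := fun b => by have := ad.hi b; linarith
  have s1 : ∑ b ∈ univ.erase v, Pf μ lam (ε b) (ε v) =
      μ * (1 + ε v) * ((n + ∑ b, ε b) - lam * ε v * ∑ b, gg lam (ε v) (ε b)) - Pf μ lam (ε v) (ε v) := by
    rw [sum_erase_eq_sub (mem_univ v)]
    congr 1
    calc _ = ∑ b, μ * (1 + ε v) * ((1 + ε b) - lam * ε v * gg lam (ε v) (ε b)) :=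
          sum_congr rfl fun b _ => by rw [Pf_symm, Pf_gg p (ad.hi v) (h2e b)]
      _ = _ := by
        rw [← mul_sum, sum_sub_distrib, sum_add_distrib, ← mul_sum]; simp
  have s2 : |∑ b, gg lam (ε v) (ε b) - ∑ b, ε b| ≤ 10 * (n * h) := by
    have := sum_approx (fun b => gg lam (ε v) (ε b)) ε ε 0 2 (fun i => by
      have := gg_approx p (ad.hi v) (h2e i); simpa using this)
    have h3 := ad.s2
    calc _ ≤ _ := this
      _ ≤ _ := by linarith
  have dl := abs_le.1 (lam_xy p (ad.hi v) (h2e v))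
  have hden : (1 + lam * ε v * ε v) ≠ 0 := by linarith
  have key := Pi_scal (P := (1 + ε v) / (1 + lam * ε v * ε v)) (ad.hi v) ad.s1 e0.le p.lam0.le p.lam2 (by simpa using p.μe 1 (by norm_num))
    (by positivity) s2 μ0.le p.nν2 c.hν (div_mul_cancel₀ _ hden)
  have hz : d * (1 + ε v) = z v := d_ep c z v
  have hdn : d = μ * ((n:ℝ) - 1) := by
    have h1 : d * ν = μ := by rw [c.hν]; have := c.hd; linear_combination μ * this
    rw [← h1]; linear_combination (-d) * c.hnν
  have l1 : 0 ≤ 1 + ε v := by have := ad.lo v; linarith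
  have eq : ∑ b ∈ univ.erase v, Pf μ lam (ε b) (ε v) - z v = μ * (1 + ε v) * (1 + ∑ b, ε b - lam * ε v * ∑ b, gg lam (ε v) (ε b) - (1 + ε v) / (1 + lam * ε v * ε v)) := by
    rw [s1, ← hz, hdn]; unfold Pf; ring
  rw [eq, abs_mul, abs_of_nonneg (by positivity)]
  calc _ ≤ μ * (1 + ε v) * (44 * e) := by gcongr
    _ = 44 * e * (((n:ℝ) - 1) * ν) * (μ * (1 + ε v)) := by rw [c.hnν]; ring
    _ = 44 * e * ν * (d * (1 + ε v)) := by rw [hdn]; ring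
    _ = _ := by rw [hz]

lemma P_scal {EC w Wt H hb P P' κ1 r ρ M β e ν : ℝ} (H0 : 0 < H) (κ10 : 0 < κ1) (ρ0 : 0 ≤ ρ) (W0 : 0 ≤ Wt)
    (hb0 : 0 ≤ hb) (P0 : 0 ≤ P) (P1 : P ≤ 1 / 1000) (M0 : 0 ≤ M) (M1 : M ≤ 1 / 50) (β0 : 0 ≤ β) (eν0 : 0 ≤ e * ν) (eν : e * ν ≤ 1 / 1000)
    (hw : |w * H - Wt * hb| ≤ M * (Wt * hb)) (hE : |EC - w * (1 - P')| ≤ β * w)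
    (hP : |(1 - P') - (1 + ρ) * (1 - P)| ≤ 20 * e * ν) (hr : |r - 1| ≤ 6 * e * ν)
    (hh : hb * (1 - P) * κ1 = P * r) (w0 : 0 ≤ w) :
    |EC - Wt * (1 + ρ) / (H * κ1) * P| ≤ (3 * β + 2 * M + 66 * e * ν) * (Wt * (1 + ρ) / (H * κ1) * P) := by
  obtain ⟨κ, hκ⟩ : ∃ κ, κ = Wt * (1 + ρ) / (H * κ1) := ⟨_, rfl⟩
  rw [← hκ]
  have κ0 : 0 ≤ κ := by rw [hκ]; positivity
  obtain ⟨q, hq⟩ : ∃ q, q = Wt * hb / H := ⟨_, rfl⟩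
  have q0 : 0 ≤ q := by rw [hq]; positivity
  have hwq : |w - q| ≤ M * q := by
    have : w - q = (w * H - Wt * hb) / H := by rw [hq]; field_simp
    rw [this, abs_div, abs_of_pos H0, div_le_iff₀ H0]
    refine hw.trans (le_of_eq ?_)
    rw [hq]; field_simp
  have hqP : q * (1 + ρ) * (1 - P) = κ * P * r := by
    rw [hq, hκ, mul_assoc _ P r, ← hh]; field_simp
  have hr' := abs_le.1 hr
  have r1 : κ * P * r ≤ 101 / 100 * (κ * P) := by
    have : 0 ≤ κ * P := by positivity
    nlinarith
  have q2 : q ≤ 102 / 100 * (κ * P) := by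
    have h1 : q * (1 - P) ≤ q * (1 + ρ) * (1 - P) := by
      have : 0 ≤ q * ρ * (1 - P) := mul_nonneg (by positivity) (by linarith)
      linarith
    have h2 : q * P ≤ q * (1 / 1000) := by gcongr
    linarith
  have hwq' := abs_le.1 hwq
  have Mq : M * q ≤ 1 / 50 * q := by gcongr
  have w2 : w ≤ 3 * (κ * P) := by linarith
  have t1 : |EC - w * ((1 + ρ) * (1 - P))| ≤ (β + 20 * e * ν) * w := by
    have h1 : |w * ((1 - P') - (1 + ρ) * (1 - P))| ≤ w * (20 * e * ν) := by
      rw [abs_mul, abs_of_nonneg w0]; gcongr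
    have := abs_le.1 h1; have := abs_le.1 hE
    rw [abs_le]; constructor <;> linarith
  have t2 : |w * ((1 + ρ) * (1 - P)) - κ * P * r| ≤ M * (κ * P * r) := by
    have h0 : 0 ≤ (1 + ρ) * (1 - P) := mul_nonneg (by linarith) (by linarith)
    rw [← hqP, show w * ((1 + ρ) * (1 - P)) - q * (1 + ρ) * (1 - P) = (w - q) * ((1 + ρ) * (1 - P)) by ring, abs_mul, abs_of_nonneg h0]
    calc _ ≤ M * q * ((1 + ρ) * (1 - P)) := by gcongr
      _ = _ := by ring
  have κP : 0 ≤ κ * P := by positivity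
  have t3 : |κ * P * (r - 1)| ≤ κ * P * (6 * e * ν) := by rw [abs_mul, abs_of_nonneg κP]; gcongr
  have t4 : M * (κ * P * r) ≤ M * (2 * (κ * P)) := mul_le_mul_of_nonneg_left (by linarith) M0
  have t5 : (β + 20 * e * ν) * w ≤ (β + 20 * e * ν) * (3 * (κ * P)) := by
    have : 0 ≤ β + 20 * e * ν := by linarith
    gcongr
  have := abs_le.1 t1; have := abs_le.1 t2; have := abs_le.1 t3
  rw [abs_le]; constructor <;> linarith

lemma P_fin {EC N P κ z Q X θ : ℝ} (z0 : 0 < z) (κ0 : 0 ≤ κ) (P0 : 0 ≤ P) (X0 : 0 ≤ X) (θ0 : 0 ≤ θ) (hx : θ + 2 * X ≤ 1 / 2)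
    (h1 : |EC - κ * P| ≤ X * (κ * P)) (h2 : |z * N - κ * Q| ≤ X * (κ * Q)) (h3 : |Q - z| ≤ θ * z) :
    |EC - P * N| ≤ 2 * P * (3 * X + θ) * N := by
  have h3' := abs_le.1 h3
  have hQ : Q ≤ 2 * z := by nlinarith
  have a1 : X * (κ * Q) ≤ X * (κ * (2 * z)) := by gcongr
  have a2 : |κ * (Q - z)| ≤ κ * (θ * z) := by rw [abs_mul, abs_of_nonneg κ0]; gcongr
  have a3 : |z * (N - κ)| ≤ z * (κ * (θ + 2 * X)) := by
    have := abs_le.1 h2; have := abs_le.1 a2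
    rw [abs_le]; constructor <;> linarith
  rw [abs_mul, abs_of_pos z0] at a3
  have a4 := le_of_mul_le_mul_left a3 z0
  have a5 := abs_le.1 a4
  have a6 : κ * (θ + 2 * X) ≤ κ * (1 / 2) := by gcongr
  have a7 : κ ≤ 2 * N := by linarith
  have a8 : |P * (N - κ)| ≤ P * (κ * (θ + 2 * X)) := by rw [abs_mul, abs_of_nonneg P0]; gcongr
  have a9 : P * (3 * X + θ) * κ ≤ P * (3 * X + θ) * (2 * N) := by gcongr
  have := abs_le.1 h1; have := abs_le.1 a8
  rw [abs_le]; constructor <;> linarith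

lemma r_scal {σ lam ε e ν S : ℝ} (hσ : σ = lam + S) (S0 : 0 ≤ S) (S5 : S ≤ 5 * ν) (hε : |ε| ≤ e) (hs : |σ * ε| ≤ 1 / 10000) :
    |(1 - lam * ε) / (1 - σ * ε) - 1| ≤ 6 * e * ν := by
  have h1 := abs_le.1 hs
  have h0 : 0 < 1 - σ * ε := by linarith
  have e0 := (abs_nonneg ε).trans hε
  have ν0 : 0 ≤ ν := by linarith
  have h2 : (1 - lam * ε) / (1 - σ * ε) - 1 = S * ε / (1 - σ * ε) := by
    rw [eq_div_iff h0.ne', sub_mul, div_mul_cancel₀ _ h0.ne']; rw [hσ]; ring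
  rw [h2, abs_div, abs_of_pos h0, div_le_iff₀ h0, abs_mul, abs_of_nonneg S0]
  calc _ ≤ 5 * ν * e := by gcongr
    _ = 6 * e * ν * (5 / 6) := by ring
    _ ≤ _ := by
      have : 0 ≤ ν := by linarith
      gcongr; linarith

lemma hh_scal (p : PR n d e μ ν h lam) {σ x y : ℝ} (hx : |x| ≤ e) (hy : |y| ≤ e) (hs : |σ * x| ≤ 1 / 10000) (ly : 0 < 1 + y) :
    hht σ x * (1 - Pf μ lam x y) * (lam * (1 + y) / (1 - lam * y)) = Pf μ lam x y * ((1 - lam * x) / (1 - σ * x)) := by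
  have e0 := p.e0
  rw [one_sub_Pf p hx (by linarith)]
  have h1 := abs_le.1 (lam_xy p hx (by linarith : |y| ≤ 2 * e))
  have h2 := abs_le.1 (sx p p.lam0.le (by have := p.lam2; have := p.hμ0; linarith) hy)
  have h3 := abs_le.1 hs
  have d1 : (1 + lam * x * y) ≠ 0 := by linarith
  have d2 : (1 - lam * y) ≠ 0 := by linarith
  have d3 : (1 - σ * x) ≠ 0 := by linarith
  unfold hht Pf
  have hl := p.hlam
  generalize 1 + lam * x * y = A at *
  generalize 1 - lam * y = B at *
  generalize 1 - σ * x = C at *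
  field_simp
  linear_combination (1 - lam * x) * (1 + x) * hl

end

section
variable {n : ℕ} {d e μ ν h lam L : ℝ} {J : ℕ}

lemma EC_zero {z : Fin n → ℤ} {a v : Fin n} (hav : a ≠ v) (h0 : z v = 0) : EC z a v = 0 := by
  have := F2 z v
  rw [h0] at this
  have h1 : ∑ u ∈ univ.erase v, EC z v u = 0 := by rw [this]; simp
  rw [sum_eq_zero_iff_of_nonneg fun u _ => EC_nonneg z v u] at h1
  rw [EC_symm]
  exact h1 a (mem_erase.2 ⟨hav, mem_univ _⟩)

lemma Pf_zero (x : ℝ) : Pf μ lam x (-1) = 0 := by unfold Pf; simp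

lemma eν_small (p : PR n d e μ ν h lam) : e * ν ≤ 1 / 100000 := by
  have := p.νμ; have := p.e0; have := p.μe 1 (by norm_num)
  rw [pow_one] at this
  calc e * ν ≤ e * μ := by gcongr
    _ ≤ _ := by linarith

lemma stepP (c : CX n d e μ ν h lam L J) {T : ℕ} (TJ : T + 2 ≤ J) {M β : ℝ} (M0 : 0 ≤ M) (β0 : 0 ≤ β)
    (M1 : M ≤ 1 / 50) (β1 : β ≤ 1 / 50)
    (mc : MC n d μ lam L (T + 1) M) (bc : BC n d μ lam L (T + 2) β) :
    BC n d μ lam L T (4 * μ * (1 + e) ^ 2 * (9 * β + 6 * M + 250 * e * ν)) := by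
  intro z g hev a v hav
  have p := c.toPR
  have e0 := p.e0; have μ0 := p.hμ0; have ν0 := p.ν0; have h0 := p.h0
  have eν := eν_small p
  have eν0 : 0 ≤ e * ν := by positivity
  by_cases hv0 : z v = 0
  · rw [EC_zero hav hv0, ep_zero c hv0, Pf_zero]
    have := NN_nonneg z
    simp only [zero_mul, sub_zero, abs_zero]
    apply mul_nonneg _ this
    have : 0 ≤ 9 * β + 6 * M + 250 * e * ν := by positivity
    positivity
  have zv := one_le_of (g.nn v) hv0
  have ad := g.ad c (by omega : T ≤ J)
  have gx := g.down c (by omega) zv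
  have adx := gx.ad c (by omega : T + 1 ≤ J)
  have hox : Odd (∑ i, (z - ev v) i) := even_sub v hev
  have sbx := sg_bound c adx
  have SSx := SS_bound c adx
  set x := z - ev v with hx
  have epx : ∀ b, b ≠ v → ep d x b = ep d z b := by
    intro b hb; rw [hx, ep_sub c, if_neg hb, sub_zero]
  have epv : ep d x v = ep d z v - h := by rw [hx, ep_sub c, if_pos rfl]
  have hzx : ∀ b, b ≠ v → hz d μ lam x b = hht (sg d μ lam x) (ep d z b) := by
    intro b hb; unfold hz; rw [epx b hb]
  have ms := MC_sum M0 mc c (by omega) gx hox (univ.erase v)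
  have hHx : (n : ℝ) / 2 ≤ ∑ j, hz d μ lam x j := H_half p sbx.1 sbx.2 adx
  have H0 : 0 < ∑ u ∈ univ.erase v, hz d μ lam x u := by
    rw [sum_erase_eq_sub (mem_univ v)]
    have h3 := abs_le.1 (hh3 p sbx.1 sbx.2 (adx.hi v))
    have h4 := adx.hi v
    have h5 := W_n p
    have : hz d μ lam x v ≤ 2 * (1 + e) := by
      change hht _ _ ≤ _
      linarith
    linarith [p.np]
  set H := ∑ u ∈ univ.erase v, hz d μ lam x u with hH
  set Wt := ∑ u ∈ univ.erase v, NN (x - ev u) with hWt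
  have W0 : 0 ≤ Wt := sum_nonneg fun v _ => NN_nonneg _
  have yv1 : 0 < 1 + ep d z v := by
    have h1 := d_ep c z v
    have : (1:ℝ) ≤ z v := by exact_mod_cast zv
    rw [← h1] at this
    exact pos_of_mul_pos_right (by linarith) c.d0.le
  have dv := abs_le.1 (sx p p.lam0.le (by have := p.lam2; linarith) (ad.hi v))
  have κ10 : 0 < lam * (1 + ep d z v) / (1 - lam * ep d z v) := by
    have := p.lam0
    apply div_pos (by positivity); linarith
  have m2 := p.μk 2 (by norm_num)
  set κ1 := lam * (1 + ep d z v) / (1 - lam * ep d z v) with hκ1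
  have ρ0 : 0 ≤ 2 * ν / (1 - μ) := by
    have := p.μ1
    apply div_nonneg (by positivity); linarith
  have W1 : ∀ b, |1 + ep d z b| ≤ 1 + e := by
    intro b; have := ad.lo b; have := abs_le.1 (ad.hi b); rw [abs_le]; constructor <;> linarith
  have Pb : ∀ b, Pf μ lam (ep d z b) (ep d z v) ≤ 2 * μ * (1 + e) ^ 2 := by
    intro b
    exact (le_abs_self _).trans (abs_Pf_le p (ad.hi b) (by have := ad.hi v; linarith) (W1 b) (W1 v))
  have Pn : ∀ b, 0 ≤ Pf μ lam (ep d z b) (ep d z v) := fun b => Pf_nonneg p (ad.hi b) (ad.hi v) (ad.lo b) (ad.lo v)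
  have main : ∀ b, b ≠ v → |EC z b v - Wt * (1 + 2 * ν / (1 - μ)) / (H * κ1) * Pf μ lam (ep d z b) (ep d z v)|
      ≤ (3 * β + 2 * M + 66 * e * ν) * (Wt * (1 + 2 * ν / (1 - μ)) / (H * κ1) * Pf μ lam (ep d z b) (ep d z v)) := by
    intro b hb
    by_cases hb0 : z b = 0
    · rw [EC_symm, EC_zero hb.symm hb0, ep_zero c hb0, Pf_symm, Pf_zero]; simp
    have zb := one_le_of (g.nn b) hb0
    have gy : Good n d L (T + 2) (x - ev b) := gx.down c (by omega) (by rw [hx, Pi.sub_apply, ev_ne hb]; omega)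
    have ady := gy.ad c (by omega : T + 2 ≤ J)
    have epyb : ep d (x - ev b) b = ep d z b - h := by rw [ep_sub c, if_pos rfl, epx b hb]
    have epyv : ep d (x - ev b) v = ep d z v - h := by rw [ep_sub c, if_neg hb.symm, epv, sub_zero]
    have hb' := bc _ gy (odd_sub b hox) b v hb
    rw [epyb, epyv] at hb'
    have f1 := F1 z hb
    rw [sub_right_comm z (ev b) (ev v), ← hx] at f1
    have hs : |sg d μ lam x * ep d z b| ≤ 1 / 10000 := sx p sbx.1 sbx.2 (ad.hi b)
    have msb := ms b
    rw [hzx b hb] at msb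
    refine P_scal H0 κ10 ρ0 W0 (hb := hht (sg d μ lam x) (ep d z b)) (P' := Pf μ lam (ep d z b - h) (ep d z v - h))
      (r := (1 - lam * ep d z b) / (1 - sg d μ lam x * ep d z b)) ?_ (Pn b) (by have := Pb b; linarith) M0 M1 β0 eν0 (by linarith)
      msb ?_ ?_ ?_ (hh_scal p (ad.hi b) (ad.hi v) hs yv1) (NN_nonneg _)
    · exact hh_nonneg p sbx.1 sbx.2 (ad.hi b) (ad.lo b)
    · rw [f1]
      have := abs_le.1 hb'
      rw [abs_le]; constructor <;> linarith
    · exact Pf_shift p (ad.hi b) (ad.hi v) (by rw [← epyb]; exact ady.hi b) (by rw [← epyv]; exact ady.hi v)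
    · exact r_scal rfl SSx.1 SSx.2 (ad.hi b) hs
  have κ0 : 0 ≤ Wt * (1 + 2 * ν / (1 - μ)) / (H * κ1) := by positivity
  set κ := Wt * (1 + 2 * ν / (1 - μ)) / (H * κ1) with hκ
  have X0 : 0 ≤ 3 * β + 2 * M + 66 * e * ν := by positivity
  have zv' : (0:ℝ) < z v := by exact_mod_cast zv
  have su : |z v * NN z - κ * ∑ b ∈ univ.erase v, Pf μ lam (ep d z b) (ep d z v)| ≤
      (3 * β + 2 * M + 66 * e * ν) * (κ * ∑ b ∈ univ.erase v, Pf μ lam (ep d z b) (ep d z v)) := by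
    have f2 := F2 z v
    rw [← f2, mul_sum, ← sum_sub_distrib, mul_sum]
    refine (abs_sum_le_sum_abs _ _).trans (sum_le_sum fun b hb => ?_)
    rw [EC_symm]
    exact main b (ne_of_mem_erase hb)
  have fin := P_fin zv' κ0 (Pn a) X0 (θ := 44 * e * ν) (by positivity) (by linarith) (main a hav) su (Pi_bound c ad v)
  have NN0 := NN_nonneg z
  have q0 : 0 ≤ 3 * (3 * β + 2 * M + 66 * e * ν) + 44 * e * ν := by positivity
  refine fin.trans ?_
  calc _ ≤ 2 * (2 * μ * (1 + e) ^ 2) * (3 * (3 * β + 2 * M + 66 * e * ν) + 44 * e * ν) * NN z := by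
        have := Pb a; gcongr
    _ ≤ 2 * (2 * μ * (1 + e) ^ 2) * (9 * β + 6 * M + 250 * e * ν) * NN z := by
        have hle : 3 * (3 * β + 2 * M + 66 * e * ν) + 44 * e * ν ≤ 9 * β + 6 * M + 250 * e * ν := by linarith
        exact mul_le_mul_of_nonneg_right (mul_le_mul_of_nonneg_left hle (by positivity)) NN0
    _ = _ := by ring

lemma MC_mono (c : CX n d e μ ν h lam L J) {T : ℕ} (TJ : T ≤ J) {M M' : ℝ} (hM : M ≤ M') (mc : MC n d μ lam L T M) :
    MC n d μ lam L T M' := by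
  intro x g ho a b hab
  refine (mc x g ho a b hab).trans ?_
  have := NN_nonneg (x - ev b)
  have := hz_nonneg c (g.ad c TJ) a
  gcongr

lemma BC_mono {T : ℕ} {M M' : ℝ} (hM : M ≤ M') (bc : BC n d μ lam L T M) :
    BC n d μ lam L T M' := by
  intro x g ho a b hab
  refine (bc x g ho a b hab).trans ?_
  have := NN_nonneg x
  gcongr

lemma iter_arith {q u y : ℝ} (q0 : 0 ≤ q) (q1 : q ≤ 1 / 100000) (u0 : 0 ≤ u) (u1 : u ≤ 1) (y0 : 0 ≤ y) (y1 : y ≤ 1 / 10 ^ 10) :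
    10 * (6 * q * (140 * q * u + 90000 * y) + (4 * q * u + 2000 * y) + 6200 * y) ≤ 140 * q * (u / 2) + 90000 * y ∧
    4 * q * (9 * (4 * q * u + 2000 * y) + 6 * (140 * q * u + 90000 * y)) + 1000 * y ≤ 4 * q * (u / 2) + 2000 * y ∧
    140 * q * u + 90000 * y ≤ 1 / 50 ∧ 4 * q * u + 2000 * y ≤ 1 / 50 ∧
    6 * q * (140 * q * u + 90000 * y) + (4 * q * u + 2000 * y) + 6200 * y ≤ 1 / 20 := by
  have qu0 : 0 ≤ q * u := by positivity
  have qu : q * u ≤ 1 / 100000 := by nlinarith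
  have qqu : q * (q * u) ≤ 1 / 100000 * (q * u) := by gcongr
  have qy : q * y ≤ 1 / 100000 * y := by gcongr
  refine ⟨?_, ?_, ?_, ?_, ?_⟩ <;> nlinarith

lemma iter (c : CX n d e μ ν h lam L J) (k : ℕ) : ∀ T, T + 3 * k + 3 ≤ J →
    MC n d μ lam L T (140 * (μ * (1 + e) ^ 2) * (1 / 2) ^ k + 90000 * (μ * (1 + e) ^ 2 * e * ν)) ∧
    BC n d μ lam L T (4 * (μ * (1 + e) ^ 2) * (1 / 2) ^ k + 2000 * (μ * (1 + e) ^ 2 * e * ν)) := by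
  have p := c.toPR
  have e0 := p.e0; have μ0 := p.hμ0; have ν0 := p.ν0
  have m2 := p.μk 2 (by norm_num)
  have eν := eν_small p
  obtain ⟨q, hq⟩ : ∃ q, q = μ * (1 + e) ^ 2 := ⟨_, rfl⟩
  obtain ⟨y, hy⟩ : ∃ y, y = μ * (1 + e) ^ 2 * e * ν := ⟨_, rfl⟩
  have q0 : 0 ≤ q := by rw [hq]; positivity
  have y0 : 0 ≤ y := by rw [hy]; positivity
  have y1 : y ≤ 1 / 10 ^ 10 := by
    calc y = μ * (1 + e) ^ 2 * (e * ν) := by rw [hy]; ring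
      _ ≤ 1 / 100000 * (1 / 100000) := by gcongr
      _ = _ := by norm_num
  induction k with
  | zero =>
    intro T hT
    constructor
    · apply MC_mono c (by omega) _ (initM c (by omega : T + 3 ≤ J))
      rw [← hy, ← hq, show 140 * μ * (1 + e) ^ 2 = 140 * q by rw [hq]; ring]; simp; linarith
    · apply BC_mono _ (initB c (by omega : T ≤ J))
      rw [← hy, ← hq, show 4 * μ * (1 + e) ^ 2 = 4 * q by rw [hq]; ring]; simp; linarith
  | succ k ih =>
    intro T hT
    have i1 := ih (T + 1) (by omega)
    have i2 := ih (T + 2) (by omega)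
    have i3 := ih (T + 3) (by omega)
    rw [← hy, ← hq] at i1 i2 i3
    have u0 : (0:ℝ) ≤ (1 / 2) ^ k := by positivity
    have u1 : ((1:ℝ) / 2) ^ k ≤ 1 := pow_le_one₀ (by norm_num) (by norm_num)
    rw [← hy, ← hq, pow_succ]
    generalize ((1:ℝ) / 2) ^ k = u at *
    obtain ⟨a1, a2, a3, a4, a5⟩ := iter_arith q0 (by linarith) u0 u1 y0 y1
    have M0 : 0 ≤ 140 * q * u + 90000 * y := by positivity
    have β0 : 0 ≤ 4 * q * u + 2000 * y := by positivity
    have hR : ∀ X, 6 * μ * (1 + e) ^ 2 * X = 6 * q * X := by intro X; rw [hq]; ring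
    have hR2 : 6200 * (1 + e) ^ 2 * μ * e * ν = 6200 * y := by rw [hy]; ring
    constructor
    · have := stepR c (by omega : T + 3 ≤ J) M0 β0 i2.1 i3.2 (by rw [hR, hR2]; exact a5)
      rw [hR, hR2] at this
      exact MC_mono c (by omega) (by linarith) this
    · have := stepP c (by omega : T + 2 ≤ J) M0 β0 a3 a4 i1.1 i2.2
      refine BC_mono (le_trans (le_of_eq ?_) (a2.trans (le_of_eq ?_))) this
      · rw [hq, hy]; ring
      · ring

end

def Psi (n : ℕ) (d lam : ℝ) (z : Fin n → ℤ) : ℝ :=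
  (∏ i, ((n - 1).choose (z i).toNat : ℝ)) * Real.exp (-(lam * ∑ i, ep d z i ^ 2) ^ 2 / 4)

section
variable {n : ℕ} {d e μ ν h lam L : ℝ} {J : ℕ}

lemma gdiff_coef (p : PR n d e μ ν h lam) {A : ℝ} (A0 : 0 ≤ A) (A5 : A ≤ 5 * n * h) :
    |lam ^ 2 * h * A - μ * A / n| ≤ 40 * μ * ν := by
  have μ0 := p.hμ0; have μ1 := p.μ1; have ν0 := p.ν0; have np := p.np; have h0 := p.h0
  have inv := p.inv_n; have νμ := p.νμ; have nν := p.nν2; have l0 := p.lam0; have l2 := p.lam2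
  have hlam := p.hlam
  have hl : lam = μ + μ * lam := by linarith
  -- lam^2 h = lam^2/mu * nu ;
  have e1 : lam ^ 2 * h = ν * (μ * (1 + lam) ^ 2) := by
    rw [p.hν]
    have : lam = μ * (1 + lam) := by linarith
    have h2 : lam ^ 2 = μ ^ 2 * (1 + lam) ^ 2 := by rw [← mul_pow, ← this]
    rw [h2]; ring
  have e2 : μ * A / n = μ * A * (ν * (1 - 1 / n)) := by
    have hn := p.hnν
    have n0 : (n : ℝ) ≠ 0 := by linarith
    have h3 : ν * (1 - 1 / n) = 1 / n := by field_simp; linear_combination hn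
    rw [h3]; ring
  have e3 : lam ^ 2 * h * A - μ * A / n = μ * ν * A * (2 * lam + lam ^ 2 + 1 / n) := by
    rw [e2, e1]; ring
  have n0 : 0 < (n : ℝ) := by linarith
  have l3 : lam ≤ μ * (11 / 10) := by nlinarith
  have l4 : lam ^ 2 ≤ μ / 10 := by nlinarith
  rw [e3, abs_of_nonneg (by positivity)]
  calc _ ≤ μ * ν * (5 * n * h) * (2 * (μ * (11 / 10)) + μ / 10 + μ) := by gcongr; linarith
    _ = (33 / 2) * (n * (μ * h)) * (μ * ν) := by ring
    _ = (33 / 2) * (n * ν) * (μ * ν) := by rw [p.hν]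
    _ ≤ (33 / 2) * 2 * (μ * ν) := by gcongr
    _ ≤ _ := by have : 0 < μ * ν := by positivity
                linarith

lemma gdiff (c : CX n d e μ ν h lam L J) {x : Fin n → ℤ} (ad : AD n e h (ep d x)) (a b : Fin n) :
    |((lam * ∑ i, ep d (x - ev a) i ^ 2) ^ 2 / 4 - (lam * ∑ i, ep d (x - ev b) i ^ 2) ^ 2 / 4) + SS d μ x * (ep d x a - ep d x b)|
      ≤ 110 * (1 + e) * μ * e * ν := by
  have p := c.toPR
  have e0 := p.e0; have μ0 := p.hμ0; have ν0 := p.ν0; have h0 := p.h0; have l0 := p.lam0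
  rw [sumsq_sub c, sumsq_sub c]
  have A0 : 0 ≤ ∑ i, ep d x i ^ 2 := sum_nonneg fun i _ => sq_nonneg _
  have hc := gdiff_coef p A0 ad.s2
  unfold SS
  have ha := abs_le.1 (ad.hi a); have hb := abs_le.1 (ad.hi b)
  have he := c.he
  generalize ∑ i, ep d x i ^ 2 = A at *
  generalize ep d x a = u at *
  generalize ep d x b = v at *
  have eq : ((lam * (A - 2 * h * u + h ^ 2)) ^ 2 / 4 - (lam * (A - 2 * h * v + h ^ 2)) ^ 2 / 4) + μ * A / n * (u - v)
      = -((lam ^ 2 * h * A - μ * A / n) * (u - v)) - lam ^ 2 * h * h * ((u - v) * (h - (u + v))) := by ring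
  rw [eq]
  have t1 : |u - v| ≤ 2 * e := by rw [abs_le]; constructor <;> linarith
  have t2 : |h - (u + v)| ≤ 3 * e := by rw [abs_le]; constructor <;> linarith
  have t3 : |(lam ^ 2 * h * A - μ * A / n) * (u - v)| ≤ 40 * μ * ν * (2 * e) := by
    rw [abs_mul]; gcongr
  have t4 : |lam ^ 2 * h * h * ((u - v) * (h - (u + v)))| ≤ 24 * μ * e * ν * e := by
    rw [abs_mul, abs_of_nonneg (by positivity), abs_mul]
    calc _ ≤ (2 * μ) ^ 2 * h * h * ((2 * e) * (3 * e)) := by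
          gcongr; exact p.lam2
      _ = 24 * (μ * h) * (μ * h) * e * e := by ring
      _ = 24 * ν * ν * e * e := by rw [p.hν]
      _ ≤ 24 * μ * ν * e * e := by have := p.νμ; gcongr
      _ = _ := by ring
  have t5 : 0 ≤ μ * e * ν := by positivity
  have t6 : 0 ≤ μ * e * ν * e := by positivity
  have := abs_le.1 t3; have := abs_le.1 t4
  rw [abs_le]; constructor <;> linarith

/-- one factor estimate -/
lemma one_factor {s t ε S η : ℝ} (ht : |t * ε| ≤ 1 / 1000) (h : |(t - s) * ε / (1 - t * ε) - S * ε| ≤ η) :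
    (1 - s * ε) ≤ (1 - t * ε) * Real.exp (S * ε + η) := by
  have h1 := abs_le.1 ht
  have h0 : 0 < 1 - t * ε := by linarith
  have h2 := abs_le.1 h
  have h3 := Real.add_one_le_exp (S * ε + η)
  calc 1 - s * ε = (1 - t * ε) * (1 + (t - s) * ε / (1 - t * ε)) := by
        rw [mul_add, mul_div_cancel₀ _ h0.ne']; ring
    _ ≤ _ := by gcongr; linarith

lemma div_lin {D t ε S η e : ℝ} (hD : |D - S| ≤ η) (hε : |ε| ≤ e) (ht : |t * ε| ≤ 1 / 1000) (hη : 0 ≤ η) :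
    |D * ε / (1 - t * ε) - S * ε| ≤ 2 * η * e + 2 * |S| * |t| * e ^ 2 := by
  have h1 := abs_le.1 ht
  have h0 : 0 < 1 - t * ε := by linarith
  have e0 := (abs_nonneg ε).trans hε
  have : D * ε / (1 - t * ε) - S * ε = ((D - S) * ε + S * t * ε ^ 2) / (1 - t * ε) := by
    rw [eq_div_iff h0.ne', sub_mul, div_mul_cancel₀ _ h0.ne']; ring
  rw [this, abs_div, abs_of_pos h0, div_le_iff₀ h0]
  have h3 : |(D - S) * ε + S * t * ε ^ 2| ≤ η * e + |S| * |t| * e ^ 2 := by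
    refine (abs_add_le _ _).trans ?_
    rw [abs_mul, abs_mul, abs_mul, abs_pow]
    gcongr
  have h4 : 0 ≤ η * e + |S| * |t| * e ^ 2 := by positivity
  nlinarith

lemma fac (c : CX n d e μ ν h lam L J) {x : Fin n → ℤ} (ad : AD n e h (ep d x)) (i : Fin n) :
    (1 - μ / (1 - μ + ν) * ep d x i) ≤ (1 - sg d μ lam x * ep d x i) * Real.exp (SS d μ x * ep d x i + 80 * (1 + e) * μ * e * ν) ∧
    (1 - sg d μ lam x * ep d x i) ≤ (1 - μ / (1 - μ + ν) * ep d x i) * Real.exp (-SS d μ x * ep d x i + 80 * (1 + e) * μ * e * ν) := by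
  have p := c.toPR
  have e0 := p.e0; have μ0 := p.hμ0; have ν0 := p.ν0; have μ1 := p.μ1; have νμ := p.νμ; have l0 := p.lam0
  have sb := sg_bound c ad
  have S := SS_bound c ad
  obtain ⟨l', hl'⟩ : ∃ l', l' = μ / (1 - μ + ν) := ⟨_, rfl⟩
  have den : 0 < 1 - μ + ν := by linarith
  have hl2 : l' * (1 - μ + ν) = μ := by rw [hl']; exact div_mul_cancel₀ _ den.ne'
  have l'0 : 0 ≤ l' := by rw [hl']; positivity
  have l'2 : l' ≤ 2 * μ := by
    rw [hl', div_le_iff₀ den]; nlinarith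
  have hdl : |lam - l'| ≤ 3 * μ * ν := by
    have h1 : (lam - l') * (1 - μ) = l' * ν := by have := p.hlam; linear_combination this - hl2
    have h2 : |lam - l'| * (1 - μ) = l' * ν := by
      rw [← abs_of_nonneg (by linarith : 0 ≤ 1 - μ), ← abs_mul, h1, abs_of_nonneg (by positivity)]
    have h3 : l' * ν ≤ 2 * μ * ν := by gcongr
    have := abs_nonneg (lam - l')
    nlinarith
  rw [← hl']
  have hsg : sg d μ lam x = lam + SS d μ x := rfl
  have hi := ad.hi i
  have sσ := sx p sb.1 sb.2 hi
  have sl := sx p l'0 (by linarith) hi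
  generalize ep d x i = ε at *
  generalize hS' : SS d μ x = S' at *
  generalize sg d μ lam x = σ at *
  have W : μ * ν * e ^ 2 ≤ e * (μ * e * ν) := by apply le_of_eq; ring
  have W0 : 0 ≤ μ * e * ν := by positivity
  have T1 : 2 * S' * (7 * μ) * e ^ 2 ≤ 70 * (e * (μ * e * ν)) := by
    calc _ ≤ 2 * (5 * ν) * (7 * μ) * e ^ 2 := by gcongr; exact S.2
      _ = _ := by ring
  have W1 : 0 ≤ e * (μ * e * ν) := by positivity
  have S0 := S.1
  constructor
  · apply one_factor (by linarith)
    refine (div_lin (η := 3 * μ * ν) ?_ hi (by linarith) (by positivity)).trans ?_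
    · rw [hsg, show lam + S' - l' - S' = lam - l' by ring]; exact hdl
    · rw [abs_of_nonneg S0, abs_of_nonneg sb.1]
      have : 2 * S' * σ * e ^ 2 ≤ 2 * S' * (7 * μ) * e ^ 2 := by gcongr; exact sb.2
      linarith
  · apply one_factor (by linarith)
    refine (div_lin (η := 3 * μ * ν) ?_ hi (by linarith) (by positivity)).trans ?_
    · rw [hsg, show l' - (lam + S') - -S' = -(lam - l') by ring, abs_neg]; exact hdl
    · rw [abs_neg, abs_of_nonneg S0, abs_of_nonneg l'0]
      have : 2 * S' * l' * e ^ 2 ≤ 2 * S' * (7 * μ) * e ^ 2 := by gcongr; linarith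
      linarith


lemma ratio_alg {Na Nb P xa xb Ga Gb κ Sa Sb la lb Pa Pb M t1 t2 t3 : ℝ} (κ0 : 0 < κ) (hla : 0 < la) (hlb : 0 < lb)
    (hSa : 0 < Sa) (hSb : 0 < Sb) (P0 : 0 ≤ P) (Nb0 : 0 ≤ Nb) (xa0 : 0 ≤ xa) (Gb0 : 0 ≤ Gb)
    (hm : Na * (xb / Sb) ≤ Real.exp M * (Nb * (xa / Sa)))
    (hPa : Pa * (κ * la) = P * xa * Ga) (hPb : Pb * (κ * lb) = P * xb * Gb)
    (h1 : la ≤ Sa * Real.exp t1) (h2 : Sb ≤ lb * Real.exp t2) (h3 : Gb ≤ Ga * Real.exp t3) :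
    Na * Pb ≤ Real.exp (M + t1 + t2 + t3) * (Nb * Pa) := by
  have ePa : Pa = P * xa * Ga / (κ * la) := by rw [eq_div_iff (by positivity)]; exact hPa
  have ePb : Pb = P * xb * Gb / (κ * lb) := by rw [eq_div_iff (by positivity)]; exact hPb
  have h1' : 1 / Sa ≤ Real.exp t1 / la := by
    rw [div_le_div_iff₀ hSa hla]; linarith
  have h2' : Sb / lb ≤ Real.exp t2 := by rw [div_le_iff₀ hlb]; linarith
  calc Na * Pb = (Na * (xb / Sb)) * (P * Gb / κ * (Sb / lb)) := by rw [ePb]; field_simp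
    _ ≤ (Real.exp M * (Nb * (xa / Sa))) * (P * Gb / κ * (Sb / lb)) := by
        gcongr
    _ = Real.exp M * Nb * xa * P / κ * (1 / Sa) * (Sb / lb) * Gb := by ring
    _ ≤ Real.exp M * Nb * xa * P / κ * (Real.exp t1 / la) * Real.exp t2 * (Ga * Real.exp t3) := by
        gcongr
    _ = _ := by rw [ePa, Real.exp_add, Real.exp_add, Real.exp_add]; field_simp

lemma prod_ch_sub {x : Fin n → ℤ} {a : Fin n} (h1 : 1 ≤ x a) (h2 : x a ≤ n) :
    (∏ i, ((n - 1).choose ((x - ev a) i).toNat : ℝ)) * ((n : ℝ) - x a) = (∏ i, ((n - 1).choose (x i).toNat : ℝ)) * x a := by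
  rw [← mul_prod_erase univ _ (mem_univ a), ← mul_prod_erase univ (fun i => ((n - 1).choose (x i).toNat : ℝ)) (mem_univ a)]
  have : ∏ i ∈ univ.erase a, ((n - 1).choose ((x - ev a) i).toNat : ℝ) = ∏ i ∈ univ.erase a, ((n - 1).choose (x i).toNat : ℝ) := by
    apply prod_congr rfl
    intro i hi
    rw [Pi.sub_apply, ev_ne (ne_of_mem_erase hi), sub_zero]
  rw [this, Pi.sub_apply, ev_self]
  obtain ⟨k, hk⟩ : ∃ k : ℕ, x a = k + 1 := ⟨(x a - 1).toNat, by omega⟩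
  rw [hk]
  have e1 : ((k : ℤ) + 1 - 1).toNat = k := by omega
  have e2 : ((k : ℤ) + 1).toNat = k + 1 := by omega
  rw [e1, e2]
  have := Nat.choose_succ_right_eq (n - 1) k
  have h4 : ((n - 1 - k : ℕ) : ℝ) = n - ((k : ℝ) + 1) := by
    rw [show n - 1 - k = n - (k + 1) by omega, Nat.cast_sub (by omega)]; push_cast; ring
  have h5 : ((n - 1).choose (k + 1) : ℝ) * (k + 1) = (n - 1).choose k * (n - (k + 1)) := by
    rw [← h4]; exact_mod_cast this
  push_cast
  linear_combination (-∏ i ∈ univ.erase a, ((n - 1).choose (x i).toNat : ℝ)) * h5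

lemma Psi_step (c : CX n d e μ ν h lam L J) {x : Fin n → ℤ} (a : Fin n) (h1 : 1 ≤ x a) (h2 : x a ≤ n) :
    Psi n d lam (x - ev a) * (((n : ℝ) - 1) * (1 - μ + ν) * (1 - μ / (1 - μ + ν) * ep d x a)) =
      (∏ i, ((n - 1).choose (x i).toNat : ℝ)) * x a * Real.exp (-(lam * ∑ i, ep d (x - ev a) i ^ 2) ^ 2 / 4) := by
  have p := c.toPR
  have μ1 := p.μ1; have ν0 := p.ν0
  have : ((n : ℝ) - 1) * (1 - μ + ν) * (1 - μ / (1 - μ + ν) * ep d x a) = n - x a := by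
    have den : 1 - μ + ν ≠ 0 := by linarith
    have hd : ((n : ℝ) - 1) * μ = d := by
      have e1 := p.hnν
      rw [p.hν] at e1
      have e2 := p.hd
      linear_combination d * e1 - (n - 1) * μ * e2
    have e3 := d_ep c x a
    have : (1 - μ + ν) * (1 - μ / (1 - μ + ν) * ep d x a) = 1 - μ + ν - μ * ep d x a := by field_simp
    rw [mul_assoc, this]
    linear_combination (-1 - ep d x a) * hd + p.hnν - e3
  rw [this, Psi]
  linear_combination Real.exp (-(lam * ∑ i, ep d (x - ev a) i ^ 2) ^ 2 / 4) * prod_ch_sub h1 h2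

lemma one_step (c : CX n d e μ ν h lam L J) {M : ℝ} (mc : MC n d μ lam L 0 M) {x : Fin n → ℤ} (g : Good n d L 0 x)
    (ho : Odd (∑ i, x i)) {a b : Fin n} (hab : a ≠ b) (ha : 1 ≤ x a) (hb : 1 ≤ x b) :
    NN (x - ev a) * Psi n d lam (x - ev b) ≤ Real.exp (M + 270 * (1 + e) * μ * e * ν) * (NN (x - ev b) * Psi n d lam (x - ev a)) := by
  have p := c.toPR
  have ad := g.ad c (Nat.zero_le _)
  have μ1 := p.μ1; have ν0 := p.ν0; have μ0 := p.hμ0; have np := p.np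
  have sb := sg_bound c ad
  have sσa := abs_le.1 (sx p sb.1 sb.2 (ad.hi a))
  have sσb := abs_le.1 (sx p sb.1 sb.2 (ad.hi b))
  have den : 0 < 1 - μ + ν := by linarith
  have l'0 : 0 ≤ μ / (1 - μ + ν) := by positivity
  have l'2 : μ / (1 - μ + ν) ≤ 7 * μ := by
    rw [div_le_iff₀ den]; nlinarith
  have sla := abs_le.1 (sx p l'0 l'2 (ad.hi a))
  have slb := abs_le.1 (sx p l'0 l'2 (ad.hi b))
  have d0 := c.d0
  have hxn : ∀ i, x i ≤ n := by
    intro i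
    have h1 := d_ep c x i
    have h2 := abs_le.1 (ad.hi i)
    have h3 : (x i : ℝ) ≤ n := by
      have hd : ((n : ℝ) - 1) * μ = d := by
        have e1 := p.hnν
        rw [p.hν] at e1
        have e2 := p.hd
        linear_combination d * e1 - (n - 1) * μ * e2
      have hk := p.μk 1 (by norm_num); rw [pow_one] at hk
      rw [← h1]
      have : d * (1 + ep d x i) ≤ d * (1 + e) := by gcongr; exact h2.2
      have h5 : d * (1 + e) = ((n : ℝ) - 1) * (μ * (1 + e)) := by rw [← hd]; ring
      nlinarith
    exact_mod_cast h3
  have gd := abs_le.1 (gdiff c ad a b)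
  have hm := (abs_le.1 (mc x g ho a b hab)).2
  have hxa : (1 : ℝ) ≤ x a := by exact_mod_cast ha
  have key := ratio_alg (Na := NN (x - ev a)) (Nb := NN (x - ev b)) (xa := x a) (xb := x b) (M := M) (κ := ((n : ℝ) - 1) * (1 - μ + ν))
    (Sa := 1 - sg d μ lam x * ep d x a) (Sb := 1 - sg d μ lam x * ep d x b)
    (by have : 0 < (n : ℝ) - 1 := by linarith
        positivity) (by linarith) (by linarith) (by linarith) (by linarith) (prod_nonneg fun i _ => Nat.cast_nonneg _)
    (NN_nonneg _) (by linarith) (Real.exp_pos _).le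
    (by
      rw [hz_eq c, hz_eq c] at hm
      have h1 := Real.add_one_le_exp M
      have h3 : NN (x - ev a) * (x b / d / (1 - sg d μ lam x * ep d x b)) ≤ (M + 1) * (NN (x - ev b) * (x a / d / (1 - sg d μ lam x * ep d x a))) := by linarith
      have h2 : 0 ≤ NN (x - ev b) * (x a / d / (1 - sg d μ lam x * ep d x a)) := by
        have := NN_nonneg (x - ev b)
        have : 0 < 1 - sg d μ lam x * ep d x a := by linarith
        positivity
      have h4 := h3.trans (mul_le_mul_of_nonneg_right h1 h2)
      have h5 := mul_le_mul_of_nonneg_left h4 d0.le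
      have e1 : ∀ (N y s : ℝ), d * (N * (y / d / s)) = N * (y / s) := by intro N y s; field_simp
      rw [e1, mul_left_comm, e1] at h5
      exact h5)
    (Psi_step c a ha (hxn a)) (Psi_step c b hb (hxn b)) (fac c ad a).1 (fac c ad b).2
    (t3 := -(SS d μ x * (ep d x a - ep d x b)) + 110 * (1 + e) * μ * e * ν)
    (by rw [← Real.exp_add]; apply Real.exp_le_exp.2; linarith)
  convert key using 3
  ring

end

structure TT (n : ℕ) (d L : ℝ) (z : Fin n → ℤ) : Prop where
  nn : ∀ i, 0 ≤ z i
  dev : ∀ i, |(z i : ℝ) - d| ≤ L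
  sm : ∑ i, (z i : ℝ) = n * d
  ev : Even (∑ i, z i)
  qq : ∑ i, ((z i : ℝ) - d) ^ 2 ≤ 2 * n * d

section
variable {n : ℕ} {d e μ ν h lam L : ℝ} {J : ℕ}

lemma CX.hdμ (c : CX n d e μ ν h lam L J) : ((n : ℝ) - 1) * μ = d := by
  have p := c.toPR
  have e1 := p.hnν
  rw [p.hν] at e1
  have e2 := p.hd
  linear_combination d * e1 - (n - 1) * μ * e2

lemma Psi_pos (c : CX n d e μ ν h lam L J) {z : Fin n → ℤ} (h0 : ∀ i, 0 ≤ z i) (hd : ∀ i, |(z i : ℝ) - d| ≤ L) :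
    0 < Psi n d lam z := by
  refine mul_pos (prod_pos fun i _ => ?_) (Real.exp_pos _)
  have p := c.toPR
  have h3 : (z i : ℝ) ≤ ((n - 1 : ℤ) : ℝ) := by
    have hd' := c.hdμ
    have hk := p.μk 1 (by norm_num)
    rw [pow_one] at hk
    have h1 := (abs_le.1 (hd i)).2
    have h5 : d * (1 + e) = ((n : ℝ) - 1) * (μ * (1 + e)) := by rw [← hd']; ring
    have hL := c.hL; have L0 := c.L0
    have np := p.np
    push_cast
    nlinarith
  have h4 : z i ≤ n - 1 := by exact_mod_cast h3
  have := h0 i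
  exact_mod_cast Nat.choose_pos (by omega)

def Bet {n : ℕ} (D0 D' D : Fin n → ℤ) : Prop :=
  ∀ i, min (D0 i) (D' i) ≤ D i ∧ D i ≤ max (D0 i) (D' i)

lemma btw_real {a b x : ℤ} (h : min a b ≤ x ∧ x ≤ max a b) :
    ((a : ℝ) ≤ x ∧ (x : ℝ) ≤ b) ∨ ((b : ℝ) ≤ x ∧ (x : ℝ) ≤ a) := by
  rcases le_total a b with hab | hab
  · left; simp only [min_eq_left hab, max_eq_right hab] at h; exact_mod_cast h
  · right; simp only [min_eq_right hab, max_eq_left hab] at h; exact_mod_cast h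

lemma btw_good {D0 D' x : Fin n → ℤ} (h0 : TT n d L D0) (h' : TT n d L D') (hb : Bet D0 D' x)
    (hs : |∑ i, (x i : ℝ) - n * d| ≤ 1) : Good n d L 0 x where
  nn i := (le_min (h0.nn i) (h'.nn i)).trans (hb i).1
  dev i := by
    have h1 := abs_le.1 (h0.dev i); have h2 := abs_le.1 (h'.dev i)
    push_cast
    rw [abs_le]
    rcases btw_real (hb i) with h | h <;> constructor <;> linarith
  sm := by push_cast; linarith
  qq := by
    have : ∑ i, ((x i : ℝ) - d) ^ 2 ≤ ∑ i, (((D0 i : ℝ) - d) ^ 2 + ((D' i : ℝ) - d) ^ 2) := by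
      apply sum_le_sum
      intro i _
      have aux : ∀ a b y : ℝ, a ≤ y → y ≤ b → y ^ 2 ≤ a ^ 2 + b ^ 2 := by
        intro a b y h1 h2
        rcases le_total 0 y with h | h <;> nlinarith
      rcases btw_real (hb i) with h | h
      · apply aux <;> linarith
      · rw [add_comm]; apply aux <;> linarith
    rw [sum_add_distrib] at this
    have := h0.qq; have := h'.qq
    push_cast
    linarith

lemma path_cancel {N0 N1 N2 p0 p1 p2 s t : ℝ} (h1 : N0 * p1 ≤ Real.exp s * (N1 * p0))
    (h2 : N1 * p2 ≤ Real.exp t * (N2 * p1)) (hp0 : 0 < p0) (hp1 : 0 < p1) (hp2 : 0 < p2) :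
    N0 * p2 ≤ Real.exp (t + s) * (N2 * p0) := by
  refine le_of_mul_le_mul_right ?_ hp1
  calc N0 * p2 * p1 = N0 * p1 * p2 := by ring
    _ ≤ Real.exp s * (N1 * p0) * p2 := by gcongr
    _ = Real.exp s * p0 * (N1 * p2) := by ring
    _ ≤ Real.exp s * p0 * (Real.exp t * (N2 * p1)) := by gcongr
    _ = _ := by rw [Real.exp_add]; ring

lemma path (c : CX n d e μ ν h lam L J) {M : ℝ} (M0 : 0 ≤ M) (mc : MC n d μ lam L 0 M) {D0 D' : Fin n → ℤ} (h0 : TT n d L D0) (h' : TT n d L D') (k : ℕ) :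
    ∀ D : Fin n → ℤ, Bet D0 D' D → ∑ i, D i = ∑ i, D' i → ∑ i, |D i - D' i| ≤ k →
    NN D * Psi n d lam D' ≤ Real.exp (k * (M + 270 * (1 + e) * μ * e * ν)) * (NN D' * Psi n d lam D) := by
  have p := c.toPR
  have e0 := p.e0; have μ0 := p.hμ0; have ν0 := p.ν0
  have τ0 : 0 ≤ M + 270 * (1 + e) * μ * e * ν := by positivity
  have posb : ∀ D, Bet D0 D' D → 0 < Psi n d lam D := by
    intro D hb
    refine Psi_pos c (fun i => (le_min (h0.nn i) (h'.nn i)).trans (hb i).1) fun i => ?_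
    have h1 := abs_le.1 (h0.dev i); have h2 := abs_le.1 (h'.dev i)
    rw [abs_le]
    rcases btw_real (hb i) with h | h <;> constructor <;> linarith
  have triv : ∀ k : ℕ, NN D' * Psi n d lam D' ≤ Real.exp (k * (M + 270 * (1 + e) * μ * e * ν)) * (NN D' * Psi n d lam D') := by
    intro k
    refine le_mul_of_one_le_left (mul_nonneg (NN_nonneg _) (posb D' fun i => ⟨min_le_right _ _, le_max_right _ _⟩).le) ?_
    apply Real.one_le_exp; positivity
  induction k with
  | zero =>
    intro D hb hs hk
    have : D = D' := by
      ext i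
      have h1 : ∑ i, |D i - D' i| = 0 := le_antisymm (by simpa using hk) (sum_nonneg fun i _ => abs_nonneg _)
      have := (sum_eq_zero_iff_of_nonneg fun i _ => abs_nonneg _).1 h1 i (mem_univ i)
      have := abs_eq_zero.1 this; omega
    subst this
    exact triv 0
  | succ k ih =>
    intro D hb hs hk
    by_cases hD : D = D'
    · subst hD; exact triv (k + 1)
    obtain ⟨j, hj⟩ : ∃ j, D j ≠ D' j := by by_contra hh; push Not at hh; exact hD (funext hh)
    obtain ⟨a, ha⟩ : ∃ a, D a < D' a := by
      by_contra hh; push Not at hh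
      have := sum_lt_sum (s := univ) (fun i _ => hh i) ⟨j, mem_univ j, lt_of_le_of_ne (hh j) hj.symm⟩
      omega
    obtain ⟨b, hbb⟩ : ∃ b, D' b < D b := by
      by_contra hh; push Not at hh
      have := sum_lt_sum (s := univ) (fun i _ => hh i) ⟨j, mem_univ j, lt_of_le_of_ne (hh j) hj⟩
      omega
    have hab : a ≠ b := by rintro rfl; omega
    have bx : Bet D0 D' (D + ev a) := by
      intro i
      have := hb i
      by_cases hi : i = a
      · subst hi; simp only [Pi.add_apply, ev_self]; omega
      · simpa [ev_ne hi] using this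
    have b1 : Bet D0 D' (D + ev a - ev b) := by
      intro i
      have := hb i
      have h3 := bx i
      by_cases hi : i = b
      · subst hi; simp only [Pi.add_apply, Pi.sub_apply, ev_self, ev_ne hab.symm]; omega
      · simpa [ev_ne hi] using h3
    have sx1 : ∑ i, (D + ev a) i = ∑ i, D' i + 1 := by
      simp only [Pi.add_apply, sum_add_distrib, sum_ev]; omega
    have g : Good n d L 0 (D + ev a) := by
      apply btw_good h0 h' bx
      have h2 : ∑ i, ((D + ev a) i : ℝ) = ∑ i, (D' i : ℝ) + 1 := by exact_mod_cast sx1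
      rw [h2, h'.sm]; simp
    have st := one_step c mc g (by rw [sx1]; exact h'.ev.add_one) hab
      (by have := hb a; have := h0.nn a; have := h'.nn a; simp only [Pi.add_apply, ev_self]; omega)
      (by have := h'.nn b; simp only [Pi.add_apply, ev_ne hab.symm]; omega)
    rw [add_sub_cancel_right] at st
    have i1 := ih (D + ev a - ev b) b1 (by
        simp only [Pi.sub_apply, sum_sub_distrib, sum_ev] at sx1 ⊢; omega) (by
        have : ∑ i, |(D + ev a - ev b) i - D' i| = ∑ i, (|D i - D' i| - ev a i - ev b i) := by
          apply sum_congr rfl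
          intro i _
          simp only [Pi.add_apply, Pi.sub_apply]
          by_cases hi : i = a
          · subst hi; rw [ev_self, ev_ne hab, abs_of_nonpos (by omega), abs_of_neg (by omega)]; omega
          · by_cases hi' : i = b
            · subst hi'; rw [ev_self, ev_ne hi, abs_of_nonneg (by omega), abs_of_pos (by omega)]; omega
            · rw [ev_ne hi, ev_ne hi']; simp
        rw [this, sum_sub_distrib, sum_sub_distrib, sum_ev, sum_ev]
        push_cast at hk; omega)
    have := path_cancel st i1 (posb D hb) (posb _ b1) (posb D' fun i => ⟨min_le_right _ _, le_max_right _ _⟩)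
    refine this.trans (le_of_eq ?_)
    congr 2; push_cast; ring

/-- Comparison of any two sequences in the typical set. -/
lemma compare (c : CX n d e μ ν h lam L J) {k : ℕ} (hk : 3 * k + 3 ≤ J) {D D' : Fin n → ℤ} (h0 : TT n d L D) (h' : TT n d L D')
    (hs : ∑ i, D i = ∑ i, D' i) :
    NN D * Psi n d lam D' ≤ Real.exp (3 * n * Real.sqrt d * (140 * (μ * (1 + e) ^ 2) * (1 / 2) ^ k + 90270 * (μ * (1 + e) ^ 2 * e * ν))) * (NN D' * Psi n d lam D) := by
  have p := c.toPR
  have e0 := p.e0; have μ0 := p.hμ0; have ν0 := p.ν0; have d0 := c.d0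
  have mc := (iter c k 0 (by omega)).1
  obtain ⟨s, hs1⟩ : ∃ s : ℕ, (s : ℤ) = ∑ i, |D i - D' i| := ⟨(∑ i, |D i - D' i|).toNat, Int.toNat_of_nonneg (sum_nonneg fun i _ => abs_nonneg _)⟩
  have key := path c (by positivity) mc h0 h' s D (fun i => ⟨min_le_left _ _, le_max_left _ _⟩) hs hs1.ge
  have hsr : (s : ℝ) ≤ 3 * n * Real.sqrt d := by
    have h1 : (s : ℝ) = ∑ i, |((D i : ℝ) - d) - ((D' i : ℝ) - d)| := by
      have : ((s : ℤ) : ℝ) = ((∑ i, |D i - D' i| : ℤ) : ℝ) := by rw [hs1]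
      push_cast at this
      rw [this]; apply sum_congr rfl; intro i _; congr 1; ring
    have h2 : (s : ℝ) ^ 2 ≤ n * ∑ i, (((D i : ℝ) - d) - ((D' i : ℝ) - d)) ^ 2 := by
      rw [h1]
      have := sq_sum_le_card_mul_sum_sq (s := univ) (f := fun i => |((D i : ℝ) - d) - ((D' i : ℝ) - d)|)
      simpa [sq_abs] using this
    have h3 : ∑ i, (((D i : ℝ) - d) - ((D' i : ℝ) - d)) ^ 2 ≤ 8 * n * d := by
      have : ∑ i, (((D i : ℝ) - d) - ((D' i : ℝ) - d)) ^ 2 ≤ ∑ i, (2 * ((D i : ℝ) - d) ^ 2 + 2 * ((D' i : ℝ) - d) ^ 2) := by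
        apply sum_le_sum; intro i _
        nlinarith [sq_nonneg (((D i : ℝ) - d) + ((D' i : ℝ) - d))]
      rw [sum_add_distrib, ← mul_sum, ← mul_sum] at this
      have := h0.qq; have := h'.qq; linarith
    refine abs_le_of_sq_le_sq' ?_ (by positivity) |>.2
    rw [mul_pow, Real.sq_sqrt d0.le]
    have : (n : ℝ) * ∑ i, (((D i : ℝ) - d) - ((D' i : ℝ) - d)) ^ 2 ≤ n * (8 * n * d) := by gcongr
    have : 0 ≤ (n : ℝ) * n * d := by positivity
    linarith
  refine key.trans ?_
  have hn := NN_nonneg D'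
  have hp := (Psi_pos c h0.nn h0.dev).le
  apply mul_le_mul_of_nonneg_right _ (mul_nonneg hn hp)
  apply Real.exp_le_exp.2
  have hb : 270 * (1 + e) * μ * e * ν ≤ 270 * (μ * (1 + e) ^ 2 * e * ν) := by
    have : (1 + e) ≤ (1 + e) ^ 2 := by nlinarith
    calc _ = 270 * (μ * (1 + e) * e * ν) := by ring
      _ ≤ _ := by gcongr
  apply mul_le_mul hsr _ (by positivity) (by positivity)
  linarith
end

section
variable {α : Type} [DecidableEq α]

/-- number of `M`-subsets of `U` containing `K`, as a real -/
def cnt (U : Finset α) (M : ℕ) (K : Finset α) : ℝ :=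
  (((U.powersetCard M).filter (fun S => K ⊆ S)).card : ℝ)

lemma cnt_eq {U : Finset α} {M : ℕ} {K : Finset α} (hK : K ⊆ U) :
    cnt U M K * (U.card.descFactorial K.card : ℝ) = (U.card.choose M : ℝ) * (M.descFactorial K.card : ℝ) := by
  unfold cnt
  by_cases hM : K.card ≤ M
  · have : ((U.powersetCard M).filter (fun S => K ⊆ S)).card = (U.card - K.card).choose (M - K.card) :=
      card_filter_powersetCard_subset _ _ _ hK hM
    rw [this, Nat.descFactorial_eq_factorial_mul_choose, Nat.descFactorial_eq_factorial_mul_choose]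
    have h := Nat.choose_mul (n := U.card) hM
    have h' : (U.card.choose M : ℝ) * M.choose K.card = U.card.choose K.card * (U.card - K.card).choose (M - K.card) := by
      exact_mod_cast h
    push_cast
    linear_combination (-(K.card.factorial : ℝ)) * h'
  · have : (U.powersetCard M).filter (fun S => K ⊆ S) = ∅ := by
      rw [filter_eq_empty_iff]
      intro S hS hKS
      have := card_le_card hKS
      rw [(mem_powersetCard.1 hS).2] at this
      exact hM this
    rw [this, Nat.descFactorial_of_lt (n := M) (by omega)]; simp

lemma desc_le {u M : ℕ} (h : M ≤ u) (k : ℕ) : M.descFactorial k * u ^ k ≤ u.descFactorial k * M ^ k := by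
  induction k with
  | zero => simp
  | succ k ih =>
    rw [Nat.descFactorial_succ, Nat.descFactorial_succ, pow_succ, pow_succ]
    have : (M - k) * u ≤ (u - k) * M := by
      rcases le_total k M with hk | hk
      · zify [hk, hk.trans h]; nlinarith
      · rw [Nat.sub_eq_zero_of_le hk]; simp
    calc _ = ((M - k) * u) * (M.descFactorial k * u ^ k) := by ring
      _ ≤ ((u - k) * M) * (u.descFactorial k * M ^ k) := Nat.mul_le_mul this ih
      _ = _ := by ring

lemma cnt_le {U : Finset α} {M : ℕ} {K : Finset α} (hK : K ⊆ U) (hM : M ≤ U.card) (hu : 0 < U.card) :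
    cnt U M K ≤ (U.card.choose M : ℝ) * ((M : ℝ) / U.card) ^ K.card := by
  have h1 := cnt_eq (M := M) hK
  have h2 : (M.descFactorial K.card : ℝ) * U.card ^ K.card ≤ U.card.descFactorial K.card * M ^ K.card := by
    exact_mod_cast desc_le hM K.card
  have h3 : 0 < (U.card.descFactorial K.card : ℝ) := by
    exact_mod_cast Nat.descFactorial_pos.2 (card_le_card hK)
  have hu' : 0 < (U.card : ℝ) := by exact_mod_cast hu
  rw [div_pow, ← mul_div_assoc, le_div_iff₀ (by positivity)]
  refine le_of_mul_le_mul_right ?_ h3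
  calc _ = cnt U M K * (U.card.descFactorial K.card : ℝ) * U.card ^ K.card := by ring
    _ = (U.card.choose M : ℝ) * ((M.descFactorial K.card : ℝ) * U.card ^ K.card) := by rw [h1]; ring
    _ ≤ (U.card.choose M : ℝ) * (U.card.descFactorial K.card * M ^ K.card) := by gcongr
    _ = _ := by ring

lemma mgf {U A : Finset α} {M : ℕ} (hA : A ⊆ U) (hM : M ≤ U.card) (hu : 0 < U.card) {t : ℝ} (ht : 0 ≤ t) :
    ∑ S ∈ U.powersetCard M, (1 + t) ^ (S ∩ A).card ≤ (U.card.choose M : ℝ) * (1 + t * (M / U.card)) ^ A.card := by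
  have h1 : ∀ S : Finset α, (1 + t) ^ (S ∩ A).card = ∑ K ∈ A.powerset, if K ⊆ S then t ^ K.card else 0 := by
    intro S
    rw [← sum_filter]
    have : A.powerset.filter (fun K => K ⊆ S) = (S ∩ A).powerset := by
      ext K; simp only [mem_filter, mem_powerset, subset_inter_iff]; tauto
    rw [this]
    have := prod_one_add (f := fun _ : α => t) (S ∩ A)
    simpa using this
  simp_rw [h1]
  rw [sum_comm]
  have h2 : ∀ K ∈ A.powerset, (∑ S ∈ U.powersetCard M, if K ⊆ S then t ^ K.card else 0) ≤ (U.card.choose M : ℝ) * (t * (M / U.card)) ^ K.card := by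
    intro K hK
    rw [← sum_filter, sum_const, nsmul_eq_mul]
    have := cnt_le ((mem_powerset.1 hK).trans hA) hM hu
    unfold cnt at this
    rw [mul_pow]
    calc _ ≤ _ := mul_le_mul_of_nonneg_right this (by positivity)
      _ = _ := by ring
  refine (sum_le_sum h2).trans (le_of_eq ?_)
  rw [← mul_sum]
  congr 1
  have := prod_one_add (f := fun _ : α => t * ((M : ℝ) / U.card)) A
  simpa using this.symm

lemma mgf_compl {U A : Finset α} {M : ℕ} (hA : A ⊆ U) (hM : M ≤ U.card) (hu : 0 < U.card) {t : ℝ} (ht : 0 ≤ t) :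
    ∑ S ∈ U.powersetCard M, (1 + t) ^ (A \ S).card ≤ (U.card.choose M : ℝ) * (1 + t * (1 - M / U.card)) ^ A.card := by
  have h := mgf (M := U.card - M) hA (Nat.sub_le _ _) hu ht
  rw [Nat.choose_symm hM] at h
  have hu' : (U.card : ℝ) ≠ 0 := by exact_mod_cast hu.ne'
  rw [Nat.cast_sub hM, sub_div, div_self hu'] at h
  refine le_trans (le_of_eq ?_) h
  refine sum_nbij' (fun S => U \ S) (fun S => U \ S) ?_ ?_ ?_ ?_ ?_
  · intro S hS
    have := mem_powersetCard.1 hS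
    rw [mem_powersetCard]
    exact ⟨sdiff_subset, by rw [card_sdiff_of_subset this.1, this.2]⟩
  · intro S hS
    have := mem_powersetCard.1 hS
    rw [mem_powersetCard]
    exact ⟨sdiff_subset, by rw [card_sdiff_of_subset this.1, this.2]; omega⟩
  · intro S hS
    exact Finset.sdiff_sdiff_eq_self (mem_powersetCard.1 hS).1
  · intro S hS
    exact Finset.sdiff_sdiff_eq_self (mem_powersetCard.1 hS).1
  · intro S hS
    congr 2
    ext x
    simp only [mem_sdiff, mem_inter]
    have := @hA x
    tauto

lemma markov {ι : Type} [DecidableEq ι] (P : Finset ι) (f : ι → ℝ) (hf : ∀ i ∈ P, 0 ≤ f i) (q : ι → Prop) [DecidablePred q] {r B : ℝ}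
    (hq : ∀ i ∈ P, q i → r ≤ f i) (hB : ∑ i ∈ P, f i ≤ B) : ((P.filter q).card : ℝ) * r ≤ B := by
  refine le_trans ?_ hB
  rw [← nsmul_eq_mul]
  refine (card_nsmul_le_sum _ f r fun i hi => ?_).trans (sum_le_sum_of_subset_of_nonneg (filter_subset _ _) fun i hi _ => hf i hi)
  rw [mem_filter] at hi
  exact hq i hi.1 hi.2

lemma exp_le_one_add {t : ℝ} (ht : 0 ≤ t) : Real.exp (t - t ^ 2) ≤ 1 + t := by
  have h := Real.add_one_le_exp (-(t - t ^ 2))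
  have h2 : 0 < Real.exp (t - t ^ 2) := Real.exp_pos _
  rw [Real.exp_neg] at h
  have h4 : (1 + t) * (-(t - t ^ 2) + 1) ≥ 1 := by nlinarith [pow_nonneg ht 3]
  have h3 : (1 + t) * (Real.exp (t - t ^ 2))⁻¹ ≥ 1 := by
    refine h4.le.trans ?_
    gcongr
  have h5 := mul_le_mul_of_nonneg_right h3 h2.le
  rw [mul_assoc, inv_mul_cancel₀ h2.ne'] at h5
  linarith

lemma upper_tail {U A : Finset α} {M : ℕ} (hA : A ⊆ U) (hM : M ≤ U.card) (hu : 0 < U.card) {d L : ℝ} (d0 : 0 < d) (L0 : 0 < L)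
    (hd : (A.card : ℝ) * (M / U.card) = d) :
    (((U.powersetCard M).filter (fun S => d + L ≤ ((S ∩ A).card : ℝ))).card : ℝ) ≤
      (U.card.choose M : ℝ) * Real.exp (-(L ^ 2 / (4 * (d + L)))) := by
  obtain ⟨t, ht⟩ : ∃ t, t = L / (2 * (d + L)) := ⟨_, rfl⟩
  have t0 : 0 < t := by rw [ht]; positivity
  have ht' : t * (2 * (d + L)) = L := by rw [ht]; field_simp
  have t1 : t ≤ 1 := by nlinarith
  have p0 : 0 ≤ (M : ℝ) / U.card := by positivity
  have key := markov (U.powersetCard M) (fun S => (1 + t) ^ (S ∩ A).card) (fun S _ => by positivity)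
    (fun S => d + L ≤ ((S ∩ A).card : ℝ)) (r := Real.exp ((t - t ^ 2) * (d + L))) (B := (U.card.choose M : ℝ) * Real.exp (t * d)) ?_ ?_
  · rw [← le_div_iff₀ (Real.exp_pos _), mul_div_assoc, ← Real.exp_sub] at key
    refine key.trans (le_of_eq ?_)
    congr 2
    have : L ^ 2 / (4 * (d + L)) = t * L / 2 := by rw [ht]; field_simp; ring
    rw [this]
    linear_combination (t / 2) * ht'
  · intro S _ hS
    calc _ ≤ Real.exp ((t - t ^ 2) * (S ∩ A).card) := by
          apply Real.exp_le_exp.2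
          apply mul_le_mul_of_nonneg_left hS; nlinarith
      _ = (Real.exp (t - t ^ 2)) ^ (S ∩ A).card := by rw [← Real.exp_nat_mul]; ring_nf
      _ ≤ _ := by
          have := exp_le_one_add t0.le
          gcongr
  · refine (mgf hA hM hu t0.le).trans ?_
    gcongr
    calc _ ≤ (Real.exp (t * (M / U.card))) ^ A.card := by
          have := Real.add_one_le_exp (t * ((M : ℝ) / U.card))
          gcongr; linarith
      _ = _ := by rw [← Real.exp_nat_mul, ← hd]; ring_nf

lemma lower_tail {U A : Finset α} {M : ℕ} (hA : A ⊆ U) (hM : M ≤ U.card) (hu : 0 < U.card) {d L : ℝ} (d0 : 0 < d) (L0 : 0 < L)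
    (hd : (A.card : ℝ) * (M / U.card) = d) :
    (((U.powersetCard M).filter (fun S => ((S ∩ A).card : ℝ) ≤ d - L)).card : ℝ) ≤
      (U.card.choose M : ℝ) * Real.exp (-(L ^ 2 / (4 * (d + L)))) := by
  by_cases hdL : d < L
  · have : (U.powersetCard M).filter (fun S => ((S ∩ A).card : ℝ) ≤ d - L) = ∅ := by
      rw [filter_eq_empty_iff]; intro S _ h
      have : (0 : ℝ) ≤ (S ∩ A).card := Nat.cast_nonneg _
      linarith
    rw [this]; simp; positivity
  push Not at hdL
  obtain ⟨t, ht⟩ : ∃ t, t = L / (2 * d) := ⟨_, rfl⟩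
  have t0 : 0 < t := by rw [ht]; positivity
  have ht' : t * (2 * d) = L := by rw [ht]; field_simp
  have p0 : 0 ≤ (M : ℝ) / U.card := by positivity
  have p1 : (M : ℝ) / U.card ≤ 1 := by
    have : (M : ℝ) ≤ U.card := by exact_mod_cast hM
    rw [div_le_one (by exact_mod_cast hu)]; exact this
  have key := markov (U.powersetCard M) (fun S => (1 + t) ^ (A \ S).card) (fun S _ => by positivity)
    (fun S => ((S ∩ A).card : ℝ) ≤ d - L) (r := (1 + t) ^ A.card / Real.exp (t * (d - L)))
    (B := (U.card.choose M : ℝ) * ((1 + t) ^ A.card * Real.exp (-((t - t ^ 2) * d)))) ?_ ?_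
  · have e1 : 0 < (1 + t) ^ A.card := by positivity
    have : (((U.powersetCard M).filter (fun S => ((S ∩ A).card : ℝ) ≤ d - L)).card : ℝ) ≤
      (U.card.choose M : ℝ) * (Real.exp (-((t - t ^ 2) * d)) * Real.exp (t * (d - L))) := by
      rw [mul_div_assoc', div_le_iff₀ (Real.exp_pos _)] at key
      refine le_of_mul_le_mul_right ?_ e1
      calc _ ≤ _ := key
        _ = _ := by ring
    refine this.trans ?_
    rw [← Real.exp_add]
    gcongr
    have h2 : -((t - t ^ 2) * d) + t * (d - L) = -(L ^ 2 / (4 * d)) := by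
      have : L ^ 2 / (4 * d) = t * L / 2 := by rw [ht]; field_simp; ring
      rw [this]; linear_combination (t / 2) * ht'
    rw [h2, neg_le_neg_iff]
    gcongr; linarith
  · intro S _ hS
    rw [div_le_iff₀ (Real.exp_pos _)]
    have hc : A.card = (A \ S).card + (S ∩ A).card := by
      rw [inter_comm]; exact (card_sdiff_add_card_inter A S).symm
    rw [hc, pow_add]
    gcongr
    calc (1 + t) ^ (S ∩ A).card ≤ (Real.exp t) ^ (S ∩ A).card := by
          have := Real.add_one_le_exp t
          gcongr; linarith
      _ = Real.exp (t * (S ∩ A).card) := by rw [← Real.exp_nat_mul]; ring_nf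
      _ ≤ _ := by gcongr
  · refine (mgf_compl hA hM hu t0.le).trans ?_
    gcongr
    have h1 : 1 + t * (1 - (M : ℝ) / U.card) ≤ (1 + t) * Real.exp (-((t - t ^ 2) * (M / U.card))) := by
      have := Real.add_one_le_exp (-((t - t ^ 2) * ((M : ℝ) / U.card)))
      calc _ ≤ (1 + t) * (-((t - t ^ 2) * ((M : ℝ) / U.card)) + 1) := by
            have : 0 ≤ t ^ 3 * ((M : ℝ) / U.card) := by positivity
            linarith
        _ ≤ _ := by gcongr
    calc _ ≤ ((1 + t) * Real.exp (-((t - t ^ 2) * (M / U.card)))) ^ A.card := by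
          have : 0 ≤ 1 - (M : ℝ) / U.card := by linarith
          gcongr
      _ = _ := by rw [mul_pow, ← Real.exp_nat_mul, ← hd]; congr 2; ring
end

section
variable {α : Type} [DecidableEq α]

lemma sum_cnt (U : Finset α) (M : ℕ) (K : Finset α) :
    ∑ S ∈ U.powersetCard M, (if K ⊆ S then (1 : ℝ) else 0) = cnt U M K := by
  unfold cnt; rw [sum_boole]

/-- probabilities of containing a k-set -/
def cc (u M k : ℕ) : ℝ := (u.choose M : ℝ) * (M.descFactorial k : ℝ) / (u.descFactorial k : ℝ)

lemma cnt_cc {U K : Finset α} {M : ℕ} (hK : K ⊆ U) : cnt U M K = cc U.card M K.card := by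
  have h3 : 0 < (U.card.descFactorial K.card : ℝ) := by
    exact_mod_cast Nat.descFactorial_pos.2 (card_le_card hK)
  rw [cc, eq_div_iff h3.ne']; exact cnt_eq hK

lemma cc_nonneg (u M k : ℕ) : 0 ≤ cc u M k := by unfold cc; positivity

lemma cc_succ {u M k : ℕ} (hk : k < u) (hM : k ≤ M) : cc u M (k + 1) * ((u : ℝ) - k) = cc u M k * ((M : ℝ) - k) := by
  unfold cc
  rw [Nat.descFactorial_succ, Nat.descFactorial_succ]
  push_cast [Nat.cast_sub hk.le, Nat.cast_sub hM]
  have h3 : (u.descFactorial k : ℝ) ≠ 0 := by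
    exact_mod_cast (Nat.descFactorial_pos.2 hk.le).ne'
  have h4 : (u : ℝ) - k ≠ 0 := by
    have : (k : ℝ) < u := by exact_mod_cast hk
    linarith
  field_simp

lemma cc_anti {u M k : ℕ} (hk : k < u) (hM : k ≤ M) (hu : M ≤ u) : cc u M (k + 1) ≤ cc u M k := by
  have h := cc_succ hk hM
  have h1 : (k : ℝ) < u := by exact_mod_cast hk
  have h2 : (M : ℝ) ≤ u := by exact_mod_cast hu
  have := cc_nonneg u M k
  refine le_of_mul_le_mul_right ?_ (sub_pos.2 h1)
  rw [h]; gcongr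

lemma card4 {U : Finset α} {M : ℕ} (hM : 3 ≤ M) (hMu : M ≤ U.card) (hu : 4 ≤ U.card) {x y z t : α} (hx : x ∈ U) (hy : y ∈ U) (hz : z ∈ U) (ht : t ∈ U)
    (hxy : x ≠ y) (hzt : z ≠ t) :
    cnt U M {x, y, z, t} ≤ cc U.card M 4 + (cc U.card M 3 - cc U.card M 4) * ((if z = x then 1 else 0) + (if z = y then 1 else 0) + (if t = x then 1 else 0) + (if t = y then 1 else 0))
      + cc U.card M 2 * ((if z = x ∧ t = y then 1 else 0) + (if z = y ∧ t = x then 1 else 0)) := by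
  have hs : ({x, y, z, t} : Finset α) ⊆ U := by
    intro a; simp only [mem_insert, mem_singleton]; rintro (rfl | rfl | rfl | rfl) <;> assumption
  rw [cnt_cc hs]
  have c43 : cc U.card M 4 ≤ cc U.card M 3 := cc_anti (by omega) (by omega) hMu
  have c32 : cc U.card M 3 ≤ cc U.card M 2 := cc_anti (by omega) (by omega) hMu
  have c4 := cc_nonneg U.card M 4
  by_cases h1 : z = x
  · subst h1
    by_cases h2 : t = y
    · subst h2
      have : ({z, t, z, t} : Finset α).card = 2 := by
        rw [show ({z, t, z, t} : Finset α) = {z, t} by ext a; simp]; exact card_pair hxy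
      rw [this]
      simp [hxy, hzt, hzt.symm]; linarith
    · have : ({z, y, z, t} : Finset α).card = 3 := by
        rw [show ({z, y, z, t} : Finset α) = {z, y, t} by ext a; simp; tauto]
        rw [card_eq_three]; exact ⟨z, y, t, hxy, hzt, Ne.symm h2, rfl⟩
      rw [this]
      simp [hxy, hzt.symm, h2]
  · by_cases h2 : z = y
    · subst h2
      by_cases h3 : t = x
      · subst h3
        have : ({t, z, z, t} : Finset α).card = 2 := by
          rw [show ({t, z, z, t} : Finset α) = {t, z} by ext a; simp; tauto]; exact card_pair hxy
        rw [this]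
        simp [hzt, hzt.symm]; linarith
      · have : ({x, z, z, t} : Finset α).card = 3 := by
          rw [show ({x, z, z, t} : Finset α) = {x, z, t} by ext a; simp]
          rw [card_eq_three]; exact ⟨x, z, t, hxy, Ne.symm h3, hzt, rfl⟩
        rw [this]
        simp [hxy.symm, hzt.symm, h3]
    · by_cases h3 : t = x
      · subst h3
        have : ({t, y, z, t} : Finset α).card = 3 := by
          rw [show ({t, y, z, t} : Finset α) = {t, y, z} by ext a; simp; tauto]
          rw [card_eq_three]; exact ⟨t, y, z, hxy, hzt.symm, Ne.symm h2, rfl⟩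
        rw [this]
        simp [hxy, hzt, h2]
      · by_cases h4 : t = y
        · subst h4
          have : ({x, t, z, t} : Finset α).card = 3 := by
            rw [show ({x, t, z, t} : Finset α) = {x, t, z} by ext a; simp; tauto]
            rw [card_eq_three]; exact ⟨x, t, z, hxy, Ne.symm h1, hzt.symm, rfl⟩
          rw [this]
          simp [hxy.symm, h1, hzt]
        · have : ({x, y, z, t} : Finset α).card = 4 := by
            rw [card_insert_of_notMem (by simp; exact ⟨hxy, Ne.symm h1, Ne.symm h3⟩)]
            rw [card_eq_three.2 ⟨y, z, t, Ne.symm h2, Ne.symm h4, hzt, rfl⟩]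
          rw [this]
          simp [h1, h2, h3, h4]

structure WT (U : Finset α) (w : α → α → ℝ) (r : ℝ) : Prop where
  nn : ∀ x y, 0 ≤ w x y
  le1 : ∀ x y, w x y ≤ 1
  diag : ∀ x, w x x = 0
  symm : ∀ x y, w x y = w y x
  row : ∀ x ∈ U, ∑ y ∈ U, w x y = r

def YY (U : Finset α) (w : α → α → ℝ) (S : Finset α) : ℝ :=
  ∑ x ∈ U, ∑ y ∈ U, w x y * (if x ∈ S ∧ y ∈ S then 1 else 0)

variable {U : Finset α} {w : α → α → ℝ} {r : ℝ} {M : ℕ}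

lemma WT.tot (W : WT U w r) : ∑ x ∈ U, ∑ y ∈ U, w x y = U.card * r := by
  rw [sum_congr rfl W.row, sum_const, nsmul_eq_mul]

lemma first_moment (W : WT U w r) : ∑ S ∈ U.powersetCard M, YY U w S = U.card * r * cc U.card M 2 := by
  unfold YY
  rw [sum_comm, ← W.tot, sum_mul]
  apply sum_congr rfl
  intro x hx
  rw [sum_comm, sum_mul]
  apply sum_congr rfl
  intro y hy
  rw [← mul_sum]
  by_cases h : x = y
  · subst h; simp [W.diag]
  · congr 1
    have hs : ({x, y} : Finset α) ⊆ U := by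
      intro a; simp only [mem_insert, mem_singleton]; rintro (rfl | rfl) <;> assumption
    have := cnt_cc (M := M) hs
    rw [card_pair h] at this
    rw [← this, ← sum_cnt]
    apply sum_congr rfl
    intro S _
    simp [insert_subset_iff]

lemma second_moment (W : WT U w r) (hM : 3 ≤ M) (hMu : M ≤ U.card) (hu : 4 ≤ U.card) : ∑ S ∈ U.powersetCard M, YY U w S ^ 2 ≤
    (U.card * r) ^ 2 * cc U.card M 4 + 4 * (U.card * r) * r * (cc U.card M 3 - cc U.card M 4) + 2 * (U.card * r) * cc U.card M 2 := by
  have e1 : ∀ S, YY U w S ^ 2 = ∑ x ∈ U, ∑ y ∈ U, ∑ z ∈ U, ∑ t ∈ U, w x y * w z t * (if ({x, y, z, t} : Finset α) ⊆ S then 1 else 0) := by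
    intro S
    unfold YY
    rw [sq, sum_mul]
    apply sum_congr rfl; intro x _
    rw [sum_mul]
    apply sum_congr rfl; intro y _
    rw [mul_sum]
    apply sum_congr rfl; intro z _
    rw [mul_sum]
    apply sum_congr rfl; intro t _
    rw [mul_mul_mul_comm]
    congr 1
    simp only [insert_subset_iff, singleton_subset_iff]
    by_cases h1 : x ∈ S <;> by_cases h2 : y ∈ S <;> simp [h1, h2]
  have e2 : ∑ S ∈ U.powersetCard M, YY U w S ^ 2 = ∑ x ∈ U, ∑ y ∈ U, ∑ z ∈ U, ∑ t ∈ U, w x y * w z t * cnt U M {x, y, z, t} := by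
    simp_rw [e1]
    rw [sum_comm]; apply sum_congr rfl; intro x _
    rw [sum_comm]; apply sum_congr rfl; intro y _
    rw [sum_comm]; apply sum_congr rfl; intro z _
    rw [sum_comm]; apply sum_congr rfl; intro t _
    rw [← mul_sum, sum_cnt]
  rw [e2]
  have c43 : cc U.card M 4 ≤ cc U.card M 3 := cc_anti (by omega) (by omega) hMu
  have c2 := cc_nonneg U.card M 2
  obtain ⟨c, hc⟩ : ∃ c, c = cc U.card M 3 - cc U.card M 4 := ⟨_, rfl⟩
  have h1 : ∀ x ∈ U, ∀ y ∈ U, ∑ z ∈ U, ∑ t ∈ U, w x y * w z t * cnt U M {x, y, z, t} ≤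
      w x y * (U.card * r * cc U.card M 4 + c * (4 * r) + 2 * cc U.card M 2) := by
    intro x hx y hy
    by_cases hxy : x = y
    · subst hxy; simp [W.diag]
    have h2 : ∀ z ∈ U, ∀ t ∈ U, w x y * w z t * cnt U M {x, y, z, t} ≤
        w x y * (w z t * cc U.card M 4 + c * ((if z = x then w z t else 0) + (if z = y then w z t else 0) + (if t = x then w z t else 0) + (if t = y then w z t else 0))
          + cc U.card M 2 * ((if z = x then (if t = y then 1 else 0) else 0) + (if z = y then (if t = x then 1 else 0) else 0))) := by
      intro z hz t ht
      rw [mul_assoc]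
      apply mul_le_mul_of_nonneg_left _ (W.nn x y)
      by_cases hzt : z = t
      · subst hzt
        simp only [W.diag, ite_self]
        have h0 : 0 ≤ cc U.card M 2 * ((if z = x then (if z = y then 1 else 0) else 0) + (if z = y then (if z = x then 1 else 0) else 0) : ℝ) := by
          apply mul_nonneg c2; split_ifs <;> norm_num
        linarith
      have h3 := mul_le_mul_of_nonneg_left (card4 hM hMu hu hx hy hz ht hxy hzt) (W.nn z t)
      refine h3.trans ?_
      rw [← hc]
      have w1 := W.le1 z t
      have h5 : w z t * (cc U.card M 2 * ((if z = x ∧ t = y then 1 else 0) + (if z = y ∧ t = x then 1 else 0))) ≤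
        cc U.card M 2 * ((if z = x then (if t = y then 1 else 0) else 0) + (if z = y then (if t = x then 1 else 0) else 0)) := by
        simp only [ite_and]
        refine mul_le_of_le_one_left (mul_nonneg c2 ?_) w1
        split_ifs <;> norm_num
      have h6 : w z t * (c * ((if z = x then 1 else 0) + (if z = y then 1 else 0) + (if t = x then 1 else 0) + (if t = y then 1 else 0))) =
        c * ((if z = x then w z t else 0) + (if z = y then w z t else 0) + (if t = x then w z t else 0) + (if t = y then w z t else 0)) := by
        have : ∀ (p : Prop) [Decidable p], (if p then w z t else 0) = w z t * (if p then 1 else 0) := by intro p _; split_ifs <;> simp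
        rw [this, this, this, this]; ring
      linarith
    refine (sum_le_sum fun z hz => sum_le_sum fun t ht => h2 z hz t ht).trans (le_of_eq ?_)
    simp only [← mul_sum, sum_add_distrib, ← sum_mul]
    congr 1
    rw [W.tot]
    have r1 : ∀ a ∈ U, ∑ z ∈ U, ∑ t ∈ U, (if z = a then w z t else 0) = r := by
      intro a ha
      have : ∀ z ∈ U, ∑ t ∈ U, (if z = a then w z t else 0) = if z = a then ∑ t ∈ U, w z t else 0 := by
        intro z _; split_ifs <;> simp
      rw [sum_congr rfl this, sum_ite_eq' U a, if_pos ha, W.row a ha]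
    have r2 : ∀ a ∈ U, ∑ z ∈ U, ∑ t ∈ U, (if t = a then w z t else 0) = r := by
      intro a ha
      rw [sum_comm, ← r1 a ha]
      simp_rw [W.symm]
    have r3 : ∀ a ∈ U, ∀ b ∈ U, ∑ z ∈ U, ∑ t ∈ U, (if z = a then (if t = b then (1 : ℝ) else 0) else 0) = 1 := by
      intro a ha b hb
      have : ∀ z ∈ U, ∑ t ∈ U, (if z = a then (if t = b then (1 : ℝ) else 0) else 0) = if z = a then 1 else 0 := by
        intro z _; split_ifs <;> simp [hb]
      rw [sum_congr rfl this]; simp [ha]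
    rw [r1 x hx, r1 y hy, r2 x hx, r2 y hy, r3 x hx y hy, r3 y hy x hx]
    ring
  refine (sum_le_sum fun x hx => sum_le_sum fun y hy => h1 x hx y hy).trans (le_of_eq ?_)
  simp only [← sum_mul]
  rw [W.tot, ← hc]; ring

lemma var_alg {u M p2 p3 p4 : ℝ} (hu : 4 ≤ u) (hM : 3 ≤ M) (hMu : M + 1 ≤ u) (h2 : p2 * (u * (u - 1)) = M * (M - 1))
    (h3 : p3 * (u - 2) = p2 * (M - 2)) (h4 : p4 * (u - 3) = p3 * (M - 3)) : u * p4 + 4 * (p3 - p4) ≤ u * p2 ^ 2 := by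
  have p20 : 0 ≤ p2 := by
    have : 0 ≤ M * (M - 1) := mul_nonneg (by linarith) (by linarith)
    rw [← h2] at this
    exact nonneg_of_mul_nonneg_left this (mul_pos (by linarith) (by linarith))
  have a1 : 0 < u - 1 := by linarith
  have a2 : 0 < u - 2 := by linarith
  have a3 : 0 < u - 3 := by linarith
  have key : 0 ≤ (u * p2 ^ 2 - (u * p4 + 4 * (p3 - p4))) * ((u - 1) * (u - 2) * (u - 3)) := by
    have : (u * p2 ^ 2 - (u * p4 + 4 * (p3 - p4))) * ((u - 1) * (u - 2) * (u - 3)) = p2 * ((u - M) * (2 * (u - M - 1))) := by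
      linear_combination (p2 * (u - 2) * (u - 3)) * h2 - ((u - 1) * (u - 2) * (u - 4)) * h4 - ((u - 1) * (4 * (u - 3) + (u - 4) * (M - 3))) * h3
    rw [this]
    apply mul_nonneg p20; apply mul_nonneg <;> linarith
  have := nonneg_of_mul_nonneg_left key (by positivity)
  linarith

lemma var_bound (W : WT U w r) (r0 : 0 ≤ r) (hM : 3 ≤ M) (hMu : M + 1 ≤ U.card) {m1 : ℝ} (hm : m1 * (U.card - 1) = r * M * (M - 1)) :
    ∑ S ∈ U.powersetCard M, YY U w S = (U.card.choose M : ℝ) * m1 ∧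
    ∑ S ∈ U.powersetCard M, (YY U w S - m1) ^ 2 ≤ 2 * (U.card.choose M : ℝ) * m1 := by
  have u4 : 4 ≤ U.card := by omega
  have f := first_moment (M := M) W
  have s := second_moment W hM (by omega) u4
  have hc : 0 < (U.card.choose M : ℝ) := by exact_mod_cast Nat.choose_pos (by omega)
  have c0 : cc U.card M 0 = U.card.choose M := by simp [cc]
  have h1 := cc_succ (u := U.card) (M := M) (k := 0) (by omega) (by omega)
  have h2 := cc_succ (u := U.card) (M := M) (k := 1) (by omega) (by omega)
  have h3 := cc_succ (u := U.card) (M := M) (k := 2) (by omega) (by omega)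
  have h4 := cc_succ (u := U.card) (M := M) (k := 3) (by omega) (by omega)
  rw [c0] at h1
  norm_num at h1 h2 h3 h4
  have u4' : (4 : ℝ) ≤ U.card := by exact_mod_cast u4
  have M3 : (3 : ℝ) ≤ M := by exact_mod_cast hM
  have Mu : (M : ℝ) + 1 ≤ U.card := by exact_mod_cast hMu
  have cardP : ((U.powersetCard M).card : ℝ) = U.card.choose M := by rw [card_powersetCard]
  generalize cc U.card M 1 = c1 at *
  generalize cc U.card M 2 = c2 at *
  generalize cc U.card M 3 = c3 at *
  generalize cc U.card M 4 = c4 at *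
  generalize (U.card.choose M : ℝ) = c at *
  generalize (U.card : ℝ) = u at *
  generalize (M : ℝ) = m at *
  have hu1 : u - 1 ≠ 0 := by linarith
  have hu0 : u ≠ 0 := by linarith
  have key := var_alg (p2 := c2 / c) (p3 := c3 / c) (p4 := c4 / c) u4' M3 Mu
    (by field_simp; linear_combination (m - 1) * h1 + u * h2) (by field_simp; exact h3) (by field_simp; exact h4)
  have f2 : u * r * c2 = c * m1 := by
    have : u * r * c2 * (u - 1) = c * m1 * (u - 1) := by
      linear_combination (r * (m - 1)) * h1 + (r * u) * h2 - c * hm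
    exact mul_right_cancel₀ hu1 this
  refine ⟨f.trans f2, ?_⟩
  have e : ∑ S ∈ U.powersetCard M, (YY U w S - m1) ^ 2 = ∑ S ∈ U.powersetCard M, YY U w S ^ 2 - 2 * m1 * ∑ S ∈ U.powersetCard M, YY U w S + c * m1 ^ 2 := by
    rw [← cardP, ← nsmul_eq_mul, ← sum_const, mul_sum, ← sum_sub_distrib, ← sum_add_distrib]
    apply sum_congr rfl; intro S _; ring
  rw [e, f, f2]
  have k2 : c * (u * r * r) * (u * (c4 / c) + 4 * (c3 / c - c4 / c)) ≤ c * (u * r * r) * (u * (c2 / c) ^ 2) := by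
    apply mul_le_mul_of_nonneg_left key
    have : 0 ≤ u := by linarith
    positivity
  have k3 : c * (u * r * r) * (u * (c2 / c) ^ 2) = c * m1 ^ 2 := by
    have : m1 = u * r * c2 / c := by rw [f2]; field_simp
    rw [this]; field_simp
  have k4 : c * (u * r * r) * (u * (c4 / c) + 4 * (c3 / c - c4 / c)) = (u * r) ^ 2 * c4 + 4 * (u * r) * r * (c3 - c4) := by
    field_simp
  linarith
end

section
variable {α : Type} [DecidableEq α]

structure BL (U : Finset α) {n : ℕ} (b hh : ℕ) (A : Fin n → Finset α) : Prop where
  sub : ∀ i, A i ⊆ U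
  card : ∀ i, (A i).card = b
  cov : ∀ x ∈ U, (univ.filter (fun i => x ∈ A i)).card = hh
  one : ∀ x y, x ≠ y → (univ.filter (fun i => x ∈ A i ∧ y ∈ A i)).card ≤ 1

def wt {n : ℕ} (A : Fin n → Finset α) (x y : α) : ℝ :=
  if x = y then 0 else ∑ i, if x ∈ A i ∧ y ∈ A i then (1 : ℝ) else 0

variable {U : Finset α} {n b hh M : ℕ} {A : Fin n → Finset α}

lemma BL.wt (B : BL U b hh A) (hb : 1 ≤ b) : WT U (wt A) (hh * (b - 1)) where
  nn x y := by unfold _root_.wt; split_ifs; · rfl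
               exact sum_nonneg fun i _ => by split_ifs <;> norm_num
  le1 x y := by
    unfold _root_.wt; split_ifs with h; · norm_num
    rw [sum_boole]; exact_mod_cast B.one x y h
  diag x := by simp [_root_.wt]
  symm x y := by unfold _root_.wt; simp only [eq_comm, and_comm]
  row x hx := by
    have h1 : ∀ y ∈ U, _root_.wt A x y = ∑ i, if x ∈ A i then (if y ∈ (A i).erase x then (1 : ℝ) else 0) else 0 := by
      intro y hy
      unfold _root_.wt
      by_cases h : x = y
      · subst h; simp
      · rw [if_neg h]; apply sum_congr rfl; intro i _
        by_cases h1 : x ∈ A i <;> simp [h1, Ne.symm h]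
    rw [sum_congr rfl h1, sum_comm]
    have h2 : ∀ i ∈ (univ : Finset (Fin n)), (∑ y ∈ U, if x ∈ A i then (if y ∈ (A i).erase x then (1 : ℝ) else 0) else 0) = if x ∈ A i then ((b : ℝ) - 1) else 0 := by
      intro i _
      split_ifs with h
      · rw [sum_boole, filter_mem_eq_inter, inter_eq_right.2 ((erase_subset _ _).trans (B.sub i)), card_erase_of_mem h, B.card i, Nat.cast_sub hb]; simp
      · simp
    rw [sum_congr rfl h2, ← sum_filter, sum_const, nsmul_eq_mul, B.cov x hx]

lemma BL.sumD (B : BL U b hh A) {S : Finset α} (hS : S ⊆ U) : ∑ i, ((S ∩ A i).card : ℝ) = hh * S.card := by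
  have : ∀ i, ((S ∩ A i).card : ℝ) = ∑ x ∈ S, if x ∈ A i then (1 : ℝ) else 0 := by
    intro i; rw [sum_boole, filter_mem_eq_inter]
  simp_rw [this]
  rw [sum_comm]
  have h2 : ∀ x ∈ S, (∑ i, if x ∈ A i then (1 : ℝ) else 0) = hh := by
    intro x hx; rw [sum_boole, B.cov x (hS hx)]
  rw [sum_congr rfl h2, sum_const, nsmul_eq_mul, mul_comm]

lemma BL.YYeq (B : BL U b hh A) {S : Finset α} (hS : S ⊆ U) : YY U (_root_.wt A) S = ∑ i, (((S ∩ A i).card : ℝ) ^ 2 - (S ∩ A i).card) := by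
  unfold YY
  have h0 : ∑ x ∈ U, ∑ y ∈ U, _root_.wt A x y * (if x ∈ S ∧ y ∈ S then 1 else 0) = ∑ x ∈ S, ∑ y ∈ S, _root_.wt A x y := by
    have h1 : ∀ x ∈ U, ∑ y ∈ U, _root_.wt A x y * (if x ∈ S ∧ y ∈ S then 1 else 0) = if x ∈ S then ∑ y ∈ S, _root_.wt A x y else 0 := by
      intro x _
      split_ifs with h
      · simp only [h, true_and, mul_ite, mul_one, mul_zero]
        rw [← sum_filter, filter_mem_eq_inter, inter_eq_right.2 hS]
      · simp [h]
    rw [sum_congr rfl h1, ← sum_filter, filter_mem_eq_inter, inter_eq_right.2 hS]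
  rw [h0]
  have h2 : ∀ x y, _root_.wt A x y = ∑ i, ((if x ∈ A i then (1 : ℝ) else 0) * (if y ∈ A i then (1 : ℝ) else 0) - if x = y then (if x ∈ A i then 1 else 0) else 0) := by
    intro x y
    unfold _root_.wt
    split_ifs with h
    · subst h; symm; apply sum_eq_zero; intro i _
      by_cases h1 : x ∈ A i <;> simp [h1]
    · apply sum_congr rfl; intro i _
      by_cases h1 : x ∈ A i <;> simp [h1]
  have h3 : ∀ i, ((S ∩ A i).card : ℝ) = ∑ x ∈ S, if x ∈ A i then (1 : ℝ) else 0 := by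
    intro i; rw [sum_boole, filter_mem_eq_inter]
  calc ∑ x ∈ S, ∑ y ∈ S, _root_.wt A x y = ∑ x ∈ S, ∑ i, ∑ y ∈ S, ((if x ∈ A i then (1 : ℝ) else 0) * (if y ∈ A i then (1 : ℝ) else 0) - if x = y then (if x ∈ A i then 1 else 0) else 0) := by
        apply sum_congr rfl; intro x _
        simp_rw [h2]; rw [sum_comm]
    _ = ∑ i, ∑ x ∈ S, ∑ y ∈ S, ((if x ∈ A i then (1 : ℝ) else 0) * (if y ∈ A i then (1 : ℝ) else 0) - if x = y then (if x ∈ A i then 1 else 0) else 0) := by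
        rw [sum_comm]
    _ = _ := by
        apply sum_congr rfl; intro i _
        simp only [sum_sub_distrib, sum_ite_eq, ← mul_sum]
        rw [← sum_mul, ← h3, sq]
        congr 1
        rw [h3]; apply sum_congr rfl; intro x hx; simp [hx]

/-- main concentration statement -/
lemma BL.main (B : BL U b hh A) (hb : 1 ≤ b) (hh1 : 1 ≤ hh) (hM : 3 ≤ M) (hMu : M + 1 ≤ U.card) (hn : 1 ≤ n) {d L m1 : ℝ} (d0 : 0 < d)
    (L0 : 0 < L) (hd : n * d = hh * M) (hL : Real.exp (-(L ^ 2 / (4 * (d + L)))) ≤ 1 / (n : ℝ) ^ 2)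
    (hm : m1 * (U.card - 1) = hh * (b - 1) * M * (M - 1)) (hm2 : m1 ≤ n * d ^ 2) :
    (((U.powersetCard M).filter (fun S => ¬ ((∀ i, |((S ∩ A i).card : ℝ) - d| ≤ L) ∧ ∑ i, (((S ∩ A i).card : ℝ) - d) ^ 2 ≤ 2 * n * d))).card : ℝ)
      ≤ (U.card.choose M : ℝ) * (4 / n) ∧
    ∑ S ∈ U.powersetCard M, (∑ i, (((S ∩ A i).card : ℝ) - d) ^ 2) = (U.card.choose M : ℝ) * (m1 - n * d ^ 2 + n * d) ∧
    ∑ S ∈ U.powersetCard M, (∑ i, (((S ∩ A i).card : ℝ) - d) ^ 2 - (m1 - n * d ^ 2 + n * d)) ^ 2 ≤ 2 * (U.card.choose M : ℝ) * (n * d ^ 2) := by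
  have hb' : (1 : ℝ) ≤ b := by exact_mod_cast hb
  obtain ⟨v1, v2⟩ := var_bound (B.wt hb) (mul_nonneg (Nat.cast_nonneg _) (by linarith)) hM hMu hm
  have n0 : (0 : ℝ) < n := by exact_mod_cast hn
  have hh0 : (0 : ℝ) < hh := by exact_mod_cast hh1
  have u0 : 0 < U.card := by omega
  have u0' : (0 : ℝ) < U.card := by exact_mod_cast u0
  have C0 : (0 : ℝ) ≤ U.card.choose M := Nat.cast_nonneg _
  have hQ : ∀ S ∈ U.powersetCard M, ∑ i, (((S ∩ A i).card : ℝ) - d) ^ 2 = YY U (_root_.wt A) S - n * d ^ 2 + n * d := by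
    intro S hS
    obtain ⟨hS1, hS2⟩ := mem_powersetCard.1 hS
    have e1 := B.sumD hS1
    rw [hS2, ← hd] at e1
    rw [B.YYeq hS1, sum_sub_distrib, e1]
    have : ∀ i ∈ (univ : Finset (Fin n)), (((S ∩ A i).card : ℝ) - d) ^ 2 = ((S ∩ A i).card : ℝ) ^ 2 - 2 * d * (S ∩ A i).card + d ^ 2 := by
      intro i _; ring
    rw [sum_congr rfl this, sum_add_distrib, sum_sub_distrib, ← mul_sum, e1]
    simp; ring
  have hub : (n : ℝ) * b = hh * U.card := by
    have := B.sumD (Subset.refl U)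
    have h2 : ∀ i ∈ (univ : Finset (Fin n)), ((U ∩ A i).card : ℝ) = b := by
      intro i _; rw [inter_eq_right.2 (B.sub i), B.card]
    rw [sum_congr rfl h2] at this
    simpa using this
  have hp : ∀ i, ((A i).card : ℝ) * (M / U.card) = d := by
    intro i
    rw [B.card, mul_div_assoc', div_eq_iff u0'.ne']
    have : (n * hh : ℝ) * (b * M) = (n * hh) * (d * U.card) := by linear_combination hh * M * hub - hh * U.card * hd
    exact mul_left_cancel₀ (by positivity) this
  have m2 : 2 * (U.card.choose M : ℝ) * m1 ≤ 2 * (U.card.choose M : ℝ) * (n * d ^ 2) := by gcongr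
  refine ⟨?_, ?_, ?_⟩
  · have t1 : ∀ i, (((U.powersetCard M).filter (fun S => d + L ≤ ((S ∩ A i).card : ℝ))).card : ℝ) ≤ (U.card.choose M : ℝ) * (1 / (n : ℝ) ^ 2) :=
      fun i => (upper_tail (B.sub i) (by omega) u0 d0 L0 (hp i)).trans (by gcongr)
    have t2 : ∀ i, (((U.powersetCard M).filter (fun S => ((S ∩ A i).card : ℝ) ≤ d - L)).card : ℝ) ≤ (U.card.choose M : ℝ) * (1 / (n : ℝ) ^ 2) :=
      fun i => (lower_tail (B.sub i) (by omega) u0 d0 L0 (hp i)).trans (by gcongr)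
    have t3 : (((U.powersetCard M).filter (fun S => 2 * n * d < ∑ i, (((S ∩ A i).card : ℝ) - d) ^ 2)).card : ℝ) ≤ (U.card.choose M : ℝ) * (2 / n) := by
      have := markov (U.powersetCard M) (fun S => (YY U (_root_.wt A) S - m1) ^ 2) (fun S _ => sq_nonneg _) (fun S => 2 * n * d < ∑ i, (((S ∩ A i).card : ℝ) - d) ^ 2) (r := (n * d) ^ 2) ?_ (v2.trans m2)
      · rw [← le_div_iff₀ (by positivity)] at this
        refine this.trans (le_of_eq ?_)
        field_simp
      · intro S hS h
        rw [hQ S hS] at h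
        have : (0 : ℝ) ≤ n * d := by positivity
        exact pow_le_pow_left₀ this (by linarith) 2
    have sub : (U.powersetCard M).filter (fun S => ¬ ((∀ i, |((S ∩ A i).card : ℝ) - d| ≤ L) ∧ ∑ i, (((S ∩ A i).card : ℝ) - d) ^ 2 ≤ 2 * n * d)) ⊆
        (univ.biUnion fun i => (U.powersetCard M).filter (fun S => d + L ≤ ((S ∩ A i).card : ℝ)) ∪ (U.powersetCard M).filter (fun S => ((S ∩ A i).card : ℝ) ≤ d - L)) ∪
        (U.powersetCard M).filter (fun S => 2 * n * d < ∑ i, (((S ∩ A i).card : ℝ) - d) ^ 2) := by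
      intro S hS
      rw [mem_filter] at hS
      obtain ⟨hS, hn⟩ := hS
      simp only [mem_union, mem_biUnion, mem_filter, mem_univ, true_and, hS]
      by_contra hcon
      push Not at hcon
      apply hn
      refine ⟨fun i => ?_, hcon.2⟩
      have := hcon.1 i
      rw [abs_le]; constructor <;> linarith
    have c1 := (card_le_card sub).trans (card_union_le _ _)
    have c2 : ((univ.biUnion fun i => (U.powersetCard M).filter (fun S => d + L ≤ ((S ∩ A i).card : ℝ)) ∪ (U.powersetCard M).filter (fun S => ((S ∩ A i).card : ℝ) ≤ d - L)).card : ℝ) ≤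
        ∑ i : Fin n, 2 * ((U.card.choose M : ℝ) * (1 / (n : ℝ) ^ 2)) := by
      refine le_trans (Nat.cast_le.2 card_biUnion_le) ?_
      push_cast
      apply sum_le_sum
      intro i _
      have h1 := t1 i; have h2 := t2 i
      have h3 := card_union_le ((U.powersetCard M).filter (fun S => d + L ≤ ((S ∩ A i).card : ℝ))) ((U.powersetCard M).filter (fun S => ((S ∩ A i).card : ℝ) ≤ d - L))
      have h4 : ((((U.powersetCard M).filter (fun S => d + L ≤ ((S ∩ A i).card : ℝ))) ∪ ((U.powersetCard M).filter (fun S => ((S ∩ A i).card : ℝ) ≤ d - L))).card : ℝ) ≤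
        ((U.powersetCard M).filter (fun S => d + L ≤ ((S ∩ A i).card : ℝ))).card + ((U.powersetCard M).filter (fun S => ((S ∩ A i).card : ℝ) ≤ d - L)).card := by exact_mod_cast h3
      linarith
    have c3 : ∑ i : Fin n, 2 * ((U.card.choose M : ℝ) * (1 / (n : ℝ) ^ 2)) = (U.card.choose M : ℝ) * (2 / n) := by
      simp; field_simp
    rw [c3] at c2
    have c1' := Nat.cast_le (α := ℝ).2 c1
    push_cast at c1'
    have : (U.card.choose M : ℝ) * (4 / n) = (U.card.choose M : ℝ) * (2 / n) + (U.card.choose M : ℝ) * (2 / n) := by ring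
    rw [this]
    exact c1'.trans (add_le_add c2 t3)
  · have e : ∑ S ∈ U.powersetCard M, ∑ i, (((S ∩ A i).card : ℝ) - d) ^ 2 = ∑ S ∈ U.powersetCard M, (YY U (_root_.wt A) S + (- n * d ^ 2 + n * d)) := by
      apply sum_congr rfl; intro S hS; rw [hQ S hS]; ring
    rw [e, sum_add_distrib, v1, sum_const, card_powersetCard, nsmul_eq_mul]; ring
  · refine le_trans (le_of_eq ?_) (v2.trans m2)
    apply sum_congr rfl; intro S hS; rw [hQ S hS]; ring
end

def UG (n : ℕ) : Finset (Sym2 (Fin n)) := univ.filter (fun e => ¬ e.IsDiag)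
def AG (n : ℕ) (i : Fin n) : Finset (Sym2 (Fin n)) := (UG n).filter (fun e => i ∈ e)

lemma card_UG (n : ℕ) : (UG n).card = n.choose 2 := by
  have := Sym2.card_subtype_not_diag (α := Fin n)
  rw [Fintype.card_subtype] at this
  simpa [UG] using this

lemma BL_G (n : ℕ) : BL (UG n) (n - 1) 2 (AG n) where
  sub i := filter_subset _ _
  card i := by
    have : AG n i = (univ.erase i).image (fun j => s(i, j)) := by
      ext e
      induction e using Sym2.ind with
      | _ a b =>
      simp only [AG, UG, mem_filter, mem_univ, true_and, Sym2.mk_isDiag_iff, Sym2.mem_iff, mem_image, mem_erase, and_true, Sym2.eq_iff]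
      constructor
      · rintro ⟨h1, rfl | rfl⟩
        · exact ⟨b, Ne.symm h1, by simp⟩
        · exact ⟨a, h1, by simp⟩
      · rintro ⟨j, hj, ⟨rfl, rfl⟩ | ⟨rfl, rfl⟩⟩
        · exact ⟨Ne.symm hj, by simp⟩
        · exact ⟨hj, by simp⟩
    rw [this, card_image_of_injective, card_erase_of_mem (mem_univ _), card_univ, Fintype.card_fin]
    intro a b h
    exact Sym2.congr_right.1 h
  cov x hx := by
    induction x using Sym2.ind with
    | _ a b =>
    have hx' := hx
    simp only [UG, mem_filter, mem_univ, true_and, Sym2.mk_isDiag_iff] at hx'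
    have : univ.filter (fun i => s(a, b) ∈ AG n i) = {a, b} := by
      ext i
      simp only [AG, mem_filter, mem_univ, true_and, hx, Sym2.mem_iff, mem_insert, mem_singleton]
    rw [this, card_pair hx']
  one x y hxy := by
    rw [card_le_one]
    intro i hi j hj
    simp only [AG, mem_filter, mem_univ, true_and] at hi hj
    by_contra hij
    exact hxy (Sym2.eq_of_ne_mem hij hi.1.2 hj.1.2 hi.2.2 hj.2.2)

lemma Graphs_card (n m : ℕ) : (Graphs n).filter (fun E => E.card = m) = (UG n).powersetCard m := by
  ext E
  simp only [Graphs, UG, mem_filter, mem_univ, true_and, mem_powersetCard]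
  refine and_congr_left fun _ => ?_
  constructor
  · intro h e he; simpa using h e he
  · intro h e he; simpa using h he

lemma deg_AG {n : ℕ} {E : Finset (Sym2 (Fin n))} (hE : E ⊆ UG n) (i : Fin n) : deg E i = (E ∩ AG n i).card := by
  unfold deg AG
  congr 1
  ext e
  simp only [mem_filter, mem_inter]
  have := @hE e
  tauto

lemma prG_eq {n m : ℕ} {D : Fin n → ℕ} :
    prG n m D = ((((UG n).powersetCard m).filter (fun E => (fun i => (E ∩ AG n i).card) = D)).card : ℝ) / ((UG n).card.choose m : ℝ) := by
  unfold prG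
  rw [Graphs_card, card_powersetCard]
  congr 3
  ext E
  rw [← Graphs_card]
  simp only [mem_filter, and_assoc]
  refine and_congr_right fun hE => and_congr_right fun hc => ?_
  have hE' : E ∈ (UG n).powersetCard m := by rw [← Graphs_card, mem_filter]; exact ⟨hE, hc⟩
  have := (mem_powersetCard.1 hE').1
  rw [funext_iff]
  simp only [deg_AG this]

lemma prG_NN {n m : ℕ} {D : Fin n → ℕ} (hD : ∑ i, D i = 2 * m) :
    prG n m D = NN (fun i => (D i : ℤ)) / ((UG n).card.choose m : ℝ) := by
  unfold prG NN
  rw [Graphs_card, card_powersetCard]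
  congr 3
  ext E
  rw [mem_GS]
  simp only [mem_filter]
  refine and_congr_right fun hE => ?_
  constructor
  · rintro ⟨_, h⟩ i; exact_mod_cast h i
  · intro h
    have h' : ∀ i, deg E i = D i := fun i => by exact_mod_cast h i
    refine ⟨?_, h'⟩
    have := sum_deg hE
    rw [sum_congr rfl (fun i _ => h' i), hD] at this
    omega

def AB (n : ℕ) (i : Fin n) : Finset (Fin n × Fin (n - 1)) := univ.filter (fun p => p.1 = i)

lemma BL_B (n : ℕ) : BL (univ : Finset (Fin n × Fin (n - 1))) (n - 1) 1 (AB n) where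
  sub i := subset_univ _
  card i := by
    have : AB n i = (univ : Finset (Fin (n - 1))).image (fun j => (i, j)) := by
      ext ⟨a, b⟩; simp [AB, eq_comm]
    rw [this, card_image_of_injective, card_univ, Fintype.card_fin]
    intro a b h; simpa using h
  cov x _ := by
    have : univ.filter (fun i => x ∈ AB n i) = {x.1} := by ext i; simp [AB, eq_comm]
    rw [this, card_singleton]
  one x y _ := by
    rw [card_le_one]
    intro i hi j hj
    simp only [AB, mem_filter, mem_univ, true_and] at hi hj
    rw [← hi.1, ← hj.1]

lemma row_card {n : ℕ} (S : Finset (Fin n × Fin (n - 1))) (i : Fin n) :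
    (S ∩ AB n i).card = (univ.filter (fun j => (i, j) ∈ S)).card := by
  have : S ∩ AB n i = (univ.filter (fun j => (i, j) ∈ S)).image (fun j => (i, j)) := by
    ext ⟨a, b⟩
    simp only [mem_inter, AB, mem_filter, mem_univ, true_and, mem_image, Prod.mk.injEq]
    constructor
    · rintro ⟨h, rfl⟩; exact ⟨b, h, rfl, rfl⟩
    · rintro ⟨j, h, rfl, rfl⟩; exact ⟨h, rfl⟩
  rw [this, card_image_of_injective]
  intro a b h; simpa using h

lemma prB_eq {n m : ℕ} {D : Fin n → ℕ} (hD : ∑ i, D i = 2 * m) :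
    prB n m D = ((((univ : Finset (Fin n × Fin (n - 1))).powersetCard (2 * m)).filter (fun S => (fun i => (S ∩ AB n i).card) = D)).card : ℝ) / ((univ : Finset (Fin n × Fin (n - 1))).card.choose (2 * m) : ℝ) := by
  unfold prB
  rw [if_pos hD]
  have hu : (univ : Finset (Fin n × Fin (n - 1))).card = n * (n - 1) := by simp
  rw [hu]
  congr 1
  have : (((univ : Finset (Fin n × Fin (n - 1))).powersetCard (2 * m)).filter (fun S => (fun i => (S ∩ AB n i).card) = D)).card =
      (Fintype.piFinset fun i => (univ : Finset (Fin (n - 1))).powersetCard (D i)).card := by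
    refine card_nbij' (fun S i => univ.filter (fun j => (i, j) ∈ S)) (fun f => univ.filter (fun p => p.2 ∈ f p.1)) ?_ ?_ ?_ ?_
    · intro S hS
      simp only [coe_filter, Set.mem_ofPred_eq, funext_iff, row_card] at hS
      simp only [mem_coe, Fintype.mem_piFinset, mem_powersetCard]
      exact fun i => ⟨subset_univ _, hS.2 i⟩
    · intro f hf
      simp only [mem_coe, Fintype.mem_piFinset, mem_powersetCard] at hf
      simp only [coe_filter, Set.mem_ofPred_eq, funext_iff, row_card, mem_powersetCard]
      have h1 : ∀ i, (univ.filter (fun j => (i, j) ∈ univ.filter (fun p : Fin n × Fin (n - 1) => p.2 ∈ f p.1))).card = D i := by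
        intro i; rw [← (hf i).2]; congr 1; ext j; simp
      refine ⟨⟨subset_univ _, ?_⟩, h1⟩
      have h2 := (BL_B n).sumD (subset_univ (univ.filter (fun p : Fin n × Fin (n - 1) => p.2 ∈ f p.1)))
      simp only [row_card, h1] at h2
      have h3 : (∑ i, (D i : ℝ)) = ((2 * m : ℕ) : ℝ) := by exact_mod_cast hD
      rw [h3] at h2
      simp only [Nat.cast_one, one_mul] at h2
      exact_mod_cast h2.symm
    · intro S _; ext ⟨a, b⟩; simp
    · intro f _; ext i j; simp
  rw [this, Fintype.card_piFinset]
  push_cast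
  apply prod_congr rfl
  intro i _
  rw [card_powersetCard, card_univ, Fintype.card_fin]

lemma fib_sum {β γ : Type} [DecidableEq γ] (P : Finset β) (Dm : β → γ) (TS : Finset γ) (f : γ → ℝ) :
    ∑ D ∈ TS, ((P.filter (fun S => Dm S = D)).card : ℝ) * f D = ∑ S ∈ P.filter (fun S => Dm S ∈ TS), f (Dm S) := by
  rw [← sum_fiberwise_of_maps_to (s := P.filter (fun S => Dm S ∈ TS)) (t := TS) (g := Dm) (fun S hS => (mem_filter.1 hS).2)]
  apply sum_congr rfl
  intro D hD
  rw [← nsmul_eq_mul, ← sum_const]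
  apply sum_congr
  · ext S; simp only [mem_filter]
    constructor
    · rintro ⟨h1, h2⟩; exact ⟨⟨h1, h2 ▸ hD⟩, h2⟩
    · rintro ⟨⟨h1, _⟩, h2⟩; exact ⟨h1, h2⟩
  · intro S hS; rw [(mem_filter.1 hS).2]

lemma lip {g : ℝ} (g0 : 0 ≤ g) : |Real.exp (1 / 4 - g ^ 2 / 4) - 1| ≤ |g - 1| := by
  rcases le_total 1 g with h | h
  · rw [abs_of_nonneg (by linarith : 0 ≤ g - 1), abs_le]
    have h1 : Real.exp (1 / 4 - g ^ 2 / 4) ≤ 1 := Real.exp_le_one_iff.2 (by nlinarith)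
    constructor
    · rcases le_total g 3 with h3 | h3
      · have := Real.add_one_le_exp (1 / 4 - g ^ 2 / 4)
        nlinarith
      · have := Real.exp_pos (1 / 4 - g ^ 2 / 4); linarith
    · linarith
  · rw [abs_of_nonpos (by linarith : g - 1 ≤ 0), abs_le]
    have h1 : 1 ≤ Real.exp (1 / 4 - g ^ 2 / 4) := Real.one_le_exp (by nlinarith)
    constructor
    · linarith
    · have y0 : 0 ≤ 1 / 4 - g ^ 2 / 4 := by nlinarith
      have := Real.add_one_le_exp (-(1 / 4 - g ^ 2 / 4))
      have e1 : Real.exp (1 / 4 - g ^ 2 / 4) * Real.exp (-(1 / 4 - g ^ 2 / 4)) = 1 := by rw [← Real.exp_add]; simp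
      have e2 := mul_le_mul_of_nonneg_left this (Real.exp_pos (1 / 4 - g ^ 2 / 4)).le
      rw [e1] at e2
      generalize Real.exp (1 / 4 - g ^ 2 / 4) = E at *
      nlinarith

lemma norm_final {γ : Type} (TS : Finset γ) (a φ : γ → ℝ) {x al be : ℝ} (x0 : 0 ≤ x) (x1 : x ≤ 1 / 2) (al0 : 0 ≤ al) (be0 : 0 ≤ be) (be1 : be ≤ 1 / 4)
    (ha : ∀ D ∈ TS, 0 ≤ a D) (hφ : ∀ D ∈ TS, 0 < φ D) (h : ∀ D ∈ TS, ∀ D' ∈ TS, a D * φ D' ≤ Real.exp x * (a D' * φ D))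
    (ha1 : 1 - al ≤ ∑ D ∈ TS, a D) (ha2 : ∑ D ∈ TS, a D ≤ 1) (hp : |∑ D ∈ TS, φ D - 1| ≤ be) {D : γ} (hD : D ∈ TS) :
    |a D / φ D - 1| ≤ 3 * x + al + 2 * be := by
  have φ0 := hφ D hD
  have s1 : a D * ∑ D' ∈ TS, φ D' ≤ Real.exp x * (∑ D' ∈ TS, a D') * φ D := by
    rw [mul_sum, mul_sum, sum_mul]
    apply sum_le_sum; intro D' hD'
    rw [mul_assoc]; exact h D hD D' hD'
  have s2 : (∑ D' ∈ TS, a D') * φ D ≤ Real.exp x * (a D * ∑ D' ∈ TS, φ D') := by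
    rw [mul_sum, mul_sum, sum_mul]
    apply sum_le_sum; intro D' hD'
    exact h D' hD' D hD
  obtain ⟨R, hR⟩ : ∃ R, R = a D / φ D := ⟨_, rfl⟩
  have hR' : a D = R * φ D := by rw [hR]; field_simp
  have R0 : 0 ≤ R := by rw [hR]; exact div_nonneg (ha D hD) φ0.le
  rw [← hR]
  rw [hR'] at s1 s2
  obtain ⟨p1, p2⟩ := abs_le.1 hp
  generalize ∑ D' ∈ TS, φ D' = s at *
  generalize ∑ D' ∈ TS, a D' = q at *
  have t1 : R * s ≤ Real.exp x * q := by
    refine le_of_mul_le_mul_right ?_ φ0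
    linarith
  have t2 : q ≤ Real.exp x * (R * s) := by
    refine le_of_mul_le_mul_right ?_ φ0
    linarith
  have e1 : Real.exp x ≤ 1 + 2 * x := by
    have := Real.add_one_le_exp (-x)
    have e1 : Real.exp x * Real.exp (-x) = 1 := by rw [← Real.exp_add]; simp
    have e2 := mul_le_mul_of_nonneg_left this (Real.exp_pos x).le
    rw [e1] at e2
    have := Real.exp_pos x
    nlinarith
  have e2 : 1 - x ≤ Real.exp (-x) := by have := Real.add_one_le_exp (-x); linarith
  have e3 : Real.exp (-x) * q ≤ R * s := by
    have := mul_le_mul_of_nonneg_left t2 (Real.exp_pos (-x)).le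
    rw [← mul_assoc, ← Real.exp_add] at this
    simpa using this
  have ex0 := Real.exp_pos x
  rw [abs_le]; constructor
  · by_contra hcon
    push Not at hcon
    have u1 : R * s ≤ R * (1 + be) := by gcongr; linarith
    have u2 : (1 - x) * (1 - al) ≤ Real.exp (-x) * q := by
      by_cases hal : al ≤ 1
      · apply mul_le_mul e2 ha1 (by linarith) (Real.exp_pos _).le
      · have : R < 0 := by linarith
        linarith
    nlinarith [mul_nonneg x0 al0]
  · have u1 : R * (1 - be) ≤ R * s := by gcongr; linarith
    have u2 : Real.exp x * q ≤ (1 + 2 * x) * 1 := by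
      calc _ ≤ Real.exp x * 1 := by gcongr
        _ ≤ _ := by linarith
    have : (R - 1 - (3 * x + al + 2 * be)) * (1 - be) ≤ 0 := by nlinarith [mul_nonneg x0 be0, mul_nonneg al0 be0]
    have : R - 1 - (3 * x + al + 2 * be) ≤ 0 := by
      by_contra hc; push Not at hc
      have := mul_pos hc (by linarith : 0 < 1 - be); linarith
    linarith

section

def TP (n m : ℕ) (d L : ℝ) (D : Fin n → ℕ) : Prop :=
  ∑ i, D i = 2 * m ∧ (∀ i, |(D i : ℝ) - d| ≤ L) ∧ ∑ i, ((D i : ℝ) - d) ^ 2 ≤ 2 * n * d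

open Classical in
def TS (n m : ℕ) (d L : ℝ) : Finset (Fin n → ℕ) :=
  (Fintype.piFinset fun _ : Fin n => range (2 * m + 1)).filter (TP n m d L)

lemma mem_TS {n m : ℕ} {d L : ℝ} {D : Fin n → ℕ} : D ∈ TS n m d L ↔ TP n m d L D := by
  classical
  unfold TS
  rw [mem_filter, Fintype.mem_piFinset]
  refine and_iff_right_of_imp fun h i => ?_
  rw [mem_range, Nat.lt_succ_iff, ← h.1]
  exact single_le_sum (f := D) (fun _ _ => Nat.zero_le _) (mem_univ i)

lemma TP.tt {n m : ℕ} {d L : ℝ} {D : Fin n → ℕ} (hd : n * d = 2 * m) (h : TP n m d L D) : TT n d L (fun i => (D i : ℤ)) where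
  nn i := by positivity
  dev i := by simpa using h.2.1 i
  sm := by
    have : (∑ i, (D i : ℝ)) = ((2 * m : ℕ) : ℝ) := by exact_mod_cast h.1
    push_cast at this ⊢
    rw [this, hd]
  ev := by
    have : (∑ i, (D i : ℤ)) = ((2 * m : ℕ) : ℤ) := by exact_mod_cast h.1
    rw [this]; push_cast; exact even_two_mul _
  qq := by simpa using h.2.2

def gQ (n : ℕ) (d lam : ℝ) (D : Fin n → ℕ) : ℝ := lam / d ^ 2 * ∑ i, ((D i : ℝ) - d) ^ 2
def Phi (n m : ℕ) (d lam : ℝ) (D : Fin n → ℕ) : ℝ := prB n m D * Real.exp (1 / 4 - gQ n d lam D ^ 2 / 4)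

lemma gQ_ep {n : ℕ} {d lam : ℝ} {D : Fin n → ℕ} : gQ n d lam D = lam * ∑ i, ep d (fun i => (D i : ℤ)) i ^ 2 := by
  unfold gQ ep
  simp only [div_pow, ← sum_div, Int.cast_natCast]
  ring

lemma Phi_Psi {n m : ℕ} {d lam : ℝ} {D : Fin n → ℕ} (hD : ∑ i, D i = 2 * m) :
    Phi n m d lam D = Real.exp (1 / 4) / ((n * (n - 1)).choose (2 * m) : ℝ) * Psi n d lam (fun i => (D i : ℤ)) := by
  unfold Phi prB Psi
  rw [if_pos hD, ← gQ_ep, sub_eq_add_neg, Real.exp_add]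
  simp only [Int.toNat_natCast, neg_div]
  ring

/-- splitting into good and bad -/
lemma good_bad {β : Type} (P : Finset β) (good : β → Prop) [DecidablePred good] (F : β → ℝ) {C a b : ℝ} (C0 : 0 < C) (hC : (P.card : ℝ) = C)
    (hb : ((P.filter (fun S => ¬ good S)).card : ℝ) ≤ C * a) (hF : ∑ S ∈ P, |F S - 1| ≤ C * b) :
    |(∑ S ∈ P.filter good, F S) / C - 1| ≤ b + a := by
  have e : (∑ S ∈ P.filter good, F S) / C - 1 = (∑ S ∈ P.filter good, (F S - 1) - ((P.filter (fun S => ¬ good S)).card : ℝ)) / C := by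
    have h1 : ((P.filter good).card : ℝ) + ((P.filter (fun S => ¬ good S)).card : ℝ) = C := by
      rw [← hC]; exact_mod_cast card_filter_add_card_filter_not (s := P) good
    rw [sum_sub_distrib, sum_const, nsmul_eq_mul, mul_one]
    field_simp
    linarith
  rw [e, abs_div, abs_of_pos C0, div_le_iff₀ C0]
  refine (abs_sub _ _).trans ?_
  have h2 : |∑ S ∈ P.filter good, (F S - 1)| ≤ C * b := by
    refine (abs_sum_le_sum_abs _ _).trans (le_trans ?_ hF)
    exact sum_le_sum_of_subset_of_nonneg (filter_subset _ _) (fun _ _ _ => abs_nonneg _)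
  rw [abs_of_nonneg (Nat.cast_nonneg _ : (0 : ℝ) ≤ ((P.filter (fun S => ¬ good S)).card : ℝ))]
  linarith

lemma BL.TPiff {α : Type} [DecidableEq α] {U : Finset α} {n b hh M m : ℕ} {A : Fin n → Finset α} (B : BL U b hh A) (hM : hh * M = 2 * m) {d L : ℝ}
    {S : Finset α} (hS : S ∈ U.powersetCard M) :
    (fun i => (S ∩ A i).card) ∈ TS n m d L ↔ ((∀ i, |((S ∩ A i).card : ℝ) - d| ≤ L) ∧ ∑ i, (((S ∩ A i).card : ℝ) - d) ^ 2 ≤ 2 * n * d) := by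
  rw [mem_TS]; unfold TP
  apply and_iff_right
  obtain ⟨h1, h2⟩ := mem_powersetCard.1 hS
  have := B.sumD h1
  rw [h2] at this
  rw [← hM]
  exact_mod_cast this

lemma abs_g {g n : ℝ} (n0 : 0 < n) : |g - 1| ≤ (Real.sqrt n * (g - 1) ^ 2 + 1 / Real.sqrt n) / 2 := by
  have s0 := Real.sqrt_pos.2 n0
  have : 0 ≤ (Real.sqrt n * |g - 1| - 1) ^ 2 / Real.sqrt n := by positivity
  have e : (Real.sqrt n * |g - 1| - 1) ^ 2 / Real.sqrt n = Real.sqrt n * (g - 1) ^ 2 + 1 / Real.sqrt n - 2 * |g - 1| := by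
    rw [← sq_abs (g - 1)]; field_simp; ring
  linarith

variable {n : ℕ} {d e μ ν h lam L : ℝ} {J : ℕ}

lemma m_small (c : CX n d e μ ν h lam L J) (hn : 30000 ≤ n) {m : ℕ} (hd : n * d = 2 * m) :
    3 ≤ m ∧ m + 1 ≤ n.choose 2 ∧ 2 * m + 1 ≤ n * (n - 1) := by
  have hn' : (30000 : ℝ) ≤ n := by exact_mod_cast hn
  have d1 := c.d1
  have hdμ := c.hdμ
  have μ1 := c.toPR.μ1
  have h3 : (3 : ℝ) ≤ m := by nlinarith
  have h4 : 4 * (m : ℝ) ≤ n * ((n : ℝ) - 1) := by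
    have : d ≤ ((n : ℝ) - 1) / 2 := by rw [← hdμ]; nlinarith
    nlinarith
  have h4' : 4 * m ≤ n * (n - 1) := by
    have : ((4 * m : ℕ) : ℝ) ≤ ((n * (n - 1) : ℕ) : ℝ) := by push_cast [Nat.cast_sub (show 1 ≤ n by omega)]; exact h4
    exact_mod_cast this
  have h3' : 3 ≤ m := by exact_mod_cast h3
  refine ⟨h3', ?_, by omega⟩
  rw [Nat.choose_two_right]; omega

lemma sumG (c : CX n d e μ ν h lam L J) (hn : 30000 ≤ n) {m : ℕ} (hd : n * d = 2 * m)
    (hL : Real.exp (-(L ^ 2 / (4 * (d + L)))) ≤ 1 / (n : ℝ) ^ 2) :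
    1 - 4 / n ≤ ∑ D ∈ TS n m d L, prG n m D ∧ ∑ D ∈ TS n m d L, prG n m D ≤ 1 := by
  obtain ⟨m1, m2, m3⟩ := m_small c hn hd
  have hn' : (30000 : ℝ) ≤ n := by exact_mod_cast hn
  have L0 := c.L0
  have u : ((UG n).card : ℝ) = n * (n - 1) / 2 := by rw [card_UG, Nat.cast_choose_two]
  have d1 := c.d1
  have main := ((BL_G n).main (M := m) (d := d) (L := L) (m1 := n * d * (n * d - 2) / (n + 1)) (by omega) (by norm_num) m1 (by rw [card_UG]; exact m2) (by omega) c.d0 (by linarith)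
    (by rw [hd]; norm_num) hL (by
      rw [u]; push_cast [Nat.cast_sub (show 1 ≤ n by omega)]
      rw [hd]; field_simp; ring) (by
      rw [div_le_iff₀ (by linarith)]
      have : 0 ≤ n * d := by positivity
      nlinarith)).1
  have C0 : (0 : ℝ) < (UG n).card.choose m := by
    exact_mod_cast Nat.choose_pos (by rw [card_UG]; omega)
  have e : ∑ D ∈ TS n m d L, prG n m D = (∑ S ∈ ((UG n).powersetCard m).filter (fun S => (fun i => (S ∩ AG n i).card) ∈ TS n m d L), (1 : ℝ)) / ((UG n).card.choose m : ℝ) := by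
    rw [← fib_sum ((UG n).powersetCard m) (fun S => (fun i => (S ∩ AG n i).card)) (TS n m d L) (fun _ => 1), sum_div]
    refine sum_congr rfl fun D hD => ?_
    rw [prG_eq, mul_one]
  have e2 : ((UG n).powersetCard m).filter (fun S => (fun i => (S ∩ AG n i).card) ∈ TS n m d L) = ((UG n).powersetCard m).filter (fun S => ((∀ i, |((S ∩ AG n i).card : ℝ) - d| ≤ L) ∧ ∑ i, (((S ∩ AG n i).card : ℝ) - d) ^ 2 ≤ 2 * n * d)) := by
    apply filter_congr
    intro S hS
    exact (BL_G n).TPiff (m := m) rfl hS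
  constructor
  · have := good_bad ((UG n).powersetCard m) (fun S => ((∀ i, |((S ∩ AG n i).card : ℝ) - d| ≤ L) ∧ ∑ i, (((S ∩ AG n i).card : ℝ) - d) ^ 2 ≤ 2 * n * d)) (fun _ => 1) C0 (by rw [card_powersetCard]) main (b := 0) (by simp)
    rw [← e2, ← e] at this
    have := (abs_le.1 this).1
    linarith
  · rw [e, div_le_one C0, sum_const, nsmul_eq_mul, mul_one]
    have := card_filter_le ((UG n).powersetCard m) (fun S => (fun i => (S ∩ AG n i).card) ∈ TS n m d L)
    rw [card_powersetCard] at this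
    exact_mod_cast this

lemma kq {n d μ lam : ℝ} (hn : 3 ≤ n) (d0 : 0 < d) (hμ : (n - 1) * μ = d) (hμ1 : μ < 1) (hlam : lam * (1 - μ) = μ) :
    lam / d ^ 2 * ((n - 2) * (n * d) * (n * d - 1) / (n ^ 2 - n - 1) - n * d ^ 2 + n * d) - 1 = 1 / (n ^ 2 - n - 1) := by
  have h1 : n ^ 2 - n - 1 ≠ 0 := by nlinarith
  have h2 : (1 - μ) ≠ 0 := by linarith
  have hl : lam = μ / (1 - μ) := by rw [eq_div_iff h2]; exact hlam
  have h3 : 0 < μ := by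
    by_contra hc; push Not at hc; nlinarith
  have h4 : n - 1 ≠ 0 := by linarith
  have h5 : (n - 2) * (n * d) * (n * d - 1) / (n ^ 2 - n - 1) - n * d ^ 2 + n * d = n * d * ((n - 1) ^ 2 * (1 - μ)) / (n ^ 2 - n - 1) := by
    rw [eq_div_iff h1, add_mul, sub_mul, div_mul_cancel₀ _ h1, ← hμ]; ring
  rw [h5, hl]
  have h6 : μ / (1 - μ) / d ^ 2 * (n * d * ((n - 1) ^ 2 * (1 - μ)) / (n ^ 2 - n - 1)) = n * (n - 1) / (n ^ 2 - n - 1) := by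
    have : μ / (1 - μ) / d ^ 2 * (n * d * ((n - 1) ^ 2 * (1 - μ))) = n * (n - 1) := by
      rw [← hμ]; field_simp
    rw [← mul_div_assoc, this]
  rw [h6, eq_div_iff h1, sub_mul, div_mul_cancel₀ _ h1]; ring

lemma varB {n C k q : ℝ} {β : Type} (P : Finset β) (Q : β → ℝ) (n0 : 3 ≤ n) (C0 : 0 < C) (hC : (P.card : ℝ) = C)
    {d : ℝ} (h1 : ∑ S ∈ P, (Q S - q) ^ 2 ≤ 2 * C * (n * d ^ 2)) (hk : k ^ 2 * (n * d ^ 2) ≤ 16 / n) (hq : |k * q - 1| ≤ 1 / n) :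
    ∑ S ∈ P, |k * Q S - 1| ≤ C * (34 / Real.sqrt n) := by
  have np : 0 < n := by linarith
  have s0 := Real.sqrt_pos.2 np
  have ss := Real.sq_sqrt np.le
  have h2 : ∑ S ∈ P, (k * Q S - 1) ^ 2 ≤ C * (66 / n) := by
    calc ∑ S ∈ P, (k * Q S - 1) ^ 2 ≤ ∑ S ∈ P, (2 * k ^ 2 * (Q S - q) ^ 2 + 2 * (k * q - 1) ^ 2) := by
          apply sum_le_sum; intro S _
          nlinarith [sq_nonneg (k * (Q S - q) - (k * q - 1))]
      _ = 2 * k ^ 2 * ∑ S ∈ P, (Q S - q) ^ 2 + C * (2 * (k * q - 1) ^ 2) := by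
          rw [sum_add_distrib, ← mul_sum, sum_const, nsmul_eq_mul, hC]
      _ ≤ 2 * k ^ 2 * (2 * C * (n * d ^ 2)) + C * (2 * (1 / n) ^ 2) := by
          rw [← sq_abs (k * q - 1)]
          gcongr
      _ = C * (4 * (k ^ 2 * (n * d ^ 2)) + 2 * (1 / n) ^ 2) := by ring
      _ ≤ C * (4 * (16 / n) + 2 * (1 / n)) := by
          have : (1 / n) ^ 2 ≤ 1 / n := by
            rw [sq]; apply mul_le_of_le_one_left (by positivity)
            rw [div_le_one np]; linarith
          gcongr
      _ = _ := by ring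
  calc ∑ S ∈ P, |k * Q S - 1| ≤ ∑ S ∈ P, (Real.sqrt n * (k * Q S - 1) ^ 2 + 1 / Real.sqrt n) / 2 := sum_le_sum fun S _ => abs_g np
    _ = Real.sqrt n / 2 * ∑ S ∈ P, (k * Q S - 1) ^ 2 + C * (1 / Real.sqrt n / 2) := by
        rw [← sum_div, sum_add_distrib, ← mul_sum, sum_const, nsmul_eq_mul, hC]; ring
    _ ≤ Real.sqrt n / 2 * (C * (66 / n)) + C * (1 / Real.sqrt n / 2) := by gcongr
    _ = C * (33.5 / Real.sqrt n) := by
        rw [← ss]; generalize Real.sqrt n = s at *; field_simp; rw [Real.sqrt_sq s0.le]; field_simp; norm_num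
    _ ≤ _ := by gcongr; norm_num

lemma sumB (c : CX n d e μ ν h lam L J) (hn : 30000 ≤ n) {m : ℕ} (hd : n * d = 2 * m)
    (hL : Real.exp (-(L ^ 2 / (4 * (d + L)))) ≤ 1 / (n : ℝ) ^ 2) :
    |∑ D ∈ TS n m d L, Phi n m d lam D - 1| ≤ 34 / Real.sqrt n + 4 / n := by
  obtain ⟨m1, m2, m3⟩ := m_small c hn hd
  have hn' : (30000 : ℝ) ≤ n := by exact_mod_cast hn
  have L0 := c.L0
  have hu : (univ : Finset (Fin n × Fin (n - 1))).card = n * (n - 1) := by simp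
  have u : ((univ : Finset (Fin n × Fin (n - 1))).card : ℝ) = n * (n - 1) := by rw [hu]; push_cast [Nat.cast_sub (show 1 ≤ n by omega)]; ring
  have d1 := c.d1
  have hμ1 := c.toPR.μ1
  have hdμ := c.hdμ
  have hp : (0 : ℝ) < (n : ℝ) ^ 2 - n - 1 := by nlinarith
  have main := ((BL_B n).main (M := 2 * m) (d := d) (L := L) (m1 := (n - 2) * (n * d) * (n * d - 1) / ((n : ℝ) ^ 2 - n - 1)) (by omega) (by norm_num) (by omega) (by rw [hu]; exact m3) (by omega) c.d0 (by linarith)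
    (by rw [hd]; norm_num) hL (by
      rw [u]; push_cast [Nat.cast_sub (show 1 ≤ n by omega)]
      rw [hd, div_mul_eq_mul_div, div_eq_iff hp.ne']; ring) (by
      rw [div_le_iff₀ hp]
      have h0 : 0 ≤ n * d := by positivity
      have : ((n : ℝ) - 2) * (n * d - 1) ≤ d * ((n : ℝ) ^ 2 - n - 1) := by nlinarith
      nlinarith [mul_le_mul_of_nonneg_left this h0]))
  obtain ⟨main, _, mainv⟩ := main
  have C0 : (0 : ℝ) < (univ : Finset (Fin n × Fin (n - 1))).card.choose (2 * m) := by
    exact_mod_cast Nat.choose_pos (by rw [hu]; omega)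
  have e : ∑ D ∈ TS n m d L, Phi n m d lam D = (∑ S ∈ ((univ : Finset (Fin n × Fin (n - 1))).powersetCard (2 * m)).filter (fun S => (fun i => (S ∩ AB n i).card) ∈ TS n m d L), Real.exp (1 / 4 - gQ n d lam (fun i => (S ∩ AB n i).card) ^ 2 / 4)) / ((univ : Finset (Fin n × Fin (n - 1))).card.choose (2 * m) : ℝ) := by
    rw [← fib_sum ((univ : Finset (Fin n × Fin (n - 1))).powersetCard (2 * m)) (fun S => (fun i => (S ∩ AB n i).card)) (TS n m d L) (fun D => Real.exp (1 / 4 - gQ n d lam D ^ 2 / 4)), sum_div]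
    refine sum_congr rfl fun D hD => ?_
    rw [Phi, prB_eq (mem_TS.1 hD).1]; ring
  have e2 : ((univ : Finset (Fin n × Fin (n - 1))).powersetCard (2 * m)).filter (fun S => (fun i => (S ∩ AB n i).card) ∈ TS n m d L) = ((univ : Finset (Fin n × Fin (n - 1))).powersetCard (2 * m)).filter (fun S => ((∀ i, |((S ∩ AB n i).card : ℝ) - d| ≤ L) ∧ ∑ i, (((S ∩ AB n i).card : ℝ) - d) ^ 2 ≤ 2 * n * d)) := by
    apply filter_congr
    intro S hS
    exact (BL_B n).TPiff (m := m) (by ring) hS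
  have d0 := c.d0
  have lam0 := c.toPR.lam0; have lam2 := c.toPR.lam2
  have vb := varB (n := (n : ℝ)) (k := lam / d ^ 2) _ (fun S : Finset (Fin n × Fin (n - 1)) => ∑ i, (((S ∩ AB n i).card : ℝ) - d) ^ 2) (by linarith) C0 (by rw [card_powersetCard]) mainv
    (by
      have h1 : lam ≤ 2 * (d / ((n : ℝ) - 1)) := by
        refine lam2.trans (le_of_eq ?_); rw [← hdμ]; field_simp [show (n : ℝ) - 1 ≠ 0 by linarith]
      have h2 : d / ((n : ℝ) - 1) ≤ 2 * (d / n) := by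
        rw [div_le_iff₀ (by linarith)];
        have : 2 * (d / (n : ℝ)) * (n - 1) = d * (2 - 2 / n) := by field_simp
        rw [this]
        have : 2 / (n : ℝ) ≤ 1 := by rw [div_le_one (by linarith)]; linarith
        nlinarith
      have h3 : lam ≤ 4 * (d / n) := by linarith
      calc (lam / d ^ 2) ^ 2 * ((n : ℝ) * d ^ 2) ≤ (4 * (d / n) / d ^ 2) ^ 2 * ((n : ℝ) * d ^ 2) := by gcongr
        _ = 16 / (n : ℝ) := by field_simp; norm_num)
    (by
      rw [kq (by linarith) d0 hdμ (by linarith) c.hlam, abs_of_pos (by positivity)]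
      apply one_div_le_one_div_of_le (by linarith); nlinarith)
  have := good_bad ((univ : Finset (Fin n × Fin (n - 1))).powersetCard (2 * m)) (fun S => ((∀ i, |((S ∩ AB n i).card : ℝ) - d| ≤ L) ∧ ∑ i, (((S ∩ AB n i).card : ℝ) - d) ^ 2 ≤ 2 * n * d)) (fun S => Real.exp (1 / 4 - gQ n d lam (fun i => (S ∩ AB n i).card) ^ 2 / 4)) C0 (by rw [card_powersetCard]) main (b := 34 / Real.sqrt n) (by
      refine le_trans (sum_le_sum fun S _ => lip ?_) vb
      unfold gQ; positivity)
  rw [← e2, ← e] at this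
  exact this

lemma final_bound (c : CX n d e μ ν h lam L J) (hn : 30000 ≤ n) {m k : ℕ} (hd : n * d = 2 * m) (hk : 3 * k + 3 ≤ J)
    (hL : Real.exp (-(L ^ 2 / (4 * (d + L)))) ≤ 1 / (n : ℝ) ^ 2) {x : ℝ}
    (hx : 3 * n * Real.sqrt d * (140 * (μ * (1 + e) ^ 2) * (1 / 2) ^ k + 90270 * (μ * (1 + e) ^ 2 * e * ν)) ≤ x) (hx2 : x ≤ 1 / 2)
    {D : Fin n → ℕ} (hD : TP n m d L D) :
    0 < Phi n m d lam D ∧ |prG n m D / Phi n m d lam D - 1| ≤ 3 * x + 80 / Real.sqrt n := by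
  have hn' : (30000 : ℝ) ≤ n := by exact_mod_cast hn
  obtain ⟨m1, m2, m3⟩ := m_small c hn hd
  have C0 : (0 : ℝ) < (n * (n - 1)).choose (2 * m) := by exact_mod_cast Nat.choose_pos (by omega)
  have C1 : (0 : ℝ) < (UG n).card.choose m := by exact_mod_cast Nat.choose_pos (by rw [card_UG]; omega)
  have pos : ∀ D ∈ TS n m d L, 0 < Phi n m d lam D := by
    intro D hD
    rw [mem_TS] at hD
    have t := hD.tt hd
    rw [Phi_Psi hD.1]
    exact mul_pos (div_pos (Real.exp_pos _) C0) (Psi_pos c t.nn t.dev)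
  have s0 : 160 ≤ Real.sqrt n := Real.le_sqrt_of_sq_le (by norm_num; linarith)
  have sn : 1 / (n : ℝ) ≤ 1 / (160 * Real.sqrt n) := by
    apply one_div_le_one_div_of_le (by positivity)
    nlinarith [Real.sq_sqrt (show (0 : ℝ) ≤ n by linarith)]
  have sn' : 4 / (n : ℝ) ≤ (1 / 40) / Real.sqrt n := by
    calc 4 / (n : ℝ) = 4 * (1 / n) := by ring
      _ ≤ 4 * (1 / (160 * Real.sqrt n)) := by gcongr
      _ = _ := by field_simp; norm_num
  have i0 : 1 / Real.sqrt n ≤ 1 / 160 := one_div_le_one_div_of_le (by norm_num) s0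
  have i1 : 34 / Real.sqrt n = 34 * (1 / Real.sqrt n) := by ring
  have i2 : (1 / 40) / Real.sqrt n = (1 / 40) * (1 / Real.sqrt n) := by ring
  have i3 : 80 / Real.sqrt n = 80 * (1 / Real.sqrt n) := by ring
  have i4 : 0 < 1 / Real.sqrt n := by positivity
  have x0 : 0 ≤ x := le_trans (by have := c.toPR.e0; have := c.hμ0; have := c.toPR.ν0; positivity) hx
  refine ⟨pos D (mem_TS.2 hD), ?_⟩
  obtain ⟨g1, g2⟩ := sumG c hn hd hL
  have b := sumB c hn hd hL
  have := norm_final (TS n m d L) (prG n m) (Phi n m d lam) x0 hx2 (al := 4 / n) (be := 34 / Real.sqrt n + 4 / n) (by positivity) (by positivity) (by rw [i1]; linarith)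
    (fun D _ => by unfold prG; positivity) pos (by
      intro D hD D' hD'
      rw [mem_TS] at hD hD'
      have cmp := compare c hk (hD.tt hd) (hD'.tt hd) (by have := hD.1.trans hD'.1.symm; exact_mod_cast this)
      rw [Phi_Psi hD.1, Phi_Psi hD'.1, prG_NN hD.1, prG_NN hD'.1]
      have E0 : 0 < Real.exp (1 / 4) / ((n * (n - 1)).choose (2 * m) : ℝ) := div_pos (Real.exp_pos _) C0
      generalize Real.exp (1 / 4) / ((n * (n - 1)).choose (2 * m) : ℝ) = c1 at *
      have pD := Psi_pos c (hD.tt hd).nn (hD.tt hd).dev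
      have hN : 0 ≤ NN (fun i => (D' i : ℤ)) := by unfold NN; positivity
      have cmp2 := cmp.trans (mul_le_mul_of_nonneg_right (Real.exp_le_exp.2 hx) (mul_nonneg hN pD.le))
      have := mul_le_mul_of_nonneg_left cmp2 (show 0 ≤ c1 / ((UG n).card.choose m : ℝ) by positivity)
      calc _ = c1 / ((UG n).card.choose m : ℝ) * (NN (fun i => (D i : ℤ)) * Psi n d lam (fun i => (D' i : ℤ))) := by ring
        _ ≤ _ := this
        _ = _ := by ring) g1 g2 b (mem_TS.2 hD)
  refine this.trans ?_
  linarith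
end

section
lemma ebA {C1 Λ d : ℝ} (hC : 1 ≤ C1) (hΛ : 1 ≤ Λ) (h : Λ ≤ d) :
    Real.sqrt d * (2 * (C1 * Real.sqrt ((d + Λ) * Λ)) / d) ≤ 3 * C1 * Real.sqrt Λ ∧ 2 * (C1 * Real.sqrt ((d + Λ) * Λ)) / d ≤ 3 * C1 := by
  have d0 : 0 < d := by linarith
  have hr : Real.sqrt ((d + Λ) * Λ) ≤ 1.5 * (Real.sqrt d * Real.sqrt Λ) := by
    rw [← Real.sqrt_mul d0.le]
    rw [Real.sqrt_le_iff]
    refine ⟨by positivity, ?_⟩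
    rw [mul_pow, Real.sq_sqrt (by positivity)]
    nlinarith
  have s0 := Real.sqrt_pos.2 d0
  have ss := Real.mul_self_sqrt d0.le
  have st : Real.sqrt Λ ≤ Real.sqrt d := Real.sqrt_le_sqrt h
  have t0 := Real.sqrt_nonneg Λ
  generalize Real.sqrt ((d + Λ) * Λ) = r at *
  generalize Real.sqrt d = s at *
  generalize Real.sqrt Λ = t at *
  have h1 : 2 * (C1 * r) ≤ 3 * C1 * (s * t) := by nlinarith
  constructor
  · rw [mul_div_assoc', div_le_iff₀ d0, ← ss]
    calc s * (2 * (C1 * r)) ≤ s * (3 * C1 * (s * t)) := by gcongr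
      _ = _ := by ring
  · rw [div_le_iff₀ d0, ← ss]
    calc 2 * (C1 * r) ≤ 3 * C1 * (s * t) := h1
      _ ≤ 3 * C1 * (s * s) := by gcongr

lemma ebB {C1 Λ d : ℝ} (hC : 1 ≤ C1) (hΛ : 1 ≤ Λ) (d1 : 1 ≤ d) (h : d ≤ Λ) :
    2 * (C1 * Real.sqrt ((d + Λ) * Λ)) / d ≤ 3 * C1 * Λ := by
  have d0 : 0 < d := by linarith
  have hr : Real.sqrt ((d + Λ) * Λ) ≤ 1.5 * Λ := by
    rw [Real.sqrt_le_iff]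
    refine ⟨by positivity, ?_⟩
    nlinarith
  rw [div_le_iff₀ d0]
  have : 2 * (C1 * Real.sqrt ((d + Λ) * Λ)) ≤ 3 * C1 * Λ := by nlinarith
  have h2 : 0 ≤ 3 * C1 * Λ := by positivity
  nlinarith

lemma small_bd {C1 Λ d e μ n η : ℝ} (hC : 1 ≤ C1) (hΛ : 1 ≤ Λ) (d1 : 1 ≤ d) (n0 : 0 < n) (e0 : 0 ≤ e) (μ0 : 0 ≤ μ)
    (hμn : μ * n ≤ 2 * d) (hμ : μ * Real.sqrt Λ ≤ η) (hΛn : Λ ^ 6 ≤ η * n) (hη : 512 * C1 ^ 4 * η ≤ 1 / 100000)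
    (hA : Λ ≤ d → e ≤ 3 * C1) (hB : d ≤ Λ → e ≤ 3 * C1 * Λ) : μ * (1 + e) ^ 4 ≤ 1 / 100000 := by
  rcases le_total Λ d with h | h
  · have h1 : 1 + e ≤ 4 * C1 := by have := hA h; linarith
    have h2 : μ ≤ η := by
      have : 1 ≤ Real.sqrt Λ := Real.one_le_sqrt.2 hΛ
      nlinarith
    have h3 : 0 ≤ η := μ0.trans h2
    calc μ * (1 + e) ^ 4 ≤ η * (4 * C1) ^ 4 := by gcongr
      _ = 256 * C1 ^ 4 * η := by ring
      _ ≤ 512 * C1 ^ 4 * η := by gcongr; norm_num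
      _ ≤ _ := hη
  · have h1 : 1 + e ≤ 4 * C1 * Λ := by have := hB h; nlinarith
    have h2 : μ ≤ 2 * Λ / n := by rw [le_div_iff₀ n0]; linarith
    calc μ * (1 + e) ^ 4 ≤ (2 * Λ / n) * (4 * C1 * Λ) ^ 4 := by gcongr
      _ = 512 * C1 ^ 4 * (Λ ^ 5 / n) := by ring
      _ ≤ 512 * C1 ^ 4 * η := by
          gcongr
          rw [div_le_iff₀ n0]
          refine le_trans ?_ hΛn
          exact pow_le_pow_right₀ hΛ (by norm_num)
      _ ≤ _ := hη

lemma second_bd {C1 Λ d e μ ν n η : ℝ} (hC : 1 ≤ C1) (hΛ : 1 ≤ Λ) (d1 : 1 ≤ d) (n0 : 0 < n) (e0 : 0 ≤ e)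
    (ν0 : 0 ≤ ν) (hν : ν * n ≤ 2) (hμ : μ = d * ν) (hΛn : Λ ^ 6 ≤ η * n) (hη : η ≤ 1)
    (hA : Λ ≤ d → Real.sqrt d * e ≤ 3 * C1 * Real.sqrt Λ ∧ e ≤ 3 * C1) (hB : d ≤ Λ → e ≤ 3 * C1 * Λ) :
    n * Real.sqrt d * (μ * (1 + e) ^ 2 * e * ν) ≤ 192 * C1 ^ 3 * (1 / Real.sqrt d + d * Real.sqrt Λ / n) := by
  have d0 : 0 < d := by linarith
  have s0 := Real.sqrt_pos.2 d0
  have s1 : 1 ≤ Real.sqrt d := Real.one_le_sqrt.2 d1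
  have ss := Real.mul_self_sqrt d0.le
  have hν' : ν ≤ 2 / n := by rw [le_div_iff₀ n0]; exact hν
  have e1 : n * Real.sqrt d * (μ * (1 + e) ^ 2 * e * ν) ≤ 4 / n * (d * (Real.sqrt d * e) * (1 + e) ^ 2) := by
    calc n * Real.sqrt d * (μ * (1 + e) ^ 2 * e * ν) = n * ν * ν * (d * (Real.sqrt d * e) * (1 + e) ^ 2) := by rw [hμ]; ring
      _ ≤ n * (2 / n) * (2 / n) * (d * (Real.sqrt d * e) * (1 + e) ^ 2) := by gcongr
      _ = _ := by field_simp; ring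
  refine e1.trans ?_
  rcases le_total Λ d with h | h
  · obtain ⟨a1, a2⟩ := hA h
    have h1 : 1 + e ≤ 4 * C1 := by linarith
    calc 4 / n * (d * (Real.sqrt d * e) * (1 + e) ^ 2) ≤ 4 / n * (d * (3 * C1 * Real.sqrt Λ) * (4 * C1) ^ 2) := by gcongr
      _ = 192 * C1 ^ 3 * (0 + d * Real.sqrt Λ / n) := by ring
      _ ≤ _ := by gcongr; positivity
  · have a2 := hB h
    have h1 : 1 + e ≤ 4 * C1 * Λ := by nlinarith
    have h2 : Real.sqrt d ≤ Λ := by nlinarith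
    calc 4 / n * (d * (Real.sqrt d * e) * (1 + e) ^ 2) ≤ 4 / n * (Λ * (Λ * (3 * C1 * Λ)) * (4 * C1 * Λ) ^ 2) := by gcongr
      _ = 192 * C1 ^ 3 * (Λ ^ 5 / n + 0) := by ring
      _ ≤ _ := by
          apply mul_le_mul_of_nonneg_left _ (by positivity)
          apply add_le_add
          · rw [div_le_div_iff₀ n0 s0]
            calc Λ ^ 5 * Real.sqrt d ≤ Λ ^ 5 * Λ := by gcongr
              _ = Λ ^ 6 := by ring
              _ ≤ η * n := hΛn
              _ ≤ 1 * n := by gcongr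
          · positivity

lemma two_pow {n Λ : ℝ} (n0 : 0 < n) (hΛ : Λ = Real.log n) (Λ0 : 0 ≤ Λ) {k : ℕ} (hk : 5 * Λ ≤ k) : ((1 : ℝ) / 2) ^ k ≤ 1 / n ^ 3 := by
  have h1 : n = Real.exp Λ := by rw [hΛ, Real.exp_log n0]
  have h2 : (1 : ℝ) / n ^ 3 = Real.exp (-(3 * Λ)) := by
    rw [h1, ← Real.exp_nat_mul, Real.exp_neg]; norm_num
  rw [h2, show ((1 : ℝ) / 2) ^ k = Real.exp (-(k * Real.log 2)) by
    rw [Real.exp_neg, Real.exp_nat_mul, Real.exp_log (by norm_num)]; simp]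
  apply Real.exp_le_exp.2
  have := Real.log_two_gt_d9
  have : (5 * Λ) * 0.69 ≤ k * Real.log 2 := by gcongr; linarith
  linarith

lemma first_bd {n d y p : ℝ} (n0 : 1 ≤ n) (d1 : 1 ≤ d) (dn : d ≤ n) (y0 : 0 ≤ y) (hy : y ≤ 1 / 100000) (hp0 : 0 ≤ p) (hp : p ≤ 1 / n ^ 3) :
    3 * n * Real.sqrt d * (140 * y * p) ≤ 1 / Real.sqrt d := by
  have d0 : 0 < d := by linarith
  have s0 := Real.sqrt_pos.2 d0
  have ss := Real.mul_self_sqrt d0.le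
  rw [le_div_iff₀ s0]
  calc 3 * n * Real.sqrt d * (140 * y * p) * Real.sqrt d = 420 * n * (Real.sqrt d * Real.sqrt d) * y * p := by ring
    _ = 420 * n * d * y * p := by rw [ss]
    _ ≤ 420 * n * n * (1 / 100000) * (1 / n ^ 3) := by gcongr
    _ = 0.0042 * (1 / n) := by field_simp; norm_num
    _ ≤ 0.0042 * 1 := by gcongr; rw [div_le_one (by linarith)]; exact n0
    _ ≤ 1 := by norm_num

lemma L_tail {n Λ d L C1 : ℝ} (hC : 40 ≤ C1) (n0 : 0 < n) (hΛ : Λ = Real.log n) (Λ1 : 1 ≤ Λ) (d1 : 1 ≤ d) (hL : L = C1 * Real.sqrt ((d + Λ) * Λ)) :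
    C1 * Λ ≤ L ∧ C1 * Real.sqrt (d * Λ) ≤ L ∧ Real.exp (-(L ^ 2 / (4 * (d + L)))) ≤ 1 / n ^ 2 := by
  have a1 : C1 * Λ ≤ L := by
    rw [hL]; gcongr
    apply Real.le_sqrt_of_sq_le; nlinarith
  refine ⟨a1, ?_, ?_⟩
  · rw [hL]; gcongr; linarith
  · have h1 : n = Real.exp Λ := by rw [hΛ, Real.exp_log n0]
    have h2 : (1 : ℝ) / n ^ 2 = Real.exp (-(2 * Λ)) := by
      rw [h1, ← Real.exp_nat_mul, Real.exp_neg]; norm_num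
    rw [h2]
    apply Real.exp_le_exp.2
    have L0 : 0 < L := lt_of_lt_of_le (by positivity) a1
    rw [neg_le_neg_iff, le_div_iff₀ (by positivity)]
    have h3 : L ^ 2 = C1 ^ 2 * ((d + Λ) * Λ) := by rw [hL, mul_pow, Real.sq_sqrt (by positivity)]
    have h4 : 16 * (d * Λ) ≤ L ^ 2 := by
      rw [h3]
      have : (1600 : ℝ) ≤ C1 ^ 2 := by nlinarith
      have : 1600 * (d * Λ) ≤ C1 ^ 2 * ((d + Λ) * Λ) := by
        apply mul_le_mul this (by nlinarith) (by positivity) (by positivity)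
      have : 0 < d * Λ := by positivity
      linarith
    have h5 : 16 * Λ * L ≤ L ^ 2 := by
      have : 16 * Λ ≤ L := by nlinarith
      nlinarith
    linarith

set_option maxHeartbeats 1000000 in
lemma core {n m : ℕ} {C1 Λ d μ η : ℝ} (hC : 40 ≤ C1) (hn : 30000 ≤ n) (hΛ : Λ = Real.log n) (Λ1 : 1 ≤ Λ) (d1 : 1 ≤ d)
    (hd : n * d = 2 * m) (hμ : ((n : ℝ) - 1) * μ = d) (hη : η = 1 / (1000000000 * C1 ^ 4)) (h1 : 1 / Real.sqrt d ≤ η) (h2 : μ * Real.sqrt Λ ≤ η)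
    (h3 : Λ ^ 6 ≤ η * n) {D : Fin n → ℕ} (hD : ∑ i, D i = 2 * m) (hD2 : ∀ i, |(D i : ℝ) - d| ≤ C1 * Real.sqrt (d * Λ))
    (hD3 : ∑ i, ((D i : ℝ) - d) ^ 2 ≤ 2 * n * d) :
    μ < 1 ∧ 0 < Phi n m d (μ / (1 - μ)) D ∧ |prG n m D / Phi n m d (μ / (1 - μ)) D - 1| ≤ 200000000 * C1 ^ 3 * (1 / Real.sqrt d + d * Real.sqrt Λ / n) := by
  have hn' : (30000 : ℝ) ≤ n := by exact_mod_cast hn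
  have n0 : (0 : ℝ) < n := by linarith
  have n1 : (0 : ℝ) < (n : ℝ) - 1 := by linarith
  have d0 : 0 < d := by linarith
  have hμe : μ = d * (1 / ((n : ℝ) - 1)) := by rw [← hμ]; field_simp
  have μ0 : 0 < μ := by rw [hμe]; positivity
  have C10 : 0 < C1 := by linarith
  have Cp : 1 ≤ C1 ^ 3 := one_le_pow₀ (by linarith)
  have ηp : 0 < η := by rw [hη]; positivity
  have η1 : 512 * C1 ^ 4 * η ≤ 1 / 100000 := by
    rw [hη]; field_simp; norm_num
  have η2 : 1000000000 * C1 ^ 3 * η ≤ 1 / 40 := by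
    have : 1000000000 * C1 ^ 3 * η = 1 / C1 := by rw [hη]; field_simp
    rw [this]; exact one_div_le_one_div_of_le (by norm_num) hC
  have η3 : η ≤ 1 / 1000000000 := by
    have := mul_le_mul_of_nonneg_right Cp ηp.le
    linarith
  have η4 : 1000000000 * C1 * η ≤ 1 := by
    have h4 : C1 ≤ C1 ^ 3 := le_self_pow₀ (by linarith) (by norm_num)
    have : 1000000000 * C1 * η ≤ 1000000000 * C1 ^ 3 * η := by gcongr
    linarith
  have sΛ : 1 ≤ Real.sqrt Λ := Real.one_le_sqrt.2 Λ1
  have μη : μ ≤ η := (le_mul_of_one_le_right μ0.le sΛ).trans h2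
  have μ1 : μ < 1 := by linarith
  obtain ⟨L, hL⟩ : ∃ L, L = C1 * Real.sqrt ((d + Λ) * Λ) := ⟨_, rfl⟩
  obtain ⟨t1, t2, t3⟩ := L_tail hC n0 hΛ Λ1 d1 hL
  have L0 : 0 < L := lt_of_lt_of_le (by positivity) t1
  have L40 : 40 * Λ ≤ L := le_trans (by gcongr) t1
  obtain ⟨e, he⟩ : ∃ e, e = 2 * L / d := ⟨_, rfl⟩
  have e0 : 0 < e := by rw [he]; positivity
  have hA : Λ ≤ d → Real.sqrt d * e ≤ 3 * C1 * Real.sqrt Λ ∧ e ≤ 3 * C1 := by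
    intro h; rw [he, hL]; exact ebA (by linarith) Λ1 h
  have hB : d ≤ Λ → e ≤ 3 * C1 * Λ := by
    intro h; rw [he, hL]; exact ebB (by linarith) Λ1 d1 h
  have hE : e ≤ 3 * C1 * Λ := by
    rcases le_total Λ d with h | h
    · exact (hA h).2.trans (le_mul_of_one_le_right (by positivity) Λ1)
    · exact hB h
  have dn : d ≤ n := by
    have := mul_le_mul_of_nonneg_left μ1.le n1.le
    linarith
  have sm := small_bd (C1 := C1) (n := n) (by linarith) Λ1 d1 n0 e0.le μ0.le (by have := mul_nonneg (show 0 ≤ (n : ℝ) - 2 by linarith) μ0.le; linarith) h2 h3 η1 (fun h => (hA h).2) hB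
  obtain ⟨k, hk⟩ : ∃ k, k = ⌈5 * Λ⌉₊ := ⟨_, rfl⟩
  have k1 : 5 * Λ ≤ k := by rw [hk]; exact Nat.le_ceil _
  have k2 : (k : ℝ) ≤ 5 * Λ + 1 := by rw [hk]; exact (Nat.ceil_lt_add_one (by positivity)).le
  have c : CX n d e μ (1 / ((n : ℝ) - 1)) (1 / d) (μ / (1 - μ)) L (3 * k + 3) := by
    refine { n2 := by omega, hμ0 := μ0, d1 := d1, hd := by field_simp, he := ?_, hν := ?_, hnν := by field_simp, hlam := ?_, small := sm, hL := ?_, hJ := ?_, hq := ?_ }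
    · rw [he]; gcongr; linarith
    · rw [hμe]; field_simp
    · rw [div_mul_cancel₀]; linarith
    · rw [he]; field_simp
    · push_cast; linarith
    · push_cast
      have hLe : L = e * d / 2 := by rw [he]; field_simp
      have hJ : (3 * (k : ℝ) + 3) ≤ 21 * Λ := by linarith
      have h6 : Λ ^ 2 ≤ η * n := le_trans (pow_le_pow_right₀ Λ1 (by norm_num)) h3
      rw [hLe]
      calc 5 * (e * d / 2) * (3 * (k : ℝ) + 3) ≤ 5 * (3 * C1 * Λ * d / 2) * (21 * Λ) := by gcongr
        _ = 157.5 * C1 * Λ ^ 2 * d := by ring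
        _ ≤ 157.5 * C1 * (η * n) * d := by gcongr
        _ = 157.5 * C1 * η * (n * d) := by ring
        _ ≤ 1 * (n * d) := by gcongr; linarith [mul_pos C10 ηp]
        _ = _ := one_mul _
  have b2 := second_bd (C1 := C1) (n := n) (μ := μ) (ν := 1 / ((n : ℝ) - 1)) (by linarith) Λ1 d1 n0 e0.le (by positivity) (by
    rw [one_div_mul_eq_div, div_le_iff₀ n1]; linarith) hμe h3 (by linarith) hA hB
  have b1 := first_bd (n := n) (by linarith) d1 dn (by positivity : 0 ≤ μ * (1 + e) ^ 2) (c.toPR.μk 2 (by norm_num)) (by positivity) (two_pow n0 hΛ (by linarith) k1)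
  have i0 : 0 < 1 / Real.sqrt d := by positivity
  have i1 : 0 ≤ d * Real.sqrt Λ / n := by positivity
  obtain ⟨T, hT⟩ : ∃ T, T = 1 / Real.sqrt d + d * Real.sqrt Λ / n := ⟨_, rfl⟩
  have i2 : d * Real.sqrt Λ / n ≤ η := by
    rw [div_le_iff₀ n0]
    calc d * Real.sqrt Λ = ((n : ℝ) - 1) * (μ * Real.sqrt Λ) := by rw [← hμ]; ring
      _ ≤ ((n : ℝ) - 1) * η := by gcongr
      _ ≤ η * n := by linarith
  rw [← hT] at b2 ⊢
  have T1 : 1 / Real.sqrt d ≤ T := by rw [hT]; linarith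
  have T2 : T ≤ 2 * η := by rw [hT]; linarith
  have T0 : 0 < T := by linarith
  have hx : 3 * n * Real.sqrt d * (140 * (μ * (1 + e) ^ 2) * (1 / 2) ^ k + 90270 * (μ * (1 + e) ^ 2 * e * (1 / ((n : ℝ) - 1)))) ≤ 60000000 * C1 ^ 3 * T := by
    calc _ = 3 * n * Real.sqrt d * (140 * (μ * (1 + e) ^ 2) * (1 / 2) ^ k) + 270810 * (n * Real.sqrt d * (μ * (1 + e) ^ 2 * e * (1 / ((n : ℝ) - 1)))) := by ring
      _ ≤ 1 * T + 270810 * (192 * C1 ^ 3 * T) := by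
          rw [one_mul]; gcongr; exact b1.trans T1
      _ ≤ C1 ^ 3 * T + 270810 * (192 * C1 ^ 3 * T) := by gcongr
      _ ≤ _ := by have : 0 < C1 ^ 3 * T := by positivity
                  linarith
  have hx2 : 60000000 * C1 ^ 3 * T ≤ 1 / 2 := by
    calc 60000000 * C1 ^ 3 * T ≤ 60000000 * C1 ^ 3 * (2 * η) := by gcongr
      _ ≤ 1 / 2 := by have : 0 < C1 ^ 3 * η := by positivity
                      linarith
  obtain ⟨f1, f2⟩ := final_bound c hn hd le_rfl t3 hx hx2 (D := D) ⟨hD, fun i => (hD2 i).trans t2, hD3⟩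
  refine ⟨μ1, f1, f2.trans ?_⟩
  have i3 : 80 / Real.sqrt n ≤ 80 * T := by
    calc 80 / Real.sqrt n = 80 * (1 / Real.sqrt n) := by ring
      _ ≤ 80 * (1 / Real.sqrt d) := by
          gcongr
      _ ≤ _ := by gcongr
  have i4 : 80 * T ≤ 80 * (C1 ^ 3 * T) := by
    have : T ≤ C1 ^ 3 * T := le_mul_of_one_le_left T0.le Cp
    linarith
  have : 0 < C1 ^ 3 * T := by positivity
  linarith
end

lemma eventual {η K : ℝ} (hη : 0 < η) (hK : 0 < K) : ∃ n₀ : ℕ, ∀ n : ℕ, n₀ ≤ n →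
    30000 ≤ n ∧ 1 ≤ Real.log n ∧ 2 / η ^ 2 ≤ Real.log n ^ K ∧ Real.log n ^ (-(1 / 4) : ℝ) ≤ η ∧ Real.log n ^ 6 ≤ η * n := by
  have hl : Filter.Tendsto (fun n : ℕ => Real.log n) Filter.atTop Filter.atTop := Real.tendsto_log_atTop.comp tendsto_natCast_atTop_atTop
  have a1 := Filter.eventually_ge_atTop (α := ℕ) 30000
  have a2 := hl.eventually_ge_atTop 1
  have a3 := ((tendsto_rpow_atTop hK).comp hl).eventually_ge_atTop (2 / η ^ 2)
  have a4 := ((tendsto_rpow_neg_atTop (y := 1 / 4) (by norm_num)).comp hl).eventually_le_const hη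
  have a5 := ((Real.isLittleO_pow_log_id_atTop (n := 6)).comp_tendsto tendsto_natCast_atTop_atTop).bound hη
  obtain ⟨n₀, h⟩ := Filter.eventually_atTop.1 (a1.and (a2.and (a3.and (a4.and a5))))
  refine ⟨n₀, fun n hn => ?_⟩
  obtain ⟨b1, b2, b3, b4, b5⟩ := h n hn
  refine ⟨b1, b2, b3, b4, ?_⟩
  simp only [Function.comp_apply, id, Real.norm_eq_abs] at b5
  rw [abs_of_nonneg (Nat.cast_nonneg n : (0 : ℝ) ≤ n)] at b5
  exact (le_abs_self _).trans b5

lemma gam {n S d μ : ℝ} (n1 : 1 < n) (μ0 : 0 < μ) (μ1 : μ < 1) (hμ : (n - 1) * μ = d) :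
    (S / (n - 1) ^ 2) ^ 2 / (4 * μ ^ 2 * (1 - μ) ^ 2) = (μ / (1 - μ) / d ^ 2 * S) ^ 2 / 4 := by
  have h1 : n - 1 ≠ 0 := by linarith
  have h2 : 1 - μ ≠ 0 := by linarith
  rw [← hμ]; field_simp

theorem gap_range_enumeration :
    ∀ C : ℝ, 2 ≤ C →
      ∃ A : ℝ, 0 < A ∧
        ∀ K δ : ℝ, 0 < K → 0 < δ → δ < 1 →
          ∃ n₀ : ℕ, ∀ n : ℕ, n₀ ≤ n → ∀ m : ℕ,
            let d : ℝ := 2 * (m : ℝ) / (n : ℝ)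
            let μ : ℝ := d / ((n : ℝ) - 1)
            Real.log n ^ K / n < μ → μ ≤ δ * Real.log n ^ (-(3 : ℝ) / 4) →
            ∀ D : Fin n → ℕ, (∑ i, D i) = 2 * m →
              (∀ i, |(D i : ℝ) - d| ≤ C * Real.sqrt (d * Real.log n)) →
              ((∑ i, ((D i : ℝ) - d) ^ 2) / n ≤ 2 * d) →
              let γ₂ : ℝ := (∑ i, ((D i : ℝ) - d) ^ 2) / ((n : ℝ) - 1) ^ 2
              ∃ E : ℝ,
                |E| ≤ A * (1 / Real.sqrt d + d * Real.sqrt (Real.log n) / n +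
                  d ^ 2 * Real.log n ^ ((3 : ℝ) / 2) / (n : ℝ) ^ 2) ∧
                prG n m D = prB n m D *
                  Real.exp (1 / 4 - γ₂ ^ 2 / (4 * μ ^ 2 * (1 - μ) ^ 2)) * (1 + E) := by
  intro C hC
  obtain ⟨C1, hC1⟩ : ∃ C1, C1 = C + 40 := ⟨_, rfl⟩
  have C10 : 0 < C1 := by linarith
  refine ⟨200000000 * C1 ^ 3, by positivity, ?_⟩
  intro K δ hK δ0 δ1
  obtain ⟨η, hη⟩ : ∃ η, η = 1 / (1000000000 * C1 ^ 4) := ⟨_, rfl⟩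
  have ηp : 0 < η := by rw [hη]; positivity
  have η1 : η ≤ 1 := by
    rw [hη, div_le_one (by positivity)]
    have : 1 ≤ C1 ^ 4 := one_le_pow₀ (by linarith)
    linarith
  obtain ⟨n₀, hn₀⟩ := eventual ηp hK
  refine ⟨n₀, ?_⟩
  intro n hn m d μ hlo hup D hD hD2 hD3 γ₂
  obtain ⟨b1, b2, b3, b4, b5⟩ := hn₀ n hn
  obtain ⟨Λ, hΛ⟩ : ∃ Λ, Λ = Real.log n := ⟨_, rfl⟩
  rw [← hΛ] at hlo hup hD2 b2 b3 b4 b5 ⊢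
  have hn' : (30000 : ℝ) ≤ n := by exact_mod_cast b1
  have n0 : (0 : ℝ) < n := by linarith
  have n1 : (0 : ℝ) < (n : ℝ) - 1 := by linarith
  have Λ0 : 0 < Λ := by linarith
  have hd : n * d = 2 * m := by simp only [d]; field_simp
  have hμ : ((n : ℝ) - 1) * μ = d := by simp only [μ]; field_simp
  have hγ : γ₂ = (∑ i, ((D i : ℝ) - d) ^ 2) / ((n : ℝ) - 1) ^ 2 := rfl
  clear_value γ₂ μ d
  have μ0 : 0 < μ := lt_of_le_of_lt (by positivity) hlo
  have dη : 1 / η ^ 2 ≤ d := by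
    rw [div_lt_iff₀ n0] at hlo
    have : μ * n ≤ 2 * d := by rw [← hμ]; nlinarith
    have e : 2 / η ^ 2 = 2 * (1 / η ^ 2) := by ring
    rw [e] at b3
    linarith
  have d1 : 1 ≤ d := by
    refine le_trans ?_ dη
    rw [le_div_iff₀ (by positivity), one_mul]
    exact pow_le_one₀ ηp.le η1
  have d0 : 0 < d := by linarith
  have h1 : 1 / Real.sqrt d ≤ η := by
    rw [div_le_iff₀ (Real.sqrt_pos.2 d0), mul_comm, ← div_le_iff₀ ηp]
    apply Real.le_sqrt_of_sq_le
    rw [div_pow, one_pow]; exact dη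
  have h2 : μ * Real.sqrt Λ ≤ η := by
    refine le_trans ?_ b4
    rw [Real.sqrt_eq_rpow]
    calc μ * Λ ^ (1 / 2 : ℝ) ≤ (δ * Λ ^ (-(3 : ℝ) / 4)) * Λ ^ (1 / 2 : ℝ) := by gcongr
      _ ≤ (1 * Λ ^ (-(3 : ℝ) / 4)) * Λ ^ (1 / 2 : ℝ) := by gcongr
      _ = Λ ^ (-(1 / 4) : ℝ) := by rw [one_mul, ← Real.rpow_add Λ0]; norm_num
  obtain ⟨μ1, f1, f2⟩ := core (by linarith) b1 hΛ b2 d1 hd hμ hη h1 h2 b5 hD (fun i => (hD2 i).trans (by gcongr; linarith)) (by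
    rw [div_le_iff₀ n0] at hD3; linarith)
  refine ⟨prG n m D / Phi n m d (μ / (1 - μ)) D - 1, f2.trans ?_, ?_⟩
  · apply mul_le_mul_of_nonneg_left _ (by positivity)
    have : 0 ≤ d ^ 2 * Λ ^ ((3 : ℝ) / 2) / (n : ℝ) ^ 2 := by positivity
    linarith
  · rw [hγ, gam (by linarith) μ0 μ1 hμ]
    change _ = Phi n m d (μ / (1 - μ)) D * _
    field_simp
    ring
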